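/- There exist constants C > 0 and K > 0 such that for all real numbers A and B ≥ 3 satisfying B²(log B) < A ≤ B³(log B)⁻⁴(log log B)⁻¹, one has Σ_{a ∈ 𝕃(A)} |N_a(B) − N_a^loc(B)|² ≤ K·A²B⁶/(log log B)^C. -/

import Mathlib

open Filter MeasureTheory Finset Topology
open scoped ENNReal

noncomputable section

/-- Euclidean norm of an integer quadruple. -/
def znorm (a : Fin 4 → ℤ) : ℝ := Real.sqrt (∑ i, ((a i : ℝ)) ^ 2)

/-- Euclidean norm of a natural-number quadruple. -/
def pnorm (x : Fin 4 → ℕ) : ℝ := Real.sqrt (∑ i, ((x i : ℝ)) ^ 2)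

/-- Sup-norm `|a| = maxᵢ |aᵢ|` of an integer quadruple. -/
def snorm (a : Fin 4 → ℤ) : ℕ := Finset.univ.sup fun i => (a i).natAbs

/-- Min of the absolute values of the coordinates. -/
def minAbs (a : Fin 4 → ℤ) : ℕ := Finset.univ.inf' Finset.univ_nonempty fun i => (a i).natAbs

/-- `a` is primitive: all coordinates nonzero and gcd of the coordinates is 1. -/
def IsPrimitive (a : Fin 4 → ℤ) : Prop := (∀ i, a i ≠ 0) ∧ Finset.univ.gcd a = 1

/-- `a` is locally solvable: it is primitive, its coordinates are not all of the same
sign, and for every prime `p` the congruence `⟨a,x⟩ ≡ 0 (mod p)` has a solution in the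
reduced residues mod `p`. -/
def IsLocSolv (a : Fin 4 → ℤ) : Prop :=
  IsPrimitive a ∧ ¬ ((∀ i, 0 < a i) ∨ (∀ i, a i < 0)) ∧
  ∀ p : ℕ, p.Prime → ∃ x : Fin 4 → (ZMod p)ˣ,
    ∑ i, (a i : ZMod p) * ((x i : (ZMod p)ˣ) : ZMod p) = 0

/-- The set `L(a)` of quadruples of primes solving `⟨a,p⟩ = 0`. -/
def Lsol (a : Fin 4 → ℤ) : Set (Fin 4 → ℕ) :=
  {p | (∀ i, (p i).Prime) ∧ ∑ i, a i * (p i : ℤ) = 0}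

/-- `𝔪(a)`: the minimum of `|p|` over prime solutions `p ∈ L(a)`, and `∞` if there is
no solution. -/
def mfrak (a : Fin 4 → ℤ) : ℝ≥0∞ :=
  ⨅ p ∈ Lsol a, ((Finset.univ.sup p : ℕ) : ℝ≥0∞)

/-- The condition `𝔪(a)³ ≤ |a|·(log |a|)⁴·(log log |a|)`. -/
def SmallSol (a : Fin 4 → ℤ) : Prop :=
  (mfrak a) ^ 3 ≤ ENNReal.ofReal ((snorm a : ℝ) * (Real.log (snorm a)) ^ 4 *
    Real.log (Real.log (snorm a)))

/-- `𝕃^loc(A)`. -/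
def LlocSet (A : ℝ) : Set (Fin 4 → ℤ) := {a | IsLocSolv a ∧ znorm a ≤ A}

/-- `𝕃(A)`. -/
def LSet (A : ℝ) : Set (Fin 4 → ℤ) := {a | IsPrimitive a ∧ znorm a ≤ A}

/-- `𝒫(B)`: quadruples of primes of sup-norm at most `B`. -/
def PP (B : ℝ) : Set (Fin 4 → ℕ) := {x | ∀ i, (x i).Prime ∧ (x i : ℝ) ≤ B}

/-- The counting function `N_a(B)`. -/
def NB (a : Fin 4 → ℤ) (B : ℝ) : ℝ :=
  (Real.log B) ^ 4 * (Set.ncard {x | x ∈ PP B ∧ ∑ i, a i * (x i : ℤ) = 0} : ℝ)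

/-- `w = log log B / log log log B`. -/
def wB (B : ℝ) : ℝ := Real.log (Real.log B) / Real.log (Real.log (Real.log B))

/-- `W = ∏_{p ≤ w} p^(⌈log w/log p⌉ + 1)`. -/
def WB (B : ℝ) : ℕ :=
  ∏ p ∈ Finset.filter Nat.Prime (Finset.range (⌊wB B⌋₊ + 1)),
    p ^ (⌈Real.log (wB B) / Real.log (p : ℝ)⌉₊ + 1)

/-- `rad(W) = ∏_{p ≤ w} p`. -/
def radWB (B : ℝ) : ℕ :=
  ∏ p ∈ Finset.filter Nat.Prime (Finset.range (⌊wB B⌋₊ + 1)), p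

/-- The local counting function `N_a^loc(B)`; the summation condition is
`a ∈ Λ_x^(W) ∩ 𝒞_x^(α)` with `α = log B`. -/
def NlocB (a : Fin 4 → ℤ) (B : ℝ) : ℝ :=
  (Real.log B) ^ 4 * (Real.log B * (WB B : ℝ) / znorm a) *
    ∑ᶠ x ∈ {x : Fin 4 → ℕ | x ∈ PP B ∧ ((WB B : ℤ) ∣ ∑ i, a i * (x i : ℤ)) ∧
      |∑ i, (x i : ℝ) * (a i : ℝ)| ≤ pnorm x * znorm a / (2 * Real.log B)},
      1 / pnorm x

/-- Gram determinant `‖u‖²‖v‖² − ⟨u,v⟩²` of a pair of real vectors. -/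
def gram2 (u v : Fin 4 → ℝ) : ℝ :=
  (∑ i, u i ^ 2) * (∑ i, v i ^ 2) - (∑ i, u i * v i) ^ 2

/-- Determinant of a rank-2 lattice `S ⊆ ℤ⁴`: for such a lattice it is the minimum of
`det(ℤu ⊕ ℤv) = √(‖u‖²‖v‖² − ⟨u,v⟩²)` over linearly independent pairs `u, v ∈ S`
(the minimum being attained precisely at bases of `S`). -/
def latDet2 (S : Set (Fin 4 → ℤ)) : ℝ :=
  sInf {d : ℝ | ∃ u ∈ S, ∃ v ∈ S,
    (∀ m n : ℤ, m • u + n • v = 0 → m = 0 ∧ n = 0) ∧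
    d = Real.sqrt (gram2 (fun i => (u i : ℝ)) (fun i => (v i : ℝ)))}

/-- `det(Λ_x ∩ Λ_y)` for quadruples of primes `x, y`. -/
def detXY (x y : Fin 4 → ℕ) : ℝ :=
  latDet2 {z | (∑ i, (x i : ℤ) * z i) = 0 ∧ (∑ i, (y i : ℤ) * z i) = 0}

/-- `Ω(B)`: pairs of distinct quadruples of primes of size at most `B`. -/
def OmegaB (B : ℝ) : Set ((Fin 4 → ℕ) × (Fin 4 → ℕ)) :=
  {p | p.1 ∈ PP B ∧ p.2 ∈ PP B ∧ p.1 ≠ p.2}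

/-- `E(B)`. -/
def EB (B : ℝ) : ℝ :=
  (Real.log B) ^ 8 * ∑ᶠ p ∈ OmegaB B, 1 / detXY p.1 p.2

/-- `𝒢(x,y)`: the gcd of the 2×2 minors of the matrix with columns `x, y`. -/
def Gcal (x y : Fin 4 → ℕ) : ℤ :=
  Finset.univ.gcd fun q : Fin 4 × Fin 4 =>
    (x q.1 : ℤ) * (y q.2 : ℤ) - (x q.2 : ℤ) * (y q.1 : ℤ)

/-- `Δ(x,y) = ‖x‖‖y‖/det(ℤx ⊕ ℤy)`. -/
def DeltaXY (x y : Fin 4 → ℕ) : ℝ :=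
  pnorm x * pnorm y / Real.sqrt (gram2 (fun i => (x i : ℝ)) (fun i => (y i : ℝ)))

/-- `ℰ_{x,y}(B) = min{1, Δ(x,y)²/α²} + 𝟏[𝒢(x,y) ∤ W/rad(W)]`. -/
def EcalXY (x y : Fin 4 → ℕ) (B : ℝ) : ℝ :=
  min 1 (DeltaXY x y ^ 2 / (Real.log B) ^ 2) +
  (if Gcal x y ∣ ((WB B / radWB B : ℕ) : ℤ) then 0 else 1)

/-- `F(B)`. -/
def FB (B : ℝ) : ℝ :=
  (Real.log B) ^ 8 * ∑ᶠ p ∈ OmegaB B, EcalXY p.1 p.2 B / detXY p.1 p.2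

/-- `ζ(2)`. -/
def zeta2 : ℝ := ∑' n : ℕ, (1 : ℝ) / (n + 1) ^ 2

/-- `{a ∈ ℤ⁴_prim : ‖a‖ ≤ A}` with `ℤ⁴_prim` the tuples of coprime coordinates. -/
def primA (A : ℝ) : Set (Fin 4 → ℤ) := {a | Finset.univ.gcd a = 1 ∧ znorm a ≤ A}

/-- `D(A,B)`. -/
def DAB (A B : ℝ) : ℝ :=
  (∑ᶠ a ∈ primA A, NB a B ^ 2) - (Real.log B) ^ 4 * ∑ᶠ a ∈ primA A, NB a B

/-- `Δ_a^mix(B)`. -/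
def DeltaMix (a : Fin 4 → ℤ) (B : ℝ) : ℝ :=
  (Real.log B) ^ 8 * (Real.log B * (WB B : ℝ) / znorm a) *
    ∑ᶠ x ∈ {x : Fin 4 → ℕ | x ∈ PP B ∧ ∑ i, a i * (x i : ℤ) = 0}, 1 / pnorm x

/-- `Δ_a^loc(B)`. -/
def DeltaLoc (a : Fin 4 → ℤ) (B : ℝ) : ℝ :=
  (Real.log B) ^ 8 * ((Real.log B) ^ 2 * (WB B : ℝ) ^ 2 / znorm a ^ 2) *
    ∑ᶠ x ∈ {x : Fin 4 → ℕ | x ∈ PP B ∧ ((WB B : ℤ) ∣ ∑ i, a i * (x i : ℤ)) ∧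
      |∑ i, (x i : ℝ) * (a i : ℝ)| ≤ pnorm x * znorm a / (2 * Real.log B)},
      1 / pnorm x ^ 2

/-- `D^mix(A,B)`. -/
def DmixAB (A B : ℝ) : ℝ :=
  (∑ᶠ a ∈ primA A, NB a B * NlocB a B) - ∑ᶠ a ∈ primA A, DeltaMix a B

/-- `D^loc(A,B)`. -/
def DlocAB (A B : ℝ) : ℝ :=
  (∑ᶠ a ∈ primA A, NlocB a B ^ 2) - ∑ᶠ a ∈ primA A, DeltaLoc a B

/-- `K(A,B)`. -/
def KAB (A B : ℝ) : ℝ :=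
  ∑ᶠ a ∈ primA A, ((Real.log B) ^ 4 * NB a B + DeltaMix a B + DeltaLoc a B)

/-- `τ(a,γ) = γ·vol({u ∈ 𝓑₄(1) ∩ ℝ⁴₊ : a ∈ 𝒞_u^(γ)})`. -/
def tauA (a : Fin 4 → ℤ) (γ : ℝ) : ℝ :=
  γ * (volume {u : Fin 4 → ℝ | Real.sqrt (∑ i, u i ^ 2) < 1 ∧ (∀ i, 0 < u i) ∧
      |∑ i, u i * (a i : ℝ)| ≤ Real.sqrt (∑ i, u i ^ 2) * znorm a / (2 * γ)}).toReal

/-- The singular integral `𝔍_a(B) = τ(a, log B)`. -/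
def Jfrak (a : Fin 4 → ℤ) (B : ℝ) : ℝ := tauA a (Real.log B)

/-- `σ(a,Q) = (Q/φ(Q)⁴)·#{b ∈ ((ℤ/Qℤ)^*)⁴ : ⟨a,b⟩ ≡ 0 mod Q}`. -/
def sigmaA (a : Fin 4 → ℤ) (Q : ℕ) : ℝ :=
  (Q : ℝ) / (Nat.totient Q : ℝ) ^ 4 *
    (Nat.card {b : Fin 4 → (ZMod Q)ˣ |
      ∑ i, (a i : ZMod Q) * ((b i : (ZMod Q)ˣ) : ZMod Q) = 0} : ℝ)

/-- The truncated singular series `𝔖_a(B) = σ(a, W)`. -/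
def Sfrak (a : Fin 4 → ℤ) (B : ℝ) : ℝ := sigmaA a (WB B)

end

/-- The standard bilinear form on `R⁴`. -/
def ip {R : Type*} [CommRing R] (u v : Fin 4 → R) : R :=
  u 0 * v 0 + u 1 * v 1 + u 2 * v 2 + u 3 * v 3

/-- The Gram determinant of a pair of vectors in `R⁴`. -/
def gr {R : Type*} [CommRing R] (u v : Fin 4 → R) : R := ip u u * ip v v - ip u v ^ 2

/-- The `2 × 2` minors of a pair of vectors. -/
def mn {R : Type*} [CommRing R] (u v : Fin 4 → R) (i j : Fin 4) : R := u i * v j - u j * v i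

section Algebra

variable {R : Type*} [CommRing R]

theorem ip_comm (u v : Fin 4 → R) : ip u v = ip v u := by unfold ip; ring

theorem ip_add (u v w : Fin 4 → R) : ip u (v + w) = ip u v + ip u w := by
  simp only [ip, Pi.add_apply]; ring

theorem ip_smul (c : R) (u v : Fin 4 → R) : ip u (c • v) = c * ip u v := by
  simp only [ip, Pi.smul_apply, smul_eq_mul]; ring

theorem ip_sub (u v w : Fin 4 → R) : ip u (v - w) = ip u v - ip u w := by
  simp only [ip, Pi.sub_apply]; ring

theorem add_ip (u v w : Fin 4 → R) : ip (v + w) u = ip v u + ip w u := by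
  simp only [ip, Pi.add_apply]; ring

theorem smul_ip (c : R) (u v : Fin 4 → R) : ip (c • v) u = c * ip v u := by
  simp only [ip, Pi.smul_apply, smul_eq_mul]; ring

theorem sub_ip (u v w : Fin 4 → R) : ip (v - w) u = ip v u - ip w u := by
  simp only [ip, Pi.sub_apply]; ring

theorem ip_zero (u : Fin 4 → R) : ip u 0 = 0 := by simp [ip]

theorem gr_comm (u v : Fin 4 → R) : gr u v = gr v u := by
  unfold gr; rw [ip_comm u v]; ring

theorem gr_eq_mn (u v : Fin 4 → R) :
    gr u v = mn u v 0 1 ^ 2 + mn u v 0 2 ^ 2 + mn u v 0 3 ^ 2 + mn u v 1 2 ^ 2 + mn u v 1 3 ^ 2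
      + mn u v 2 3 ^ 2 := by
  unfold gr ip mn; ring

theorem sum_eq_ip (u v : Fin 4 → R) : ∑ i, u i * v i = ip u v := by
  rw [Fin.sum_univ_four, ip]

theorem det_sq_of_orthogonal {x y u v : Fin 4 → R}
    (hxu : ip x u = 0) (hxv : ip x v = 0) (hyu : ip y u = 0) (hyv : ip y v = 0) :
    (Matrix.of ![x, y, u, v]).det ^ 2 = gr x y * gr u v := by
  set M : Matrix (Fin 4) (Fin 4) R := Matrix.of ![x, y, u, v] with hM
  have hMM : M * M.transpose =
      !![ip x x, ip x y, 0, 0; ip x y, ip y y, 0, 0; 0, 0, ip u u, ip u v; 0, 0, ip u v, ip v v] := by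
    have e1 : ip u x = 0 := by rw [ip_comm, hxu]
    have e2 : ip v x = 0 := by rw [ip_comm, hxv]
    have e3 : ip u y = 0 := by rw [ip_comm, hyu]
    have e4 : ip v y = 0 := by rw [ip_comm, hyv]
    ext i j
    rw [Matrix.mul_apply]
    simp only [Matrix.transpose_apply, sum_eq_ip]
    fin_cases i <;> fin_cases j <;>
      first
      | exact rfl | exact hxu | exact hxv | exact hyu | exact hyv | exact e1 | exact e2 | exact e3
      | exact e4 | exact ip_comm y x | exact ip_comm v u
  have h1 : (M * M.transpose).det = M.det ^ 2 := by
    rw [Matrix.det_mul, Matrix.det_transpose, sq]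
  rw [← h1, hMM]
  simp [Matrix.det_succ_row_zero, Fin.sum_univ_succ, Fin.succAbove, gr]
  ring

theorem det_eq_plucker (x y u v : Fin 4 → R) :
    (Matrix.of ![x, y, u, v]).det = mn x y 0 1 * mn u v 2 3 - mn x y 0 2 * mn u v 1 3
      + mn x y 0 3 * mn u v 1 2 + mn x y 1 2 * mn u v 0 3 - mn x y 1 3 * mn u v 0 2
      + mn x y 2 3 * mn u v 0 1 := by
  simp [Matrix.det_succ_row_zero, Fin.sum_univ_succ, Fin.succAbove, mn]
  ring

/-- Vectors orthogonal to two orthogonal nondegenerate planes vanish. -/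
theorem eq_zero_of_ip_eq_zero [IsDomain R] {x y u v z : Fin 4 → R}
    (hxu : ip x u = 0) (hxv : ip x v = 0) (hyu : ip y u = 0) (hyv : ip y v = 0)
    (hxy : gr x y ≠ 0) (huv : gr u v ≠ 0)
    (hx : ip x z = 0) (hy : ip y z = 0) (hu : ip u z = 0) (hv : ip v z = 0) : z = 0 := by
  have hdet := det_sq_of_orthogonal hxu hxv hyu hyv
  have hne : (Matrix.of ![x, y, u, v]).det ≠ 0 := by
    intro h
    rw [h] at hdet
    have : gr x y * gr u v = 0 := by rw [← hdet]; ring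
    exact (mul_ne_zero hxy huv) this
  apply Matrix.eq_zero_of_mulVec_eq_zero hne
  ext i
  rw [Matrix.mulVec, dotProduct, sum_eq_ip]
  fin_cases i <;> first | exact hx | exact hy | exact hu | exact hv

/-- The orthogonal decomposition along two orthogonal nondegenerate planes. -/
theorem smul_eq_of_orthogonal [IsDomain R] {x y u v : Fin 4 → R}
    (hxu : ip x u = 0) (hxv : ip x v = 0) (hyu : ip y u = 0) (hyv : ip y v = 0)
    (hxy : gr x y ≠ 0) (huv : gr u v ≠ 0) (w : Fin 4 → R) :
    (gr x y * gr u v) • w =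
      gr x y • ((ip w u * ip v v - ip w v * ip u v) • u + (ip w v * ip u u - ip w u * ip u v) • v)
      + gr u v • ((ip w x * ip y y - ip w y * ip x y) • x
        + (ip w y * ip x x - ip w x * ip x y) • y) := by
  rw [← sub_eq_zero]
  have e1 : ip u x = 0 := by rw [ip_comm, hxu]
  have e2 : ip v x = 0 := by rw [ip_comm, hxv]
  have e3 : ip u y = 0 := by rw [ip_comm, hyu]
  have e4 : ip v y = 0 := by rw [ip_comm, hyv]
  apply eq_zero_of_ip_eq_zero hxu hxv hyu hyv hxy huv
  all_goals simp only [ip_sub, ip_add, ip_smul, hxu, hxv, hyu, hyv, e1, e2, e3, e4, ip_comm w,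
    ip_comm v u, ip_comm y x]
  all_goals simp only [gr]
  all_goals ring

theorem ip_self_of_orthogonal [IsDomain R] {x y u v : Fin 4 → R}
    (hxu : ip x u = 0) (hxv : ip x v = 0) (hyu : ip y u = 0) (hyv : ip y v = 0)
    (hxy : gr x y ≠ 0) (huv : gr u v ≠ 0) (w : Fin 4 → R) :
    gr x y * gr u v * ip w w =
      gr x y * (ip w u ^ 2 * ip v v - 2 * ip w u * ip w v * ip u v + ip w v ^ 2 * ip u u)
      + gr u v * (ip w x ^ 2 * ip y y - 2 * ip w x * ip w y * ip x y + ip w y ^ 2 * ip x x) := by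
  have h := congrArg (ip w) (smul_eq_of_orthogonal hxu hxv hyu hyv hxy huv w)
  simp only [ip_add, ip_smul] at h
  rw [h]; ring

end Algebra

theorem ip_self_nonneg (u : Fin 4 → ℤ) : 0 ≤ ip u u := by unfold ip; nlinarith [sq_nonneg (u 0), sq_nonneg (u 1), sq_nonneg (u 2), sq_nonneg (u 3)]

theorem sq_le_ip_self (u : Fin 4 → ℤ) (i : Fin 4) : u i ^ 2 ≤ ip u u := by
  unfold ip
  fin_cases i <;> simp <;> nlinarith [sq_nonneg (u 0), sq_nonneg (u 1), sq_nonneg (u 2), sq_nonneg (u 3)]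

theorem ip_self_pos {u : Fin 4 → ℤ} (h : u ≠ 0) : 0 < ip u u := by
  obtain ⟨i, hi⟩ := Function.ne_iff.mp h
  have h1 := sq_le_ip_self u i
  have h2 : 0 < u i ^ 2 := by have : u i ≠ 0 := hi; positivity
  omega

theorem gr_nonneg (u v : Fin 4 → ℤ) : 0 ≤ gr u v := by rw [gr_eq_mn]; positivity

theorem mn_eq_zero_of_gr {u v : Fin 4 → ℤ} (h : gr u v = 0) (i j : Fin 4) : mn u v i j = 0 := by
  rw [gr_eq_mn] at h
  have key : mn u v 0 1 = 0 ∧ mn u v 0 2 = 0 ∧ mn u v 0 3 = 0 ∧ mn u v 1 2 = 0 ∧ mn u v 1 3 = 0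
      ∧ mn u v 2 3 = 0 := by
    refine ⟨?_, ?_, ?_, ?_, ?_, ?_⟩ <;> rw [← sq_eq_zero_iff] <;>
    nlinarith [sq_nonneg (mn u v 0 1), sq_nonneg (mn u v 0 2), sq_nonneg (mn u v 0 3),
      sq_nonneg (mn u v 1 2), sq_nonneg (mn u v 1 3), sq_nonneg (mn u v 2 3)]
  obtain ⟨h1, h2, h3, h4, h5, h6⟩ := key
  unfold mn at *
  fin_cases i <;> fin_cases j <;> simp <;> linarith

theorem gr_eq_zero_of_mn {u v : Fin 4 → ℤ} (h : ∀ i j, mn u v i j = 0) : gr u v = 0 := by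
  rw [gr_eq_mn]; simp [h]

theorem gr_eq_zero_trans {w u v : Fin 4 → ℤ} (hw : w ≠ 0) (hu : gr w u = 0) (hv : gr w v = 0) :
    gr u v = 0 := by
  obtain ⟨i, hi⟩ := Function.ne_iff.mp hw
  apply gr_eq_zero_of_mn
  intro j k
  have hu' := mn_eq_zero_of_gr hu
  have hv' := mn_eq_zero_of_gr hv
  have : w i ^ 2 * mn u v j k = 0 := by
    have h1 := hu' i j
    have h2 := hv' i k
    have h3 := hu' i k
    have h4 := hv' i j
    unfold mn at *
    linear_combination w i * v k * h1 + w j * u i * h2 - w i * v j * h3 - w k * u i * h4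
  have hne : w i ^ 2 ≠ 0 := pow_ne_zero _ hi
  exact (mul_eq_zero.mp this).resolve_left hne

theorem exists_min_ip {p : (Fin 4 → ℤ) → Prop} (h : ∃ u, p u) :
    ∃ u, p u ∧ ∀ v, p v → ip u u ≤ ip v v := by
  classical
  have hex : ∃ n : ℕ, ∃ u, p u ∧ ip u u = n := by
    obtain ⟨u, hu⟩ := h
    exact ⟨(ip u u).toNat, u, hu, (Int.toNat_of_nonneg (ip_self_nonneg u)).symm⟩
  obtain ⟨u, hu, hn⟩ := Nat.find_spec hex
  refine ⟨u, hu, fun v hv => ?_⟩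
  have := Nat.find_min' hex ⟨v, hv, (Int.toNat_of_nonneg (ip_self_nonneg v)).symm⟩
  have h0 := ip_self_nonneg v
  omega

theorem exists_round (p r : ℤ) (hr : r ≠ 0) : ∃ i : ℤ, 2 * |p - i * r| ≤ |r| := by
  refine ⟨round ((p : ℚ) / r), ?_⟩
  have h := abs_sub_round ((p : ℚ) / r)
  have hr' : (0 : ℚ) < |(r : ℚ)| := by positivity
  have : |(p : ℚ) - round ((p : ℚ) / r) * r| ≤ 1 / 2 * |(r : ℚ)| := by
    have e : (p : ℚ) - round ((p : ℚ) / r) * r = ((p : ℚ) / r - round ((p : ℚ) / r)) * r := by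
      have : (r : ℚ) ≠ 0 := by exact_mod_cast hr
      field_simp
    rw [e, abs_mul]
    gcongr
  have h2 : (2 : ℚ) * |(p : ℚ) - round ((p : ℚ) / r) * r| ≤ |(r : ℚ)| := by linarith
  exact_mod_cast h2

/-- Gauss reduction: a rank two sublattice of `ℤ⁴` has a reduced basis. -/
theorem exists_reduced_basis (H : AddSubgroup (Fin 4 → ℤ))
    (hex : ∃ u ∈ H, ∃ v ∈ H, gr u v ≠ 0)
    (h3 : ∀ u ∈ H, ∀ v ∈ H, ∀ w ∈ H, gr u v ≠ 0 → ∃ p q r : ℤ, r ≠ 0 ∧ r • w = p • u + q • v) :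
    ∃ u ∈ H, ∃ v ∈ H, 0 < gr u v ∧ 2 * |ip u v| ≤ ip u u ∧ ip u u ≤ ip v v ∧ 0 < ip u u ∧
      (∀ w ∈ H, ∃ i j : ℤ, w = i • u + j • v) ∧ (∀ w ∈ H, w ≠ 0 → ip u u ≤ ip w w) ∧
      (∀ w ∈ H, gr u w ≠ 0 → ip v v ≤ ip w w) := by
  obtain ⟨a, ha, b, hb, hab⟩ := hex
  have ha0 : a ≠ 0 := by rintro rfl; simp [gr, ip] at hab
  obtain ⟨u, ⟨huH, hu0⟩, humin⟩ := exists_min_ip (p := fun w => w ∈ H ∧ w ≠ 0) ⟨a, ha, ha0⟩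
  have hex2 : ∃ w, w ∈ H ∧ gr u w ≠ 0 := by
    by_contra! hcon
    exact hab (gr_eq_zero_trans hu0 (hcon a ha) (hcon b hb))
  obtain ⟨v, ⟨hvH, hv0⟩, hvmin⟩ := exists_min_ip (p := fun w => w ∈ H ∧ gr u w ≠ 0) hex2
  have hvne : v ≠ 0 := by rintro rfl; simp [gr, ip] at hv0
  have hupos := ip_self_pos hu0
  have hvpos := ip_self_pos hvne
  have hgrpos : 0 < gr u v := lt_of_le_of_ne (gr_nonneg u v) (Ne.symm hv0)
  have huv : ip u u ≤ ip v v := humin v ⟨hvH, hvne⟩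
  have hred : 2 * |ip u v| ≤ ip u u := by
    have h1 := hvmin (v + u) ⟨H.add_mem hvH huH, by
      have : gr u (v + u) = gr u v := by simp only [gr, ip, Pi.add_apply]; ring
      rwa [this]⟩
    have h2 := hvmin (v - u) ⟨H.sub_mem hvH huH, by
      have : gr u (v - u) = gr u v := by simp only [gr, ip, Pi.sub_apply]; ring
      rwa [this]⟩
    simp only [ip_add, add_ip, ip_sub, sub_ip, ip_comm v u] at h1 h2
    rcases abs_cases (ip u v) with ⟨h, _⟩ | ⟨h, _⟩ <;> rw [h] <;> linarith
  refine ⟨u, huH, v, hvH, hgrpos, hred, huv, hupos, ?_, fun w hw h0 => humin w ⟨hw, h0⟩,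
    fun w hw h0 => hvmin w ⟨hw, h0⟩⟩
  intro w hw
  obtain ⟨p, q, r, hr, hpq⟩ := h3 u huH v hvH w hw hv0
  obtain ⟨i, hi⟩ := exists_round p r hr
  obtain ⟨j, hj⟩ := exists_round q r hr
  set w' := w - i • u - j • v with hw'
  have hw'H : w' ∈ H := H.sub_mem (H.sub_mem hw (H.zsmul_mem huH i)) (H.zsmul_mem hvH j)
  have hrw : r • w' = (p - i * r) • u + (q - j * r) • v := by
    rw [hw', smul_sub, smul_sub, hpq]; module
  set p' := p - i * r
  set q' := q - j * r
  have hr2 : 0 < r ^ 2 := by positivity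
  have hp4 : 4 * p' ^ 2 ≤ r ^ 2 := by
    have := mul_self_le_mul_self (by positivity) hi
    nlinarith [abs_mul_abs_self p', abs_mul_abs_self r]
  have hq4 : 4 * q' ^ 2 ≤ r ^ 2 := by
    have := mul_self_le_mul_self (by positivity) hj
    nlinarith [abs_mul_abs_self q', abs_mul_abs_self r]
  have hpq4 : 4 * |p' * q'| ≤ r ^ 2 := by
    rw [abs_mul]; nlinarith [sq_nonneg (|p'| - |q'|), sq_abs p', sq_abs q']
  have hn : r ^ 2 * ip w' w' = p' ^ 2 * ip u u + 2 * (p' * q') * ip u v + q' ^ 2 * ip v v := by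
    have : ip (r • w') (r • w') = r ^ 2 * ip w' w' := by rw [ip_smul, smul_ip]; ring
    rw [← this, hrw]
    simp only [ip_add, add_ip, ip_smul, smul_ip, ip_comm v u]; ring
  have hg : r ^ 2 * gr u w' = q' ^ 2 * gr u v := by
    have : gr u (r • w') = r ^ 2 * gr u w' := by simp only [gr, ip_smul, smul_ip]; ring
    rw [← this, hrw]
    simp only [gr, ip_add, add_ip, ip_smul, smul_ip, ip_comm v u]; ring
  have hcross : 2 * (p' * q') * ip u v * 4 ≤ r ^ 2 * ip u u := by
    have h1 : p' * q' * ip u v ≤ |p' * q'| * |ip u v| := by rw [← abs_mul]; exact le_abs_self _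
    nlinarith [mul_le_mul hpq4 hred (by positivity) hr2.le]
  have hgw : gr u w' = 0 := by
    by_contra hne
    have h1 := hvmin w' ⟨hw'H, hne⟩
    nlinarith
  have hq0 : q' = 0 := by
    rw [hgw, mul_zero] at hg
    have := (mul_eq_zero.mp hg.symm).resolve_right hgrpos.ne'
    exact pow_eq_zero_iff (by norm_num) |>.mp this
  have hw0 : w' = 0 := by
    by_contra hne
    have h1 := humin w' ⟨hw'H, hne⟩
    rw [hq0] at hn
    nlinarith
  exact ⟨i, j, by rw [hw', sub_sub, sub_eq_zero] at hw0; exact hw0⟩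

theorem card_Icc_ceil_floor_le {a b : ℝ} (h : a ≤ b) :
    ((Finset.Icc ⌈a⌉ ⌊b⌋).card : ℝ) ≤ b - a + 1 := by
  rw [Int.card_Icc]
  have h1 := Int.floor_le b
  have h2 := Int.le_ceil a
  have : ((⌊b⌋ + 1 - ⌈a⌉ : ℤ) : ℝ) ≤ b - a + 1 := by push_cast; linarith
  rcases le_total 0 (⌊b⌋ + 1 - ⌈a⌉) with h0 | h0
  · have e : (((⌊b⌋ + 1 - ⌈a⌉).toNat : ℤ) : ℝ) = ((⌊b⌋ + 1 - ⌈a⌉ : ℤ) : ℝ) := by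
      rw [Int.toNat_of_nonneg h0]
    rw [← e] at this; exact_mod_cast this
  · rw [Int.toNat_of_nonpos h0]; push_cast; linarith

theorem le_card_Icc_ceil_floor (a b : ℝ) :
    b - a - 1 ≤ ((Finset.Icc ⌈a⌉ ⌊b⌋).card : ℝ) := by
  rw [Int.card_Icc]
  have h1 := Int.lt_floor_add_one b
  have h2 := Int.ceil_lt_add_one a
  have : b - a - 1 ≤ ((⌊b⌋ + 1 - ⌈a⌉ : ℤ) : ℝ) := by push_cast; linarith
  refine this.trans ?_
  have h3 := Int.self_le_toNat (⌊b⌋ + 1 - ⌈a⌉)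
  exact_mod_cast h3

theorem sum_Ico_int (F : ℤ → ℝ) (k : ℤ) (n : ℕ) :
    ∑ i ∈ Finset.Ico k (k + n), F i = ∑ i ∈ Finset.range n, F (k + i) := by
  induction n with
  | zero => simp
  | succ n ih =>
    rw [Finset.sum_range_succ, ← ih]
    have : Finset.Ico k (k + (n + 1 : ℕ)) = insert (k + n) (Finset.Ico k (k + n)) := by
      ext i; simp only [Finset.mem_Ico, Finset.mem_insert]; push_cast; omega
    rw [this, Finset.sum_insert (by simp), add_comm]

/-- The half-circle function. -/
noncomputable def hc (R t : ℝ) : ℝ := Real.sqrt (R - t ^ 2)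

theorem hc_nonneg (R t : ℝ) : 0 ≤ hc R t := Real.sqrt_nonneg _

theorem continuous_hc (R : ℝ) : Continuous (hc R) := by unfold hc; fun_prop

theorem hc_le (R t : ℝ) : hc R t ≤ Real.sqrt R :=
  Real.sqrt_le_sqrt (by nlinarith [sq_nonneg t])

theorem hc_anti {R a b : ℝ} (h : a ^ 2 ≤ b ^ 2) : hc R b ≤ hc R a :=
  Real.sqrt_le_sqrt (by linarith)

theorem hc_eq_zero {R t : ℝ} (h : R ≤ t ^ 2) : hc R t = 0 := Real.sqrt_eq_zero_of_nonpos (by linarith)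

/-- The variation function of the half-circle function. -/
noncomputable def hv (R t : ℝ) : ℝ := if t ≤ 0 then hc R t else 2 * Real.sqrt R - hc R t

theorem hv_nonneg (R t : ℝ) : 0 ≤ hv R t := by
  unfold hv; split_ifs
  · exact hc_nonneg _ _
  · linarith [hc_le R t, Real.sqrt_nonneg R]

theorem hv_le (R t : ℝ) : hv R t ≤ 2 * Real.sqrt R := by
  unfold hv; split_ifs
  · linarith [hc_le R t, Real.sqrt_nonneg R]
  · linarith [hc_nonneg R t]

theorem abs_hc_sub_le {R a b : ℝ} (h : a ≤ b) : |hc R b - hc R a| ≤ hv R b - hv R a := by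
  have ha := hc_le R a
  have hb := hc_le R b
  unfold hv
  split_ifs with h1 h2 h2
  · rw [abs_of_nonneg]
    exact sub_nonneg.mpr (hc_anti (by nlinarith))
  · linarith
  · rw [abs_le]; constructor <;> linarith
  · have := hc_anti (R := R) (show a ^ 2 ≤ b ^ 2 by nlinarith)
    rw [abs_of_nonpos (by linarith)]; linarith

theorem abs_hc_step {R a b : ℝ} (h : a ≤ b) :
    |(∫ t in a..b, hc R t) - (b - a) * hc R a| ≤ (b - a) * (hv R b - hv R a) := by
  have e : (∫ t in a..b, hc R t) - (b - a) * hc R a = ∫ t in a..b, (hc R t - hc R a) := by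
    rw [intervalIntegral.integral_sub ((continuous_hc R).intervalIntegrable _ _) (by simp)]
    simp
  rw [e, ← Real.norm_eq_abs]
  have := intervalIntegral.norm_integral_le_of_norm_le_const (a := a) (b := b)
    (f := fun t => hc R t - hc R a) (C := hv R b - hv R a) (by
      intro t ht
      rw [Set.uIoc_of_le h] at ht
      have h1 := abs_hc_sub_le (R := R) ht.1.le
      have h2 := (abs_nonneg _).trans (abs_hc_sub_le (R := R) ht.2)
      rw [Real.norm_eq_abs]; linarith)
  rw [abs_of_nonneg (sub_nonneg.mpr h)] at this
  linarith

theorem integral_hc {R : ℝ} (hR : 0 ≤ R) :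
    ∫ t in (-Real.sqrt R)..(Real.sqrt R), hc R t = Real.pi * R / 2 := by
  rcases hR.eq_or_lt with rfl | hR
  · simp
  have hs : 0 < Real.sqrt R := Real.sqrt_pos.mpr hR
  have h := intervalIntegral.integral_comp_mul_left (a := -1) (b := 1) (hc R) hs.ne'
  have e : ∀ t : ℝ, hc R (Real.sqrt R * t) = Real.sqrt R * Real.sqrt (1 - t ^ 2) := by
    intro t
    unfold hc
    rw [← Real.sqrt_mul hR.le, mul_pow, Real.sq_sqrt hR.le]; congr 1; ring
  simp only [e, intervalIntegral.integral_const_mul, integral_sqrt_one_sub_sq, mul_one, mul_neg,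
    smul_eq_mul] at h
  have : Real.sqrt R * (Real.sqrt R * (Real.pi / 2)) =
      ∫ t in (-Real.sqrt R)..(Real.sqrt R), hc R t := by
    rw [h]; field_simp
  rw [← this, ← mul_assoc, Real.mul_self_sqrt hR.le]; ring

theorem integral_hc_wide {R a b : ℝ} (hR : 0 ≤ R) (ha : a ≤ -Real.sqrt R) (hb : Real.sqrt R ≤ b) :
    ∫ t in a..b, hc R t = Real.pi * R / 2 := by
  have ii : ∀ a b, IntervalIntegrable (hc R) volume a b :=
    fun a b => (continuous_hc R).intervalIntegrable _ _
  have hs := Real.sq_sqrt hR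
  have hs0 := Real.sqrt_nonneg R
  rw [← intervalIntegral.integral_add_adjacent_intervals (ii a (-Real.sqrt R)) (ii _ b),
    ← intervalIntegral.integral_add_adjacent_intervals (ii (-Real.sqrt R) (Real.sqrt R)) (ii _ b),
    integral_hc hR]
  have z1 : ∫ t in a..(-Real.sqrt R), hc R t = 0 := by
    rw [intervalIntegral.integral_congr (g := fun _ => 0), intervalIntegral.integral_zero]
    intro t ht
    rw [Set.uIcc_of_le ha] at ht
    exact hc_eq_zero (by nlinarith [ht.2])
  have z2 : ∫ t in (Real.sqrt R)..b, hc R t = 0 := by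
    rw [intervalIntegral.integral_congr (g := fun _ => 0), intervalIntegral.integral_zero]
    intro t ht
    rw [Set.uIcc_of_le hb] at ht
    exact hc_eq_zero (by nlinarith [ht.1])
  rw [z1, z2]; ring

theorem riemann_hc {R s β : ℝ} (hR : 0 ≤ R) (hs : 0 < s) (n : ℕ) (h0 : β ≤ -Real.sqrt R)
    (hn : Real.sqrt R ≤ β + s * n) :
    |s * ∑ i ∈ Finset.range n, hc R (β + s * i) - Real.pi * R / 2| ≤ s * (2 * Real.sqrt R) := by
  have ii : ∀ a b, IntervalIntegrable (hc R) volume a b :=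
    fun a b => (continuous_hc R).intervalIntegrable _ _
  have h1 := intervalIntegral.sum_integral_adjacent_intervals (a := fun i : ℕ => β + s * i)
    (f := hc R) (μ := volume) (n := n) (fun k _ => ii _ _)
  simp only [Nat.cast_zero, mul_zero, add_zero] at h1
  rw [integral_hc_wide hR h0 hn] at h1
  rw [← h1, Finset.mul_sum, ← Finset.sum_sub_distrib]
  refine (Finset.abs_sum_le_sum_abs _ _).trans ?_
  have h2 : ∀ i ∈ Finset.range n, |s * hc R (β + s * i) -
      ∫ t in (β + s * i)..(β + s * (i + 1 : ℕ)), hc R t| ≤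
      s * (hv R (β + s * (i + 1 : ℕ)) - hv R (β + s * i)) := by
    intro i _
    have := abs_hc_step (R := R) (a := β + s * i) (b := β + s * (i + 1 : ℕ)) (by push_cast; linarith)
    have e : β + s * (i + 1 : ℕ) - (β + s * i) = s := by push_cast; ring
    rw [e] at this
    rwa [abs_sub_comm]
  refine (Finset.sum_le_sum h2).trans ?_
  rw [← Finset.mul_sum, Finset.sum_range_sub (fun i : ℕ => hv R (β + s * i))]
  have := hv_le R (β + s * n)
  have := hv_nonneg R (β + s * (0 : ℕ))
  gcongr; linarith

/-- The `k` with `(β + s k)² ≤ R`. -/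
noncomputable def gk (s β R : ℝ) : Finset ℤ :=
  Finset.Icc ⌈(-Real.sqrt R - β) / s⌉ ⌊(Real.sqrt R - β) / s⌋

theorem mem_gk {s β R : ℝ} (hR : 0 ≤ R) (hs : 0 < s) (k : ℤ) :
    k ∈ gk s β R ↔ (β + s * k) ^ 2 ≤ R := by
  rw [gk, Finset.mem_Icc, Int.ceil_le, Int.le_floor, div_le_iff₀ hs, le_div_iff₀ hs,
    ← Real.sqrt_le_sqrt_iff hR, Real.sqrt_sq_eq_abs, abs_le]
  constructor <;> rintro ⟨h1, h2⟩ <;> constructor <;> linarith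

theorem card_gk_le {s β R : ℝ} (hs : 0 < s) :
    ((gk s β R).card : ℝ) ≤ 2 * Real.sqrt R / s + 1 := by
  have h := card_Icc_ceil_floor_le (a := (-Real.sqrt R - β) / s) (b := (Real.sqrt R - β) / s) (by
    have := Real.sqrt_nonneg R
    gcongr; linarith)
  refine h.trans (le_of_eq ?_)
  field_simp; ring

theorem le_card_gk {s β R : ℝ} (hs : 0 < s) :
    2 * Real.sqrt R / s - 1 ≤ ((gk s β R).card : ℝ) := by
  have h := le_card_Icc_ceil_floor ((-Real.sqrt R - β) / s) ((Real.sqrt R - β) / s)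
  refine le_trans (le_of_eq ?_) h
  field_simp; ring

theorem riemann_gk {R s β : ℝ} (hR : 0 ≤ R) (hs : 0 < s) :
    |s * ∑ k ∈ gk s β R, hc R (β + s * k) - Real.pi * R / 2| ≤ s * (2 * Real.sqrt R) := by
  have hsq := Real.sqrt_nonneg R
  set k0 : ℤ := ⌊(-Real.sqrt R - β) / s⌋ with hk0
  have hk : ∃ n : ℕ, (Real.sqrt R - β) / s < k0 + n := by
    obtain ⟨n, hn⟩ := exists_nat_gt ((Real.sqrt R - β) / s - k0)
    exact ⟨n, by linarith⟩
  obtain ⟨n, hn⟩ := hk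
  have h0 : β + s * k0 ≤ -Real.sqrt R := by
    have := Int.floor_le ((-Real.sqrt R - β) / s)
    rw [le_div_iff₀ hs] at this; linarith
  have h1 : Real.sqrt R ≤ β + s * k0 + s * n := by
    rw [div_lt_iff₀ hs] at hn; nlinarith
  have h2 := riemann_hc hR hs n h0 h1
  have e : ∑ k ∈ gk s β R, hc R (β + s * k) = ∑ i ∈ Finset.range n, hc R (β + s * k0 + s * i) := by
    have := sum_Ico_int (fun k => hc R (β + s * k)) k0 n
    have e2 : ∑ i ∈ Finset.range n, hc R (β + s * k0 + s * i) =
        ∑ i ∈ Finset.range n, hc R (β + s * ((k0 + i : ℤ) : ℝ)) := by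
      refine Finset.sum_congr rfl fun i _ => ?_
      push_cast; congr 1; ring
    rw [e2, ← this]
    by_cases hne : Real.sqrt R = 0
    · rw [Finset.sum_eq_zero, Finset.sum_eq_zero]
      · intro i _; exact le_antisymm ((hc_le _ _).trans hne.le) (hc_nonneg _ _)
      · intro i _; exact le_antisymm ((hc_le _ _).trans hne.le) (hc_nonneg _ _)
    refine Finset.sum_subset ?_ ?_
    · intro k hk
      rw [mem_gk hR hs, ← Real.sqrt_le_sqrt_iff hR, Real.sqrt_sq_eq_abs, abs_le] at hk
      rw [Finset.mem_Ico]
      constructor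
      · have : s * (k0 : ℝ) ≤ s * k := by linarith [hk.1]
        have := le_of_mul_le_mul_left this hs
        exact_mod_cast this
      · have : s * (k : ℝ) < s * (k0 + n) := by
          rw [div_lt_iff₀ hs] at hn; linarith [hk.2]
        have := lt_of_mul_lt_mul_left this hs.le
        exact_mod_cast this
    · intro k _ hk
      rw [mem_gk hR hs] at hk
      exact hc_eq_zero (by linarith)
  rw [e]; exact h2

/-- Lattice points of a plane lattice in a disc. -/
theorem grid_count {l s R : ℝ} (β : ℝ) (γ : ℤ → ℝ) (hR : 0 ≤ R) (hl : 0 < l) (hs : 0 < s) :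
    |(((gk s β R).sigma fun k => gk l (γ k) (R - (β + s * k) ^ 2)).card : ℝ)
      - Real.pi * R / (l * s)| ≤ 4 * Real.sqrt R / l + 2 * Real.sqrt R / s + 1 := by
  rw [Finset.card_sigma]
  push_cast
  have h1 : |∑ k ∈ gk s β R, (((gk l (γ k) (R - (β + s * k) ^ 2)).card : ℝ)
      - 2 * hc R (β + s * k) / l)| ≤ 2 * Real.sqrt R / s + 1 := by
    refine (Finset.abs_sum_le_sum_abs _ _).trans ?_
    refine le_trans (Finset.sum_le_sum (g := fun _ => (1 : ℝ)) ?_) ?_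
    · intro k _
      have a1 := card_gk_le (s := l) (β := γ k) (R := R - (β + s * k) ^ 2) hl
      have a2 := le_card_gk (s := l) (β := γ k) (R := R - (β + s * k) ^ 2) hl
      rw [abs_le]; unfold hc
      constructor <;> linarith
    · simp only [Finset.sum_const, nsmul_eq_mul, mul_one]
      exact card_gk_le hs
  have h2 := riemann_gk (β := β) hR hs
  rw [Finset.sum_sub_distrib] at h1
  have e : ∑ k ∈ gk s β R, 2 * hc R (β + s * k) / l - Real.pi * R / (l * s) =
      2 / (l * s) * (s * ∑ k ∈ gk s β R, hc R (β + s * k) - Real.pi * R / 2) := by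
    rw [mul_sub, Finset.mul_sum, Finset.mul_sum]
    congr 1
    · refine Finset.sum_congr rfl fun k _ => ?_
      field_simp
    · field_simp
  have h3 : |∑ k ∈ gk s β R, 2 * hc R (β + s * k) / l - Real.pi * R / (l * s)| ≤
      4 * Real.sqrt R / l := by
    rw [e, abs_mul, abs_of_pos (by positivity)]
    calc 2 / (l * s) * |s * ∑ k ∈ gk s β R, hc R (β + s * k) - Real.pi * R / 2|
        ≤ 2 / (l * s) * (s * (2 * Real.sqrt R)) := by gcongr
      _ = 4 * Real.sqrt R / l := by field_simp; ring
  have := abs_add_le (∑ k ∈ gk s β R, ((gk l (γ k) (R - (β + s * k) ^ 2)).card : ℝ) -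
    ∑ k ∈ gk s β R, 2 * hc R (β + s * k) / l)
    (∑ k ∈ gk s β R, 2 * hc R (β + s * k) / l - Real.pi * R / (l * s))
  rw [sub_add_sub_cancel] at this
  linarith

/-- Integer points of the closed Euclidean ball of radius `T`. -/
noncomputable def bl (T : ℝ) : Finset (Fin 4 → ℤ) :=
  (Fintype.piFinset fun _ => Finset.Icc (-⌊T⌋) ⌊T⌋).filter fun a => ((ip a a : ℤ) : ℝ) ≤ T ^ 2

theorem mem_bl {T : ℝ} (hT : 0 ≤ T) (a : Fin 4 → ℤ) : a ∈ bl T ↔ ((ip a a : ℤ) : ℝ) ≤ T ^ 2 := by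
  rw [bl, Finset.mem_filter, Fintype.mem_piFinset]
  refine ⟨fun h => h.2, fun h => ⟨fun i => ?_, h⟩⟩
  have h1 : ((a i : ℝ)) ^ 2 ≤ T ^ 2 := by
    refine le_trans ?_ h
    exact_mod_cast sq_le_ip_self a i
  have h2 := abs_le.mp (abs_le_of_sq_le_sq h1 hT)
  rw [Finset.mem_Icc, neg_le, Int.le_floor, Int.le_floor]
  push_cast
  constructor <;> linarith [h2.1, h2.2]

/-- `u, v` is a reduced basis of the lattice of integer points orthogonal to `x` and `y`. -/
structure OrthBasis (x y u v : Fin 4 → ℤ) : Prop where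
  xu : ip x u = 0
  xv : ip x v = 0
  yu : ip y u = 0
  yv : ip y v = 0
  gxy : 0 < gr x y
  guv : 0 < gr u v
  red : 2 * |ip u v| ≤ ip u u
  le : ip u u ≤ ip v v
  pos : 0 < ip u u
  span : ∀ w, ip x w = 0 → ip y w = 0 → ∃ i j : ℤ, w = i • u + j • v
  min : ∀ w, ip x w = 0 → ip y w = 0 → w ≠ 0 → ip u u ≤ ip w w

theorem exists_orthBasis {x y : Fin 4 → ℤ} (h : gr x y ≠ 0) : ∃ u v, OrthBasis x y u v := by
  let H : AddSubgroup (Fin 4 → ℤ) :=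
    { carrier := {w | ip x w = 0 ∧ ip y w = 0}
      zero_mem' := ⟨ip_zero _, ip_zero _⟩
      add_mem' := fun {a b} ha hb => by
        simp only [Set.mem_ofPred_eq, ip_add] at *
        omega
      neg_mem' := fun {a} ha => by
        have e : ∀ z : Fin 4 → ℤ, ip z (-a) = - ip z a := fun z => by
          simp only [ip, Pi.neg_apply]; ring
        simp only [Set.mem_ofPred_eq, e] at *
        omega }
  have memH : ∀ w, w ∈ H ↔ ip x w = 0 ∧ ip y w = 0 := fun w => Iff.rfl
  have h3 : ∀ u ∈ H, ∀ v ∈ H, ∀ w ∈ H, gr u v ≠ 0 →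
      ∃ p q r : ℤ, r ≠ 0 ∧ r • w = p • u + q • v := by
    intro u hu v hv w hw huv
    rw [memH] at hu hv hw
    have := smul_eq_of_orthogonal hu.1 hv.1 hu.2 hv.2 h huv w
    rw [ip_comm w x, ip_comm w y, hw.1, hw.2] at this
    refine ⟨gr x y * (ip w u * ip v v - ip w v * ip u v),
      gr x y * (ip w v * ip u u - ip w u * ip u v), gr x y * gr u v, mul_ne_zero h huv, ?_⟩
    rw [this]
    module
  have hex : ∃ u ∈ H, ∃ v ∈ H, gr u v ≠ 0 := by
    by_contra! hcon
    have e3 : ![mn x y 1 2, -mn x y 0 2, mn x y 0 1, 0] ∈ H := by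
      rw [memH]; constructor <;> simp [ip, mn] <;> ring
    have e2 : ![mn x y 1 3, -mn x y 0 3, 0, mn x y 0 1] ∈ H := by
      rw [memH]; constructor <;> simp [ip, mn] <;> ring
    have e1 : ![mn x y 2 3, 0, -mn x y 0 3, mn x y 0 2] ∈ H := by
      rw [memH]; constructor <;> simp [ip, mn] <;> ring
    have e0 : ![0, mn x y 2 3, -mn x y 1 3, mn x y 1 2] ∈ H := by
      rw [memH]; constructor <;> simp [ip, mn] <;> ring
    have f1 := mn_eq_zero_of_gr (hcon _ e3 _ e2) 2 3
    have f2 := mn_eq_zero_of_gr (hcon _ e3 _ e1) 1 3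
    have f3 := mn_eq_zero_of_gr (hcon _ e2 _ e1) 1 2
    have f4 := mn_eq_zero_of_gr (hcon _ e3 _ e0) 0 3
    have f5 := mn_eq_zero_of_gr (hcon _ e2 _ e0) 0 2
    have f6 := mn_eq_zero_of_gr (hcon _ e1 _ e0) 0 1
    rw [mn] at f1 f2 f3 f4 f5 f6
    simp at f1 f2 f3 f4 f5 f6
    apply h
    rw [gr_eq_mn, f1, f2, f3, f4, f5, f6]; norm_num
  obtain ⟨u, hu, v, hv, h1, h2, h4, h5, h6, h7, -⟩ := exists_reduced_basis H hex h3
  rw [memH] at hu hv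
  exact ⟨u, v, hu.1, hv.1, hu.2, hv.2, lt_of_le_of_ne (gr_nonneg _ _) h.symm, h1, h2, h4, h5,
    fun w a b => h6 w ⟨a, b⟩, fun w a b => h7 w ⟨a, b⟩⟩

/-- The squared distance from the origin of the plane `⟨x,·⟩ = m`, `⟨y,·⟩ = n`. -/
noncomputable def hdist (x y : Fin 4 → ℤ) (m n : ℤ) : ℝ :=
  ((m : ℝ) ^ 2 * (ip y y : ℤ) - 2 * m * n * (ip x y : ℤ) + (n : ℝ) ^ 2 * (ip x x : ℤ)) / (gr x y : ℤ)

/-- Integer points of the plane `⟨x,·⟩ = m`, `⟨y,·⟩ = n` in a ball. -/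
noncomputable def slc (x y : Fin 4 → ℤ) (m n : ℤ) (T : ℝ) : Finset (Fin 4 → ℤ) :=
  (bl T).filter fun a => ip x a = m ∧ ip y a = n

theorem OrthBasis.norm_eq {x y u v : Fin 4 → ℤ} (h : OrthBasis x y u v) {l g : ℝ} (hl : 0 < l)
    (hg : 0 < g) (hl2 : l ^ 2 = (ip u u : ℤ)) (hg2 : g ^ 2 = (gr u v : ℤ))
    (a : Fin 4 → ℤ) (j k : ℤ) :
    ((ip (a + j • u + k • v) (a + j • u + k • v) : ℤ) : ℝ) =
      ((ip a u : ℤ) / l + k * (ip u v : ℤ) / l + l * j) ^ 2 +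
      (((ip a v : ℤ) * l ^ 2 - (ip a u : ℤ) * (ip u v : ℤ)) / (l * g) + g / l * k) ^ 2 +
      hdist x y (ip x a) (ip y a) := by
  have h1 := ip_self_of_orthogonal h.xu h.xv h.yu h.yv h.gxy.ne' h.guv.ne' (a + j • u + k • v)
  have hux : ip u x = 0 := by rw [ip_comm, h.xu]
  have hvx : ip v x = 0 := by rw [ip_comm, h.xv]
  have huy : ip u y = 0 := by rw [ip_comm, h.yu]
  have hvy : ip v y = 0 := by rw [ip_comm, h.yv]
  rw [show ip (a + j • u + k • v) x = ip x a by
      rw [add_ip, add_ip, smul_ip, smul_ip, hux, hvx, ip_comm a]; ring,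
    show ip (a + j • u + k • v) y = ip y a by
      rw [add_ip, add_ip, smul_ip, smul_ip, huy, hvy, ip_comm a]; ring,
    show ip (a + j • u + k • v) u = ip a u + j * ip u u + k * ip u v by
      rw [add_ip, add_ip, smul_ip, smul_ip, ip_comm v u],
    show ip (a + j • u + k • v) v = ip a v + j * ip u v + k * ip v v by
      rw [add_ip, add_ip, smul_ip, smul_ip]] at h1
  have hG : ((gr u v : ℤ) : ℝ) = (ip u u : ℤ) * (ip v v : ℤ) - (ip u v : ℤ) ^ 2 := by
    unfold gr; push_cast; ring
  have h2 := congrArg (fun z : ℤ => (z : ℝ)) h1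
  push_cast at h2
  set N : ℝ := ((ip (a + j • u + k • v) (a + j • u + k • v) : ℤ) : ℝ)
  have hxy : (0 : ℝ) < (gr x y : ℤ) := by exact_mod_cast h.gxy
  unfold hdist
  set D : ℝ := ((gr x y : ℤ) : ℝ)
  rw [← hl2] at h2 hG
  rw [← hg2] at h2 hG
  generalize ((ip a u : ℤ) : ℝ) = p at *
  generalize ((ip a v : ℤ) : ℝ) = q at *
  generalize ((ip u v : ℤ) : ℝ) = c at *
  generalize ((ip v v : ℤ) : ℝ) = V at *
  generalize ((ip x a : ℤ) : ℝ) = m at *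
  generalize ((ip y a : ℤ) : ℝ) = n at *
  generalize ((ip x x : ℤ) : ℝ) = X at *
  generalize ((ip y y : ℤ) : ℝ) = Y at *
  generalize ((ip x y : ℤ) : ℝ) = Z at *
  have hV : V = (g ^ 2 + c ^ 2) / l ^ 2 := by field_simp; linarith
  subst hV
  have : N = (D * ((p + j * l ^ 2 + k * c) ^ 2 * ((g ^ 2 + c ^ 2) / l ^ 2) -
      2 * (p + j * l ^ 2 + k * c) * (q + j * c + k * ((g ^ 2 + c ^ 2) / l ^ 2)) * c +
      (q + j * c + k * ((g ^ 2 + c ^ 2) / l ^ 2)) ^ 2 * l ^ 2) +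
      g ^ 2 * (m ^ 2 * Y - 2 * m * n * Z + n ^ 2 * X)) / (D * g ^ 2) := by
    rw [← h2]; field_simp
  rw [this]
  field_simp
  ring

theorem hdist_nonneg {x y : Fin 4 → ℤ} (h : 0 < gr x y) (m n : ℤ) : 0 ≤ hdist x y m n := by
  unfold hdist
  apply div_nonneg
  · have : (0 : ℤ) ≤ m ^ 2 * ip y y - 2 * m * n * ip x y + n ^ 2 * ip x x := by
      have := ip_self_nonneg (m • y - n • x)
      simp only [ip_sub, sub_ip, ip_smul, smul_ip, ip_comm y x] at this
      linarith
    exact_mod_cast this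
  · exact_mod_cast h.le

theorem OrthBasis.half_le {x y u v : Fin 4 → ℤ} (h : OrthBasis x y u v) {l g : ℝ} (hl : 0 < l)
    (hg : 0 < g) (hl2 : l ^ 2 = (ip u u : ℤ)) (hg2 : g ^ 2 = (gr u v : ℤ)) : l / 2 ≤ g / l := by
  have h1 : ip u u ^ 2 ≤ 4 * gr u v := by
    unfold gr
    have := mul_self_le_mul_self (by positivity) h.red
    nlinarith [sq_abs (ip u v), h.le, h.pos]
  have h2 : ((ip u u : ℤ) : ℝ) ^ 2 ≤ 4 * (gr u v : ℤ) := by exact_mod_cast h1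
  rw [← hl2, ← hg2] at h2
  have h3 : l ^ 2 ≤ 2 * g := abs_le_of_sq_le_sq' (by nlinarith) (by positivity) |>.2
  rw [div_le_div_iff₀ two_pos hl]; nlinarith

theorem OrthBasis.indep {x y u v : Fin 4 → ℤ} (h : OrthBasis x y u v) {j k : ℤ}
    (e : j • u + k • v = 0) : j = 0 ∧ k = 0 := by
  have h1 : j * ip u u + k * ip u v = 0 := by
    have := congrArg (ip u) e
    simpa only [ip_add, ip_smul, ip_zero] using this
  have h2 : j * ip u v + k * ip v v = 0 := by
    have := congrArg (ip v) e
    simpa only [ip_add, ip_smul, ip_zero, ip_comm v u] using this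
  have hg := h.guv
  have a1 : j * gr u v = 0 := by unfold gr; linear_combination ip v v * h1 - ip u v * h2
  have a2 : k * gr u v = 0 := by unfold gr; linear_combination ip u u * h2 - ip u v * h1
  exact ⟨(mul_eq_zero.mp a1).resolve_right hg.ne', (mul_eq_zero.mp a2).resolve_right hg.ne'⟩

theorem OrthBasis.slice {x y u v : Fin 4 → ℤ} (h : OrthBasis x y u v) {l g : ℝ} (hl : 0 < l)
    (hg : 0 < g) (hl2 : l ^ 2 = (ip u u : ℤ)) (hg2 : g ^ 2 = (gr u v : ℤ))
    {m n : ℤ} (a : Fin 4 → ℤ) (hm : ip x a = m) (hn : ip y a = n) {T : ℝ} (hT : 0 ≤ T)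
    (hH : hdist x y m n ≤ T ^ 2) :
    |((slc x y m n T).card : ℝ) - Real.pi * (T ^ 2 - hdist x y m n) / g| ≤ 8 * T / l + 1 := by
  subst hm hn
  set H := hdist x y (ip x a) (ip y a) with hHdef
  set R := T ^ 2 - H with hR
  have hR0 : 0 ≤ R := by linarith
  have hs : 0 < g / l := by positivity
  set β : ℝ := ((ip a v : ℤ) * l ^ 2 - (ip a u : ℤ) * (ip u v : ℤ)) / (l * g) with hβ
  set γ : ℤ → ℝ := fun k => (ip a u : ℤ) / l + k * (ip u v : ℤ) / l with hγ
  have hux : ip x u = 0 := h.xu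
  have hc := grid_count β γ hR0 hl hs
  have hcard : (slc x y (ip x a) (ip y a) T).card =
      ((gk (g / l) β R).sigma fun k => gk l (γ k) (R - (β + g / l * k) ^ 2)).card := by
    symm
    have hmem : ∀ j k : ℤ, ((ip (a + j • u + k • v) (a + j • u + k • v) : ℤ) : ℝ) ≤ T ^ 2 ↔
        (β + g / l * k) ^ 2 ≤ R ∧ (γ k + l * j) ^ 2 ≤ R - (β + g / l * k) ^ 2 := by
      intro j k
      rw [h.norm_eq hl hg hl2 hg2, ← hβ, ← hHdef]
      have := sq_nonneg (γ k + l * j)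
      constructor
      · intro h1; constructor <;> linarith
      · rintro ⟨-, h2⟩; linarith
    refine Finset.card_bij (fun p _ => a + p.2 • u + p.1 • v) ?_ ?_ ?_
    · rintro ⟨k, j⟩ hkj
      rw [Finset.mem_sigma, mem_gk hR0 hs] at hkj
      have h1 := hkj.1
      have h2 := hkj.2
      rw [mem_gk (by simp only; linarith) hl] at h2
      rw [slc, Finset.mem_filter, mem_bl hT]
      refine ⟨(hmem j k).mpr ⟨h1, h2⟩, ?_, ?_⟩
      · rw [ip_add, ip_add, ip_smul, ip_smul, h.xu, h.xv]; ring
      · rw [ip_add, ip_add, ip_smul, ip_smul, h.yu, h.yv]; ring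
    · rintro ⟨k, j⟩ - ⟨k', j'⟩ - e
      simp only at e
      have : (j - j') • u + (k - k') • v = 0 := by
        rw [sub_smul, sub_smul]
        have : a + j • u + k • v - (a + j' • u + k' • v) = 0 := by rw [e, sub_self]
        rw [← this]; abel
      obtain ⟨e1, e2⟩ := h.indep this
      have e1 : j = j' := by omega
      have e2 : k = k' := by omega
      subst e1 e2; rfl
    · intro b hb
      rw [slc, Finset.mem_filter, mem_bl hT] at hb
      obtain ⟨j, k, e⟩ := h.span (b - a) (by rw [ip_sub, hb.2.1, sub_self])
        (by rw [ip_sub, hb.2.2, sub_self])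
      have e' : a + j • u + k • v = b := by rw [add_assoc, ← e]; abel
      have := (hmem j k).mp (by rw [e']; exact hb.1)
      refine ⟨⟨k, j⟩, ?_, e'⟩
      rw [Finset.mem_sigma, mem_gk hR0 hs]
      refine ⟨this.1, ?_⟩
      rw [mem_gk (by simp only; linarith [this.1]) hl]
      exact this.2
  rw [hcard]
  have e : l * (g / l) = g := by field_simp
  rw [e] at hc
  refine hc.trans ?_
  have hsq : Real.sqrt R ≤ T := Real.sqrt_le_iff.mpr ⟨hT, by linarith [hdist_nonneg h.gxy (ip x a) (ip y a)]⟩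
  have hhalf := h.half_le hl hg hl2 hg2
  have : 2 * Real.sqrt R / (g / l) ≤ 4 * T / l := by
    calc 2 * Real.sqrt R / (g / l) ≤ 2 * T / (l / 2) := by gcongr
      _ = 4 * T / l := by field_simp; ring
  have : 4 * Real.sqrt R / l ≤ 4 * T / l := by gcongr
  have e8 : 8 * T / l = 4 * T / l + 4 * T / l := by ring
  linarith

theorem OrthBasis.slice_eq_zero {x y u v : Fin 4 → ℤ} (h : OrthBasis x y u v)
    {m n : ℤ} {T : ℝ} (hT : 0 ≤ T) (hH : T ^ 2 < hdist x y m n) : (slc x y m n T).card = 0 := by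
  rw [Finset.card_eq_zero, Finset.eq_empty_iff_forall_notMem]
  intro a ha
  rw [slc, Finset.mem_filter, mem_bl hT] at ha
  obtain ⟨h1, rfl, rfl⟩ := ha
  have hl : (0 : ℝ) < (ip u u : ℤ) := by exact_mod_cast h.pos
  have hg : (0 : ℝ) < (gr u v : ℤ) := by exact_mod_cast h.guv
  have := h.norm_eq (Real.sqrt_pos.mpr hl) (Real.sqrt_pos.mpr hg) (Real.sq_sqrt hl.le)
    (Real.sq_sqrt hg.le) a 0 0
  rw [zero_smul, zero_smul, add_zero, add_zero] at this
  rw [this] at h1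
  have s1 := fun z : ℝ => sq_nonneg z
  generalize (((ip a v : ℤ) : ℝ) * _ - _) / _ + _ = z1 at h1
  generalize ((ip a u : ℤ) : ℝ) / _ + _ + _ = z2 at h1
  nlinarith [s1 z1, s1 z2]

/-- Euclidean norm of an integer vector. -/
noncomputable def vn (x : Fin 4 → ℤ) : ℝ := Real.sqrt ((ip x x : ℤ) : ℝ)

theorem vn_nonneg (x : Fin 4 → ℤ) : 0 ≤ vn x := Real.sqrt_nonneg _

theorem vn_sq (x : Fin 4 → ℤ) : vn x ^ 2 = ((ip x x : ℤ) : ℝ) :=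
  Real.sq_sqrt (by exact_mod_cast ip_self_nonneg x)

theorem vn_pos {x : Fin 4 → ℤ} (h : x ≠ 0) : 0 < vn x :=
  Real.sqrt_pos.mpr (by exact_mod_cast ip_self_pos h)

theorem one_le_vn {x : Fin 4 → ℤ} (h : x ≠ 0) : 1 ≤ vn x := by
  rw [vn, Real.one_le_sqrt]
  have := ip_self_pos h
  exact_mod_cast this

theorem mem_bl_iff_vn {T : ℝ} (hT : 0 ≤ T) (a : Fin 4 → ℤ) : a ∈ bl T ↔ vn a ≤ T := by
  rw [mem_bl hT, ← vn_sq, sq_le_sq₀ (vn_nonneg a) hT]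

/-- Square root of the Gram determinant. -/
noncomputable def sg (x y : Fin 4 → ℤ) : ℝ := Real.sqrt ((gr x y : ℤ) : ℝ)

theorem sg_sq (x y : Fin 4 → ℤ) : sg x y ^ 2 = ((gr x y : ℤ) : ℝ) :=
  Real.sq_sqrt (by exact_mod_cast gr_nonneg x y)

theorem sg_nonneg (x y : Fin 4 → ℤ) : 0 ≤ sg x y := Real.sqrt_nonneg _

theorem sg_pos {x y : Fin 4 → ℤ} (h : 0 < gr x y) : 0 < sg x y :=
  Real.sqrt_pos.mpr (by exact_mod_cast h)

theorem sg_comm (x y : Fin 4 → ℤ) : sg x y = sg y x := by rw [sg, sg, gr_comm]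

/-- The indicator of orthogonality. -/
noncomputable def ee (x a : Fin 4 → ℤ) : ℝ := if ip x a = 0 then 1 else 0

/-- The local model of the indicator of orthogonality. -/
noncomputable def ff (α : ℝ) (W : ℤ) (x a : Fin 4 → ℤ) : ℝ :=
  if W ∣ ip x a ∧ |((ip x a : ℤ) : ℝ)| ≤ vn x * vn a / (2 * α) then α * W / (vn a * vn x) else 0

theorem ee_nonneg (x a : Fin 4 → ℤ) : 0 ≤ ee x a := by unfold ee; split_ifs <;> norm_num

theorem ee_le_one (x a : Fin 4 → ℤ) : ee x a ≤ 1 := by unfold ee; split_ifs <;> norm_num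

theorem ff_nonneg {α : ℝ} {W : ℤ} (hα : 0 ≤ α) (hW : 0 ≤ W) (x a : Fin 4 → ℤ) :
    0 ≤ ff α W x a := by
  have := vn_nonneg x
  have := vn_nonneg a
  have : (0 : ℝ) ≤ W := by exact_mod_cast hW
  unfold ff; split_ifs <;> positivity

/-- Integer points of a spherical shell. -/
noncomputable def shl (r r' : ℝ) : Finset (Fin 4 → ℤ) := bl r' \ bl r

theorem mem_shl {r r' : ℝ} (hr : 0 ≤ r) (hr' : 0 ≤ r') (a : Fin 4 → ℤ) :
    a ∈ shl r r' ↔ r < vn a ∧ vn a ≤ r' := by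
  rw [shl, Finset.mem_sdiff, mem_bl_iff_vn hr, mem_bl_iff_vn hr', not_le, and_comm]

/-- Integer points of a shell on the plane `⟨x,·⟩ = m`, `⟨y,·⟩ = n`. -/
noncomputable def ssl (x y : Fin 4 → ℤ) (r r' : ℝ) (m n : ℤ) : ℝ :=
  (((shl r r').filter fun a => ip x a = m ∧ ip y a = n).card : ℝ)

theorem ssl_nonneg (x y : Fin 4 → ℤ) (r r' : ℝ) (m n : ℤ) : 0 ≤ ssl x y r r' m n := by
  unfold ssl; positivity

theorem ssl_eq {x y : Fin 4 → ℤ} {r r' : ℝ} (hr : 0 ≤ r) (h : r ≤ r') (m n : ℤ) :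
    ssl x y r r' m n = ((slc x y m n r').card : ℝ) - (slc x y m n r).card := by
  have hsub : slc x y m n r ⊆ slc x y m n r' := by
    intro a ha
    rw [slc, Finset.mem_filter, mem_bl_iff_vn] at *
    · exact ⟨ha.1.trans h, ha.2⟩
    all_goals linarith
  have := Finset.card_sdiff_add_card_eq_card hsub
  rw [ssl, ← this]
  have e : (shl r r').filter (fun a => ip x a = m ∧ ip y a = n) = slc x y m n r' \ slc x y m n r := by
    ext a
    simp only [shl, slc, Finset.mem_filter, Finset.mem_sdiff]
    tauto
  rw [e]; push_cast; ring

theorem OrthBasis.ssl_le {x y u v : Fin 4 → ℤ} (h : OrthBasis x y u v) {ρ η : ℝ} (hρ : 0 < ρ)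
    (hη : 0 < η) (hη1 : η ≤ 1) (m n : ℤ) :
    ssl x y ρ ((1 + η) * ρ) m n ≤
      Real.pi / sg u v * (((1 + η) ^ 2 - 1) * ρ ^ 2) + (24 * ρ / vn u + 2) := by
  have hup : 0 < vn u := Real.sqrt_pos.mpr (by exact_mod_cast h.pos)
  have hg := sg_pos h.guv
  have hρ' : ρ ≤ (1 + η) * ρ := by nlinarith
  have hD : 0 ≤ (1 + η) ^ 2 - 1 := by nlinarith
  rw [ssl_eq hρ.le hρ']
  set ρ' := (1 + η) * ρ with hρd
  have hsum : 8 * ρ' / vn u + 8 * ρ / vn u ≤ 24 * ρ / vn u := by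
    rw [← add_div]; gcongr; nlinarith
  have hpos : 0 ≤ 8 * ρ / vn u := by positivity
  have hmain : 0 ≤ Real.pi / sg u v * (((1 + η) ^ 2 - 1) * ρ ^ 2) := by
    have := Real.pi_pos; positivity
  have hc0 : (0 : ℝ) ≤ ((slc x y m n ρ).card : ℝ) := by positivity
  rcases Finset.eq_empty_or_nonempty (slc x y m n ρ') with h0 | ⟨a, ha⟩
  · rw [h0, Finset.card_empty]; push_cast
    have : 0 ≤ 24 * ρ / vn u := by positivity
    linarith
  rw [slc, Finset.mem_filter] at ha
  have hsl := fun T hT hH => h.slice (T := T) hup hg (vn_sq u) (sg_sq u v) a ha.2.1 ha.2.2 hT hH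
  rcases le_or_gt (hdist x y m n) (ρ' ^ 2) with h1 | h1
  · have a1 := (abs_le.mp (hsl ρ' (by positivity) h1)).2
    rcases le_or_gt (hdist x y m n) (ρ ^ 2) with h2 | h2
    · have a2 := (abs_le.mp (hsl ρ (by positivity) h2)).1
      have e : Real.pi * (ρ' ^ 2 - hdist x y m n) / sg u v - Real.pi * (ρ ^ 2 - hdist x y m n) / sg u v
        = Real.pi / sg u v * (((1 + η) ^ 2 - 1) * ρ ^ 2) := by rw [hρd]; field_simp; ring
      linarith
    · have : Real.pi * (ρ' ^ 2 - hdist x y m n) / sg u v ≤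
          Real.pi / sg u v * (((1 + η) ^ 2 - 1) * ρ ^ 2) := by
        rw [mul_div_right_comm]
        have := Real.pi_pos
        gcongr
        rw [hρd]; nlinarith
      linarith
  · rw [h.slice_eq_zero (by positivity) h1]; push_cast
    have : 0 ≤ 24 * ρ / vn u := by positivity
    linarith

theorem OrthBasis.le_ssl {x y u v : Fin 4 → ℤ} (h : OrthBasis x y u v) {ρ η : ℝ} (hρ : 0 < ρ)
    (hη : 0 < η) (hη1 : η ≤ 1) {m n : ℤ} (hH : hdist x y m n ≤ ρ ^ 2)
    (a : Fin 4 → ℤ) (hm : ip x a = m) (hn : ip y a = n) :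
    Real.pi / sg u v * (((1 + η) ^ 2 - 1) * ρ ^ 2) - (24 * ρ / vn u + 2) ≤
      ssl x y ρ ((1 + η) * ρ) m n := by
  have hup : 0 < vn u := Real.sqrt_pos.mpr (by exact_mod_cast h.pos)
  have hg := sg_pos h.guv
  have hρ' : ρ ≤ (1 + η) * ρ := by nlinarith
  rw [ssl_eq hρ.le hρ']
  set ρ' := (1 + η) * ρ with hρd
  have hsum : 8 * ρ' / vn u + 8 * ρ / vn u ≤ 24 * ρ / vn u := by
    rw [← add_div]; gcongr; nlinarith
  have hsl := fun T hT hH => h.slice (T := T) hup hg (vn_sq u) (sg_sq u v) a hm hn hT hH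
  have a1 := (abs_le.mp (hsl ρ' (by positivity) (hH.trans (by gcongr)))).1
  have a2 := (abs_le.mp (hsl ρ (by positivity) hH)).2
  have e : Real.pi * (ρ' ^ 2 - hdist x y m n) / sg u v - Real.pi * (ρ ^ 2 - hdist x y m n) / sg u v
    = Real.pi / sg u v * (((1 + η) ^ 2 - 1) * ρ ^ 2) := by rw [hρd]; field_simp; ring
  linarith

/-- The gcd of the `2 × 2` minors. -/
def gm (x y : Fin 4 → ℤ) : ℤ := Finset.univ.gcd fun q : Fin 4 × Fin 4 => mn x y q.1 q.2

theorem gm_dvd (x y : Fin 4 → ℤ) (i j : Fin 4) : gm x y ∣ mn x y i j :=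
  Finset.gcd_dvd (f := fun q : Fin 4 × Fin 4 => mn x y q.1 q.2) (Finset.mem_univ (i, j))

theorem dvd_gm {x y : Fin 4 → ℤ} {d : ℤ} (h : ∀ i j, d ∣ mn x y i j) : d ∣ gm x y :=
  Finset.dvd_gcd fun q _ => h q.1 q.2

theorem gm_dvd_comm (x y : Fin 4 → ℤ) : gm x y ∣ gm y x := by
  apply dvd_gm
  intro i j
  have := gm_dvd x y j i
  have e : mn y x i j = mn x y j i := by unfold mn; ring
  rwa [e]

theorem exists_ip_eq {x y : Fin 4 → ℤ} {n : ℤ} (h : gm x y ∣ n) :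
    ∃ a, ip x a = 0 ∧ ip y a = n := by
  let I : Ideal ℤ :=
    { carrier := {n | ∃ a, ip x a = 0 ∧ ip y a = n}
      zero_mem' := ⟨0, ip_zero _, ip_zero _⟩
      add_mem' := by
        rintro p q ⟨a, h1, h2⟩ ⟨b, h3, h4⟩
        exact ⟨a + b, by rw [ip_add, h1, h3, add_zero], by rw [ip_add, h2, h4]⟩
      smul_mem' := by
        rintro c p ⟨a, h1, h2⟩
        exact ⟨c • a, by rw [ip_smul, h1, mul_zero], by rw [ip_smul, h2, smul_eq_mul]⟩ }
  obtain ⟨d, hd⟩ := (inferInstance : I.IsPrincipal)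
  have hd' : ∀ n, n ∈ I ↔ d ∣ n := by
    intro n; rw [hd]; exact Ideal.mem_span_singleton
  have hall : ∀ i j, d ∣ mn x y i j := by
    intro i j
    rw [← hd']
    refine ⟨Pi.single j (x i) - Pi.single i (x j), ?_, ?_⟩
    · fin_cases i <;> fin_cases j <;> simp [ip] <;> ring
    · fin_cases i <;> fin_cases j <;> simp [ip, mn] <;> ring
  exact (hd' n).mpr ((dvd_gm hall).trans h)

/-- The `j` with `|W j| ≤ K`. -/
noncomputable def mw (W : ℤ) (K : ℝ) : Finset ℤ := Finset.Icc ⌈-(K / W)⌉ ⌊K / W⌋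

theorem mem_mw {W : ℤ} (hW : 0 < W) (K : ℝ) (j : ℤ) :
    j ∈ mw W K ↔ |((W * j : ℤ) : ℝ)| ≤ K := by
  have hW' : (0 : ℝ) < W := by exact_mod_cast hW
  rw [mw, Finset.mem_Icc, Int.ceil_le, Int.le_floor, ← abs_le, le_div_iff₀ hW', Int.cast_mul,
    abs_mul, abs_of_pos hW', mul_comm]

theorem card_mw_le (W : ℤ) {K : ℝ} (hW : 0 < W) (hK : 0 ≤ K) :
    ((mw W K).card : ℝ) ≤ 2 * K / W + 1 := by
  have hW' : (0 : ℝ) < W := by exact_mod_cast hW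
  have h0 : 0 ≤ K / W := by positivity
  have h := card_Icc_ceil_floor_le (a := -(K / W)) (b := K / W) (by linarith)
  refine h.trans (le_of_eq ?_); ring

theorem le_card_mw (W : ℤ) (K : ℝ) : 2 * K / W - 1 ≤ ((mw W K).card : ℝ) := by
  have h := le_card_Icc_ceil_floor (-(K / W)) (K / W)
  refine le_trans (le_of_eq ?_) h; ring

theorem ssl_eq_sum (x y : Fin 4 → ℤ) (r r' : ℝ) (m n : ℤ) :
    ssl x y r r' m n = ∑ a ∈ shl r r', if ip x a = m ∧ ip y a = n then (1 : ℝ) else 0 := by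
  rw [ssl, Finset.sum_boole]

theorem sum_ee_mul_ee (x y : Fin 4 → ℤ) (r r' : ℝ) :
    ∑ a ∈ shl r r', ee x a * ee y a = ssl x y r r' 0 0 := by
  rw [ssl_eq_sum]
  refine Finset.sum_congr rfl fun a _ => ?_
  unfold ee; split_ifs <;> simp_all

theorem sum_ff_mul_ff_le {α : ℝ} {W : ℤ} (hα : 0 < α) (hW : 0 < W) {r r' : ℝ} (hr : 0 < r)
    (hr' : r ≤ r') {x y : Fin 4 → ℤ} (hx : x ≠ 0) (hy : y ≠ 0) :
    ∑ a ∈ shl r r', ff α W x a * ff α W y a ≤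
      ∑ i ∈ mw W (vn x * r' / (2 * α)), ∑ j ∈ mw W (vn y * r' / (2 * α)),
        (α * W / (r * vn x)) * (α * W / (r * vn y)) * ssl x y r r' (W * i) (W * j) := by
  have hW' : (0 : ℝ) < W := by exact_mod_cast hW
  have hvx := vn_pos hx
  have hvy := vn_pos hy
  simp only [ssl_eq_sum, Finset.mul_sum]
  rw [Finset.sum_congr rfl fun i _ => Finset.sum_comm, Finset.sum_comm]
  refine Finset.sum_le_sum fun a ha => ?_
  rw [mem_shl hr.le (hr.le.trans hr')] at ha
  have hnn : ∀ i ∈ mw W (vn x * r' / (2 * α)), ∀ j ∈ mw W (vn y * r' / (2 * α)),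
      0 ≤ (α * W / (r * vn x)) * (α * W / (r * vn y)) *
        (if ip x a = W * i ∧ ip y a = W * j then (1 : ℝ) else 0) := by
    intro i _ j _
    have : (0 : ℝ) ≤ (if ip x a = W * i ∧ ip y a = W * j then (1 : ℝ) else 0) := by
      split_ifs <;> norm_num
    positivity
  have hnn' := Finset.sum_nonneg fun i hi => Finset.sum_nonneg (hnn i hi)
  by_cases h1 : W ∣ ip x a ∧ |((ip x a : ℤ) : ℝ)| ≤ vn x * vn a / (2 * α)
  swap
  · rw [ff, if_neg h1, zero_mul]; exact hnn'
  by_cases h2 : W ∣ ip y a ∧ |((ip y a : ℤ) : ℝ)| ≤ vn y * vn a / (2 * α)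
  swap
  · rw [ff, ff, if_neg h2, mul_zero]; exact hnn'
  rw [ff, ff, if_pos h1, if_pos h2]
  obtain ⟨⟨i, hi⟩, h1⟩ := h1
  obtain ⟨⟨j, hj⟩, h2⟩ := h2
  have mi : i ∈ mw W (vn x * r' / (2 * α)) := by
    rw [mem_mw hW, ← hi]; refine h1.trans ?_
    gcongr; exact ha.2
  have mj : j ∈ mw W (vn y * r' / (2 * α)) := by
    rw [mem_mw hW, ← hj]; refine h2.trans ?_
    gcongr; exact ha.2
  refine le_trans ?_ (Finset.single_le_sum (fun i hi => Finset.sum_nonneg (hnn i hi)) mi)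
  refine le_trans ?_ (Finset.single_le_sum (hnn i mi) mj)
  rw [if_pos ⟨hi, hj⟩, mul_one]
  have := ha.1.le
  have h0 : 0 < vn a := hr.trans ha.1
  gcongr

theorem le_sum_ee_mul_ff {α : ℝ} {W : ℤ} (hα : 0 < α) (hW : 0 < W) {r r' : ℝ} (hr : 0 < r)
    (hr' : r ≤ r') {x y : Fin 4 → ℤ} (hy : y ≠ 0) :
    ∑ j ∈ mw W (vn y * r / (2 * α)), (α * W / (r' * vn y)) * ssl x y r r' 0 (W * j) ≤
      ∑ a ∈ shl r r', ee x a * ff α W y a := by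
  have hW' : (0 : ℝ) < W := by exact_mod_cast hW
  have hvy := vn_pos hy
  simp only [ssl_eq_sum, Finset.mul_sum]
  rw [Finset.sum_comm]
  refine Finset.sum_le_sum fun a ha => ?_
  rw [mem_shl hr.le (hr.le.trans hr')] at ha
  by_cases h : ∃ j ∈ mw W (vn y * r / (2 * α)), ip x a = 0 ∧ ip y a = W * j
  · obtain ⟨j, hj, h1, h2⟩ := h
    rw [Finset.sum_eq_single j]
    · rw [if_pos ⟨h1, h2⟩, mul_one, ee, if_pos h1, one_mul, ff, if_pos]
      · have h0 : 0 < vn a := hr.trans ha.1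
        gcongr; exact ha.2
      · refine ⟨⟨j, h2⟩, ?_⟩
        rw [mem_mw hW, ← h2] at hj
        refine hj.trans ?_
        gcongr; exact ha.1.le
    · intro k _ hk
      rw [if_neg, mul_zero]
      rintro ⟨-, h3⟩
      exact hk (mul_left_cancel₀ hW.ne' (h3.symm.trans h2))
    · intro h; exact absurd hj h
  · rw [Finset.sum_eq_zero]
    · exact mul_nonneg (ee_nonneg _ _) (ff_nonneg hα.le hW.le _ _)
    · intro j hj
      rw [if_neg, mul_zero]
      exact fun h' => h ⟨j, hj, h'⟩

/-- The shell correlation of a pair. -/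
noncomputable def ssum (α : ℝ) (W : ℤ) (r r' : ℝ) (x y : Fin 4 → ℤ) : ℝ :=
  ∑ a ∈ shl r r', (ee x a - ff α W x a) * (ee y a - ff α W y a)

theorem ssum_eq (α : ℝ) (W : ℤ) (r r' : ℝ) (x y : Fin 4 → ℤ) :
    ssum α W r r' x y = ssl x y r r' 0 0 - ∑ a ∈ shl r r', ee x a * ff α W y a
      - ∑ a ∈ shl r r', ee y a * ff α W x a + ∑ a ∈ shl r r', ff α W x a * ff α W y a := by
  rw [ssum, ← sum_ee_mul_ee, ← Finset.sum_sub_distrib, ← Finset.sum_sub_distrib,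
    ← Finset.sum_add_distrib]
  refine Finset.sum_congr rfl fun a _ => ?_
  ring

theorem OrthBasis.ne_zero {x y u v : Fin 4 → ℤ} (h : OrthBasis x y u v) : x ≠ 0 ∧ y ≠ 0 := by
  have := h.gxy
  constructor <;> rintro rfl <;> simp [gr, ip] at this

theorem OrthBasis.swap {x y u v : Fin 4 → ℤ} (h : OrthBasis x y u v) : OrthBasis y x u v :=
  ⟨h.yu, h.yv, h.xu, h.xv, by rw [gr_comm]; exact h.gxy, h.guv, h.red, h.le, h.pos,
    fun w a b => h.span w b a, fun w a b => h.min w b a⟩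

section Shell

variable {α η ρ : ℝ} {W : ℤ} {x y u v : Fin 4 → ℤ}

theorem OrthBasis.sum_ff_le (h : OrthBasis x y u v) (hα : 0 < α) (hW : 0 < W) (hρ : 0 < ρ)
    (hη : 0 < η) (hη1 : η ≤ 1) (hx : α * W ≤ η * (ρ * vn x)) (hy : α * W ≤ η * (ρ * vn y)) :
    ∑ a ∈ shl ρ ((1 + η) * ρ), ff α W x a * ff α W y a ≤ (1 + 8 * η) *
      (Real.pi / sg u v * (((1 + η) ^ 2 - 1) * ρ ^ 2) + (24 * ρ / vn u + 2)) := by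
  have hW' : (0 : ℝ) < W := by exact_mod_cast hW
  have hup : 0 < vn u := Real.sqrt_pos.mpr (by exact_mod_cast h.pos)
  have hg := sg_pos h.guv
  have hvx := vn_pos h.ne_zero.1
  have hvy := vn_pos h.ne_zero.2
  have hρ' : ρ ≤ (1 + η) * ρ := by nlinarith
  refine (sum_ff_mul_ff_le hα hW hρ hρ' h.ne_zero.1 h.ne_zero.2).trans ?_
  set M := Real.pi / sg u v * (((1 + η) ^ 2 - 1) * ρ ^ 2) + (24 * ρ / vn u + 2) with hM
  have hM0 : 0 ≤ M := (ssl_nonneg x y _ _ 0 0).trans (h.ssl_le hρ hη hη1 0 0)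
  have hcnt : ∀ z : Fin 4 → ℤ, 0 < vn z → α * W ≤ η * (ρ * vn z) →
      (α * W / (ρ * vn z)) * ((mw W (vn z * ((1 + η) * ρ) / (2 * α))).card : ℝ) ≤ 1 + 2 * η := by
    intro z hz h1
    have h2 := card_mw_le W (K := vn z * ((1 + η) * ρ) / (2 * α)) hW (by positivity)
    calc (α * W / (ρ * vn z)) * ((mw W (vn z * ((1 + η) * ρ) / (2 * α))).card : ℝ)
        ≤ (α * W / (ρ * vn z)) * (2 * (vn z * ((1 + η) * ρ) / (2 * α)) / W + 1) := by gcongr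
      _ = (1 + η) + α * W / (ρ * vn z) := by field_simp
      _ ≤ (1 + η) + η := by
        gcongr; rw [div_le_iff₀ (by positivity)]; exact h1
      _ = 1 + 2 * η := by ring
  calc _ ≤ ∑ i ∈ mw W (vn x * ((1 + η) * ρ) / (2 * α)), ∑ j ∈ mw W (vn y * ((1 + η) * ρ) / (2 * α)),
        (α * W / (ρ * vn x)) * (α * W / (ρ * vn y)) * M := by
        gcongr; exact h.ssl_le hρ hη hη1 _ _
    _ = ((α * W / (ρ * vn x)) * ((mw W (vn x * ((1 + η) * ρ) / (2 * α))).card : ℝ)) *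
        ((α * W / (ρ * vn y)) * ((mw W (vn y * ((1 + η) * ρ) / (2 * α))).card : ℝ)) * M := by
        simp only [Finset.sum_const, nsmul_eq_mul]; ring
    _ ≤ (1 + 2 * η) * (1 + 2 * η) * M := by
        gcongr
        · exact hcnt x hvx hx
        · exact hcnt y hvy hy
    _ ≤ (1 + 8 * η) * M := by gcongr; nlinarith

theorem OrthBasis.ssum_le (h : OrthBasis x y u v) (hα : 0 < α) (hW : 0 < W) (hρ : 0 < ρ)
    (hη : 0 < η) (hη1 : η ≤ 1 / 8) (hx : α * W ≤ η * (ρ * vn x)) (hy : α * W ≤ η * (ρ * vn y)) :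
    ssum α W ρ ((1 + η) * ρ) x y ≤
      3 * (Real.pi / sg u v * (((1 + η) ^ 2 - 1) * ρ ^ 2)) + 12 * (24 * ρ / vn u + 2) := by
  have hup : 0 < vn u := Real.sqrt_pos.mpr (by exact_mod_cast h.pos)
  have hg := sg_pos h.guv
  have hD : 0 ≤ (1 + η) ^ 2 - 1 := by nlinarith
  have h1 := h.ssl_le hρ hη (by linarith) 0 0
  have h2 := h.sum_ff_le hα hW hρ hη (by linarith) hx hy
  have h3 : ∀ x y, 0 ≤ ∑ a ∈ shl ρ ((1 + η) * ρ), ee x a * ff α W y a := fun x y =>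
    Finset.sum_nonneg fun a _ => mul_nonneg (ee_nonneg _ _) (ff_nonneg hα.le hW.le _ _)
  rw [ssum_eq]
  have h4 := h3 x y
  have h5 := h3 y x
  have h6 : 0 ≤ 24 * ρ / vn u + 2 := by positivity
  have h7 : 0 ≤ Real.pi / sg u v * (((1 + η) ^ 2 - 1) * ρ ^ 2) := by
    have := Real.pi_pos; positivity
  generalize 24 * ρ / vn u + 2 = E at *
  generalize Real.pi / sg u v * (((1 + η) ^ 2 - 1) * ρ ^ 2) = M at *
  nlinarith

theorem OrthBasis.le_sum_ee_ff (h : OrthBasis x y u v) (hα : 0 < α) (hW : 0 < W) (hρ : 0 < ρ)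
    (hη : 0 < η) (hη1 : η ≤ 1 / 8) (hy : α * W ≤ η * (ρ * vn y))
    (hg : gm x y ∣ W) (hbal : vn x * vn y ≤ 2 * α * sg x y) :
    (1 - 2 * η) * (Real.pi / sg u v * (((1 + η) ^ 2 - 1) * ρ ^ 2)) - (24 * ρ / vn u + 2) ≤
    ∑ a ∈ shl ρ ((1 + η) * ρ), ee x a * ff α W y a := by
  have hW' : (0 : ℝ) < W := by exact_mod_cast hW
  have hup : 0 < vn u := Real.sqrt_pos.mpr (by exact_mod_cast h.pos)
  have hguv := sg_pos h.guv
  have hgxy := sg_pos h.gxy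
  have hvy := vn_pos h.ne_zero.2
  have hvx := vn_pos h.ne_zero.1
  have hD : 0 ≤ (1 + η) ^ 2 - 1 := by nlinarith
  have hρ' : ρ ≤ (1 + η) * ρ := by nlinarith
  refine le_trans ?_ (le_sum_ee_mul_ff hα hW hρ hρ' h.ne_zero.2)
  set M := Real.pi / sg u v * (((1 + η) ^ 2 - 1) * ρ ^ 2) with hM
  set E := 24 * ρ / vn u + 2 with hE
  have hM0 : 0 ≤ M := by have := Real.pi_pos; positivity
  have hE0 : 0 ≤ E := by positivity
  have hlow : ∀ j ∈ mw W (vn y * ρ / (2 * α)), M - E ≤ ssl x y ρ ((1 + η) * ρ) 0 (W * j) := by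
    intro j hj
    obtain ⟨a, ha, hb⟩ := exists_ip_eq (x := x) (y := y) (n := W * j) (hg.mul_right j)
    refine h.le_ssl hρ hη (by linarith) ?_ a ha hb
    rw [mem_mw hW] at hj
    unfold hdist
    rw [← vn_sq x, ← vn_sq y, ← sg_sq x y]
    have h1 : ((W * j : ℤ) : ℝ) ^ 2 ≤ (vn y * ρ / (2 * α)) ^ 2 := by
      rw [← sq_abs]; gcongr
    rw [div_le_iff₀ (by positivity)]
    calc _ = ((W * j : ℤ) : ℝ) ^ 2 * vn x ^ 2 := by push_cast; ring
      _ ≤ (vn y * ρ / (2 * α)) ^ 2 * vn x ^ 2 := by gcongr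
      _ = ρ ^ 2 * ((vn x * vn y) / (2 * α)) ^ 2 := by field_simp
      _ ≤ ρ ^ 2 * sg x y ^ 2 := by
        gcongr; rw [div_le_iff₀ (by positivity)]; linarith
  set κ := (α * W / ((1 + η) * ρ * vn y)) * ((mw W (vn y * ρ / (2 * α))).card : ℝ) with hκ
  have hδ : α * W / (ρ * vn y) ≤ η := by rw [div_le_iff₀ (by positivity)]; exact hy
  have hκ1 : κ ≤ 1 := by
    have h2 := card_mw_le W (K := vn y * ρ / (2 * α)) hW (by positivity)
    calc κ ≤ (α * W / ((1 + η) * ρ * vn y)) * (2 * (vn y * ρ / (2 * α)) / W + 1) := by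
          rw [hκ]; gcongr
      _ = (1 + α * W / (ρ * vn y)) / (1 + η) := by field_simp
      _ ≤ 1 := by rw [div_le_one (by positivity)]; linarith
  have hκ2 : 1 - 2 * η ≤ κ := by
    have h2 := le_card_mw W (vn y * ρ / (2 * α))
    calc 1 - 2 * η ≤ (1 - η) / (1 + η) := by rw [le_div_iff₀ (by positivity)]; nlinarith
      _ ≤ (1 - α * W / (ρ * vn y)) / (1 + η) := by gcongr
      _ = (α * W / ((1 + η) * ρ * vn y)) * (2 * (vn y * ρ / (2 * α)) / W - 1) := by field_simp
      _ ≤ κ := by rw [hκ]; gcongr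
  calc (1 - 2 * η) * M - E ≤ κ * M - κ * E := by nlinarith
    _ = ∑ j ∈ mw W (vn y * ρ / (2 * α)), (α * W / ((1 + η) * ρ * vn y)) * (M - E) := by
        rw [Finset.sum_const, nsmul_eq_mul, hκ]; ring
    _ ≤ _ := by
        refine Finset.sum_le_sum fun j hj => ?_
        have := hlow j hj
        gcongr

theorem OrthBasis.ssum_le_of_good (h : OrthBasis x y u v) (hα : 0 < α) (hW : 0 < W) (hρ : 0 < ρ)
    (hη : 0 < η) (hη1 : η ≤ 1 / 8) (hx : α * W ≤ η * (ρ * vn x)) (hy : α * W ≤ η * (ρ * vn y))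
    (hg : gm x y ∣ W) (hbal : vn x * vn y ≤ 2 * α * sg x y) :
    ssum α W ρ ((1 + η) * ρ) x y ≤
      12 * η * (Real.pi / sg u v * (((1 + η) ^ 2 - 1) * ρ ^ 2)) + 12 * (24 * ρ / vn u + 2) := by
  have hup : 0 < vn u := Real.sqrt_pos.mpr (by exact_mod_cast h.pos)
  have h1 := h.ssl_le hρ hη (by linarith) 0 0
  have h2 := h.sum_ff_le hα hW hρ hη (by linarith) hx hy
  have h3 := h.le_sum_ee_ff hα hW hρ hη hη1 hy hg hbal
  have h4 := h.swap.le_sum_ee_ff hα hW hρ hη hη1 hx ((gm_dvd_comm y x).trans hg)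
    (by rw [mul_comm, sg_comm]; exact hbal)
  rw [ssum_eq]
  have h6 : 0 ≤ 24 * ρ / vn u + 2 := by positivity
  generalize 24 * ρ / vn u + 2 = E at *
  generalize Real.pi / sg u v * (((1 + η) ^ 2 - 1) * ρ ^ 2) = M at *
  nlinarith

end Shell

theorem gm_nonneg (x y : Fin 4 → ℤ) : 0 ≤ gm x y :=
  Int.nonneg_of_normalize_eq_self Finset.normalize_gcd

theorem gm_pos {x y : Fin 4 → ℤ} (h : 0 < gr x y) : 0 < gm x y := by
  refine lt_of_le_of_ne (gm_nonneg x y) fun h0 => ?_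
  have : gr x y = 0 := gr_eq_zero_of_mn fun i j => by
    have := gm_dvd x y i j
    rwa [← h0, zero_dvd_iff] at this
  omega

/-- The equality case of the Cauchy–Schwarz inequality. -/
theorem mul_eq_mul_of_cauchy_eq {ι : Type*} [Fintype ι] {P V : ι → ℤ}
    (h : (∑ i, P i * V i) ^ 2 = (∑ i, P i ^ 2) * ∑ i, V i ^ 2) (i j : ι) :
    P i * V j = P j * V i := by
  have key : ∑ i, ∑ j, (P i * V j - P j * V i) ^ 2 = 0 := by
    have e : ∀ i j, (P i * V j - P j * V i) ^ 2 =
        P i ^ 2 * V j ^ 2 - 2 * ((P i * V i) * (P j * V j)) + V i ^ 2 * P j ^ 2 := fun i j => by ring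
    simp only [e, Finset.sum_add_distrib, Finset.sum_sub_distrib, ← Finset.mul_sum,
      ← Finset.sum_mul]
    rw [← sq, h]; ring
  rw [Finset.sum_eq_zero_iff_of_nonneg (fun i _ => Finset.sum_nonneg fun j _ => sq_nonneg _)] at key
  have k1 := key i (Finset.mem_univ i)
  rw [Finset.sum_eq_zero_iff_of_nonneg (fun j _ => sq_nonneg _)] at k1
  have k2 := pow_eq_zero_iff (two_ne_zero) |>.mp (k1 j (Finset.mem_univ j))
  linarith

theorem OrthBasis.sg_le {x y u v : Fin 4 → ℤ} (h : OrthBasis x y u v) :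
    sg x y ≤ gm x y * sg u v := by
  let P : Fin 6 → ℤ := ![mn x y 0 1, mn x y 0 2, mn x y 0 3, mn x y 1 2, mn x y 1 3, mn x y 2 3]
  let V : Fin 6 → ℤ := ![mn u v 2 3, -mn u v 1 3, mn u v 1 2, mn u v 0 3, -mn u v 0 2, mn u v 0 1]
  have hP : ∑ i, P i ^ 2 = gr x y := by
    rw [gr_eq_mn]; simp [P, Fin.sum_univ_succ]; ring
  have hV : ∑ i, V i ^ 2 = gr u v := by
    rw [gr_eq_mn]; simp [V, Fin.sum_univ_succ]; ring
  have hPV : (∑ i, P i * V i) ^ 2 = (∑ i, P i ^ 2) * ∑ i, V i ^ 2 := by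
    rw [hP, hV, ← det_sq_of_orthogonal h.xu h.xv h.yu h.yv, det_eq_plucker]
    congr 1
    simp [P, V, Fin.sum_univ_succ]; ring
  have hprop := mul_eq_mul_of_cauchy_eq hPV
  let I : Ideal ℤ :=
    { carrier := {n | ∃ t, ∀ j, n * V j = t * P j}
      zero_mem' := ⟨0, fun j => by ring⟩
      add_mem' := by
        rintro p q ⟨a, h1⟩ ⟨b, h2⟩
        exact ⟨a + b, fun j => by linear_combination h1 j + h2 j⟩
      smul_mem' := by
        rintro c p ⟨a, h1⟩
        exact ⟨c * a, fun j => by rw [smul_eq_mul]; linear_combination c * h1 j⟩ }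
  obtain ⟨d, hd⟩ := (inferInstance : I.IsPrincipal)
  have hd' : ∀ n, n ∈ I ↔ d ∣ n := by
    intro n; rw [hd]; exact Ideal.mem_span_singleton
  have hmem : ∀ i, d ∣ P i := fun i => (hd' _).mp ⟨V i, fun j => by rw [hprop i j]; ring⟩
  have hall : ∀ i j, d ∣ mn x y i j := by
    have m01 : d ∣ mn x y 0 1 := hmem 0
    have m02 : d ∣ mn x y 0 2 := hmem 1
    have m03 : d ∣ mn x y 0 3 := hmem 2
    have m12 : d ∣ mn x y 1 2 := hmem 3
    have m13 : d ∣ mn x y 1 3 := hmem 4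
    have m23 : d ∣ mn x y 2 3 := hmem 5
    have hs : ∀ i j, mn x y i j = - mn x y j i := fun i j => by unfold mn; ring
    have h0 : ∀ i, mn x y i i = 0 := fun i => by unfold mn; ring
    intro i j
    fin_cases i <;> fin_cases j <;>
    first
    | assumption
    | exact (h0 _) ▸ dvd_zero d
    | exact (hs _ _) ▸ (dvd_neg.mpr (by assumption))
  obtain ⟨t, ht⟩ : gm x y ∈ I := (hd' _).mpr (dvd_gm hall)
  have hgm := gm_pos h.gxy
  have e : gm x y ^ 2 * gr u v = t ^ 2 * gr x y := by
    rw [← hP, ← hV, Finset.mul_sum, Finset.mul_sum]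
    refine Finset.sum_congr rfl fun j _ => ?_
    rw [← mul_pow, ht, mul_pow]
  have h1 := h.gxy
  have h2 := h.guv
  have ht0 : t ≠ 0 := by
    rintro rfl
    have : 0 < gm x y ^ 2 * gr u v := by positivity
    rw [e] at this; simp at this
  have ht1 : 1 ≤ t ^ 2 := by
    have : 0 < t ^ 2 := by positivity
    omega
  have hle : gr x y ≤ gm x y ^ 2 * gr u v := by rw [e]; nlinarith
  have hg0 : (0 : ℝ) ≤ gm x y := by exact_mod_cast hgm.le
  refine abs_le_of_sq_le_sq' ?_ (mul_nonneg hg0 (sg_nonneg u v)) |>.2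
  rw [mul_pow, sg_sq, sg_sq]
  exact_mod_cast hle

/-- The weight of an independent pair. -/
noncomputable def mu (x y : Fin 4 → ℤ) : ℝ := gm x y / sg x y

theorem mu_nonneg (x y : Fin 4 → ℤ) : 0 ≤ mu x y :=
  div_nonneg (by exact_mod_cast gm_nonneg x y) (sg_nonneg x y)

theorem OrthBasis.pi_div_le {x y u v : Fin 4 → ℤ} (h : OrthBasis x y u v) :
    Real.pi / sg u v ≤ Real.pi * mu x y := by
  have h1 := sg_pos h.gxy
  have h2 := sg_pos h.guv
  rw [mu, mul_div_assoc', div_le_div_iff₀ h2 h1]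
  have := mul_le_mul_of_nonneg_left h.sg_le Real.pi_pos.le
  linarith

theorem OrthBasis.gm_eq_one {x y u v : Fin 4 → ℤ} (h : OrthBasis x y u v) : gm u v = 1 := by
  have hg := gm_pos h.guv
  set d := gm u v with hd
  have hdiv : ∀ w, ip x w = 0 → ip y w = 0 → (∀ i, d ∣ w i) →
      ∃ i j : ℤ, w = (d * i) • u + (d * j) • v := by
    intro w hx hy hw
    choose z hz using hw
    have e : w = d • z := by ext i; rw [hz i]; simp
    rw [e, ip_smul] at hx hy
    obtain ⟨i, j, hij⟩ := h.span z ((mul_eq_zero.mp hx).resolve_left hg.ne')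
      ((mul_eq_zero.mp hy).resolve_left hg.ne')
    exact ⟨i, j, by rw [e, hij, smul_add, smul_smul, smul_smul]⟩
  have hu : ∀ i, d ∣ u i := by
    intro i
    obtain ⟨p, q, hpq⟩ := hdiv (u i • v - v i • u)
      (by rw [ip_sub, ip_smul, ip_smul, h.xu, h.xv]; ring)
      (by rw [ip_sub, ip_smul, ip_smul, h.yu, h.yv]; ring) (by
        intro j
        have := gm_dvd u v i j
        have e : (u i • v - v i • u) j = mn u v i j := by
          simp only [Pi.sub_apply, Pi.smul_apply, smul_eq_mul, mn]; ring
        rwa [e])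
    have : (d * p + v i) • u + (d * q - u i) • v = 0 := by
      have e : (d * p + v i) • u + (d * q - u i) • v =
        ((d * p) • u + (d * q) • v) - (u i • v - v i • u) := by module
      rw [e, ← hpq, sub_self]
    exact ⟨q, by linarith [(h.indep this).2]⟩
  obtain ⟨p, q, hpq⟩ := hdiv u h.xu h.yu hu
  have : (d * p - 1) • u + (d * q) • v = 0 := by
    have e : (d * p - 1) • u + (d * q) • v = ((d * p) • u + (d * q) • v) - u := by module
    rw [e, ← hpq, sub_self]
  have h1 : d * p = 1 := by linarith [(h.indep this).1]
  exact Int.eq_one_of_mul_eq_one_right hg.le h1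

theorem gm_smul_of_mn {x y u v : Fin 4 → ℤ} {k : ℤ} (h : ∀ i j, mn x y i j = k * mn u v i j) :
    gm x y = |k| * gm u v := by
  unfold gm
  simp only [h]
  rw [Finset.gcd_mul_left, Int.abs_eq_normalize]

theorem sg_smul_of_mn {x y u v : Fin 4 → ℤ} {k : ℤ} (h : ∀ i j, mn x y i j = k * mn u v i j) :
    sg x y = |(k : ℝ)| * sg u v := by
  have : gr x y = k ^ 2 * gr u v := by rw [gr_eq_mn, gr_eq_mn]; simp only [h]; ring
  rw [sg, sg, this]; push_cast
  rw [Real.sqrt_mul (sq_nonneg _), Real.sqrt_sq_eq_abs]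

/-- Small combinations of a pair of vectors. -/
noncomputable def lt (Z : ℝ) (u v : Fin 4 → ℤ) : Finset (Fin 4 → ℤ) :=
  ((mw 1 (2 * Z / vn u)) ×ˢ (mw 1 (2 * Z / vn v))).image fun p => p.1 • u + p.2 • v

theorem card_lt_le {Z : ℝ} {u v : Fin 4 → ℤ} (hu : u ≠ 0) (hv : v ≠ 0)
    (hu' : vn u ≤ 2 * Z) (hv' : vn v ≤ 2 * Z) :
    ((lt Z u v).card : ℝ) ≤ 36 * Z ^ 2 / (vn u * vn v) := by
  have hpu := vn_pos hu
  have hpv := vn_pos hv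
  have hZ : 0 ≤ 2 * Z := hpu.le.trans hu'
  have h1 := card_mw_le 1 (K := 2 * Z / vn u) one_pos (by positivity)
  have h2 := card_mw_le 1 (K := 2 * Z / vn v) one_pos (by positivity)
  have h3 : 1 ≤ 2 * Z / vn u := by rwa [le_div_iff₀ hpu, one_mul]
  have h4 : 1 ≤ 2 * Z / vn v := by rwa [le_div_iff₀ hpv, one_mul]
  have h5 : ((lt Z u v).card : ℝ) ≤ ((mw 1 (2 * Z / vn u)).card : ℝ) * (mw 1 (2 * Z / vn v)).card := by
    have := Finset.card_image_le (s := (mw 1 (2 * Z / vn u)) ×ˢ (mw 1 (2 * Z / vn v)))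
      (f := fun p => p.1 • u + p.2 • v)
    rw [Finset.card_product] at this
    exact_mod_cast this
  push_cast at h1 h2
  calc ((lt Z u v).card : ℝ) ≤ (3 * (2 * Z / vn u)) * (3 * (2 * Z / vn v)) :=
        h5.trans (mul_le_mul (by linarith) (by linarith) (by positivity) (by positivity))
    _ = _ := by field_simp; ring

theorem sum_sq_le_of_reduced {u v : Fin 4 → ℤ} (hred : 2 * |ip u v| ≤ ip u u)
    (hle : ip u u ≤ ip v v) (i j : ℤ) :
    i ^ 2 * ip u u + j ^ 2 * ip v v ≤ 2 * ip (i • u + j • v) (i • u + j • v) := by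
  have e : ip (i • u + j • v) (i • u + j • v) =
      i ^ 2 * ip u u + 2 * (i * j) * ip u v + j ^ 2 * ip v v := by
    simp only [ip_add, add_ip, ip_smul, smul_ip, ip_comm v u]; ring
  have h1 : -(i * j * ip u v) ≤ |i * j| * |ip u v| := by rw [← abs_mul]; exact neg_le_abs _
  have h2 : 2 * |i * j| ≤ i ^ 2 + j ^ 2 := by
    rw [abs_mul]; nlinarith [sq_nonneg (|i| - |j|), sq_abs i, sq_abs j]
  have h3 : |i * j| * (2 * |ip u v|) ≤ |i * j| * ip u u := by gcongr
  have h4 := ip_self_nonneg u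
  have h5 := sq_nonneg j
  rw [e]
  nlinarith [mul_le_mul_of_nonneg_right h2 h4, mul_le_mul_of_nonneg_left hle h5]

theorem exists_lt {Z X : ℝ} {x y : Fin 4 → ℤ} (hxy : gr x y ≠ 0) (hx : vn x ≤ Z) (hy : vn y ≤ Z)
    (hX : sg x y ≤ gm x y * X) :
    ∃ u v, u ≠ 0 ∧ v ≠ 0 ∧ vn u ≤ 2 * Z ∧ vn v ≤ 2 * Z ∧ vn u * vn v ≤ 2 * X ∧
      mu x y ≤ 2 / (vn u * vn v) ∧ x ∈ lt Z u v ∧ y ∈ lt Z u v := by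
  have hZ : 0 ≤ Z := (vn_nonneg x).trans hx
  obtain ⟨p, q, hpq⟩ := exists_orthBasis hxy
  obtain ⟨u, v, h⟩ := exists_orthBasis hpq.guv.ne'
  obtain ⟨i, j, hij⟩ := h.span x (by rw [ip_comm, hpq.xu]) (by rw [ip_comm, hpq.xv])
  obtain ⟨i', j', hij'⟩ := h.span y (by rw [ip_comm, hpq.yu]) (by rw [ip_comm, hpq.yv])
  have hmn : ∀ a b, mn x y a b = (i * j' - i' * j) * mn u v a b := by
    intro a b
    simp only [hij, hij', mn, Pi.add_apply, Pi.smul_apply, smul_eq_mul]; ring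
  have hu0 : u ≠ 0 := by
    rintro rfl; have := h.pos; simp [ip] at this
  have hv0 : v ≠ 0 := by
    rintro rfl; have := h.pos; have := h.le; simp [ip] at *; omega
  have hup := vn_pos hu0
  have hvp := vn_pos hv0
  have hgm := gm_smul_of_mn hmn
  rw [h.gm_eq_one, mul_one] at hgm
  have hsg := sg_smul_of_mn hmn
  have hk : i * j' - i' * j ≠ 0 := by
    intro h0
    have := gm_pos hpq.gxy
    rw [hgm, h0] at this; simp at this
  set k := i * j' - i' * j
  have hkr : (0 : ℝ) < |(k : ℝ)| := by positivity
  have hsguv := sg_pos h.guv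
  have hsg2 : vn u * vn v ≤ 2 * sg u v := by
    have h1 : ip u u * ip v v ≤ 4 * gr u v := by
      unfold gr
      have := mul_self_le_mul_self (by positivity) h.red
      nlinarith [sq_abs (ip u v), h.le, h.pos]
    refine abs_le_of_sq_le_sq' ?_ (by positivity) |>.2
    rw [mul_pow, mul_pow, vn_sq, vn_sq, sg_sq]
    have : ((ip u u : ℤ) : ℝ) * (ip v v : ℤ) ≤ 4 * (gr u v : ℤ) := by exact_mod_cast h1
    linarith
  have hgmr : ((gm x y : ℤ) : ℝ) = |(k : ℝ)| := by rw [hgm]; push_cast; rfl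
  have hcoef : ∀ z, ∀ i j : ℤ, z = i • u + j • v → vn z ≤ Z →
      |(i : ℝ)| * vn u ≤ 2 * Z ∧ |(j : ℝ)| * vn v ≤ 2 * Z := by
    intro z i j hz hzZ
    have h1 := sum_sq_le_of_reduced h.red h.le i j
    rw [← hz] at h1
    have h2 : (i : ℝ) ^ 2 * vn u ^ 2 + (j : ℝ) ^ 2 * vn v ^ 2 ≤ 2 * vn z ^ 2 := by
      rw [vn_sq, vn_sq, vn_sq]; exact_mod_cast h1
    have h3 : vn z ^ 2 ≤ Z ^ 2 := by have := vn_nonneg z; gcongr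
    constructor
    · refine abs_le_of_sq_le_sq' ?_ (by positivity) |>.2
      rw [mul_pow, sq_abs]; nlinarith [mul_nonneg (sq_nonneg (j : ℝ)) (sq_nonneg (vn v))]
    · refine abs_le_of_sq_le_sq' ?_ (by positivity) |>.2
      rw [mul_pow, sq_abs]; nlinarith [mul_nonneg (sq_nonneg (i : ℝ)) (sq_nonneg (vn u))]
  have hmem : ∀ z, ∀ i j : ℤ, z = i • u + j • v → vn z ≤ Z → z ∈ lt Z u v := by
    intro z i j hz hzZ
    obtain ⟨h1, h2⟩ := hcoef z i j hz hzZ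
    rw [lt, Finset.mem_image]
    refine ⟨(i, j), ?_, hz.symm⟩
    rw [Finset.mem_product, mem_mw one_pos, mem_mw one_pos]
    push_cast
    rw [one_mul, one_mul, le_div_iff₀ hup, le_div_iff₀ hvp]
    exact ⟨h1, h2⟩
  have hv2 : vn v ≤ 2 * Z := by
    have hj : j ≠ 0 ∨ j' ≠ 0 := by
      by_contra! hcon
      exact hk (by simp only [k, hcon.1, hcon.2]; ring)
    have key : ∀ z, ∀ i j : ℤ, z = i • u + j • v → vn z ≤ Z → j ≠ 0 → vn v ≤ 2 * Z := by
      intro z i j hz hzZ hj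
      refine le_trans ?_ (hcoef z i j hz hzZ).2
      have : (1 : ℝ) ≤ |(j : ℝ)| := by exact_mod_cast Int.one_le_abs hj
      nlinarith
    rcases hj with hj | hj
    · exact key x i j hij hx hj
    · exact key y i' j' hij' hy hj
  have huv : vn u ≤ vn v := Real.sqrt_le_sqrt (by exact_mod_cast h.le)
  refine ⟨u, v, hu0, hv0, huv.trans hv2, hv2, ?_, ?_, hmem x i j hij hx, hmem y i' j' hij' hy⟩
  · rw [hsg, hgmr] at hX
    have := le_of_mul_le_mul_left hX hkr
    linarith
  · rw [mu, hsg, hgmr]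
    have : |(k : ℝ)| / (|(k : ℝ)| * sg u v) = 1 / sg u v := by field_simp
    rw [this, div_le_div_iff₀ hsguv (by positivity)]; linarith

theorem sum_inv_max_le {T : ℝ} (hT : 1 ≤ T) :
    ∑ t ∈ Finset.Icc (-⌊T⌋) ⌊T⌋, (1 : ℝ) / max 1 |(t : ℝ)| ≤ 3 + 2 * Real.log T := by
  have hfl : 0 ≤ ⌊T⌋ := Int.floor_nonneg.mpr (by linarith)
  set n : ℕ := ⌊T⌋.toNat with hn
  have hn' : (n : ℤ) = ⌊T⌋ := Int.toNat_of_nonneg hfl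
  have hsub : Finset.Icc (-⌊T⌋) ⌊T⌋ ⊆ {0} ∪ ((Finset.range n).image (fun i : ℕ => ((i : ℤ) + 1)) ∪
      (Finset.range n).image (fun i : ℕ => -((i : ℤ) + 1))) := by
    intro t ht
    rw [Finset.mem_Icc] at ht
    simp only [Finset.mem_union, Finset.mem_singleton, Finset.mem_image, Finset.mem_range]
    rcases lt_trichotomy t 0 with h | h | h
    · right; right; exact ⟨(-t - 1).toNat, by omega, by omega⟩
    · left; exact h
    · right; left; exact ⟨(t - 1).toNat, by omega, by omega⟩
  have hnn : ∀ t : ℤ, (0 : ℝ) ≤ 1 / max 1 |(t : ℝ)| := fun t => by positivity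
  have hharm : ∑ i ∈ Finset.range n, (1 : ℝ) / ((i : ℝ) + 1) ≤ 1 + Real.log T := by
    have h1 := harmonic_floor_le_one_add_log T hT
    have e : n = ⌊T⌋₊ := by rw [hn]; exact Int.floor_toNat T
    rw [e]
    refine le_trans (le_of_eq ?_) h1
    rw [harmonic]; push_cast
    refine Finset.sum_congr rfl fun i _ => ?_
    rw [one_div]
  have him : ∀ f : ℕ → ℤ, (∀ i, |(f i : ℝ)| = (i : ℝ) + 1) →
      ∑ t ∈ (Finset.range n).image f, (1 : ℝ) / max 1 |(t : ℝ)| ≤ 1 + Real.log T := by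
    intro f hf
    refine (Finset.sum_image_le_of_nonneg (fun t _ => hnn t)).trans ?_
    refine le_trans (Finset.sum_le_sum fun i _ => ?_) hharm
    rw [hf, max_eq_right (by linarith [Nat.cast_nonneg (α := ℝ) i])]
  calc _ ≤ ∑ t ∈ {0} ∪ ((Finset.range n).image (fun i : ℕ => ((i : ℤ) + 1)) ∪
      (Finset.range n).image (fun i : ℕ => -((i : ℤ) + 1))), (1 : ℝ) / max 1 |(t : ℝ)| :=
        Finset.sum_le_sum_of_subset_of_nonneg hsub fun t _ _ => hnn t
    _ ≤ 1 + ((1 + Real.log T) + (1 + Real.log T)) := by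
        have key : ∀ A B : Finset ℤ, ∑ t ∈ A ∪ B, (1 : ℝ) / max 1 |(t : ℝ)| ≤
            ∑ t ∈ A, (1 : ℝ) / max 1 |(t : ℝ)| + ∑ t ∈ B, (1 : ℝ) / max 1 |(t : ℝ)| := by
          intro A B
          rw [← Finset.sum_union_inter]
          have := Finset.sum_nonneg fun t (_ : t ∈ A ∩ B) => hnn t
          linarith
        refine (key _ _).trans (add_le_add (by simp) ((key _ _).trans (add_le_add ?_ ?_)))
        · refine him _ fun i => ?_
          push_cast; rw [abs_of_nonneg (by positivity)]
        · refine him _ fun i => ?_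
          push_cast; rw [abs_neg, abs_of_nonneg (by positivity)]
    _ = _ := by ring

theorem sum_inv_vn_pow_le {T : ℝ} (hT : 1 ≤ T) :
    ∑ v ∈ (bl T).filter (· ≠ 0), 1 / vn v ^ 4 ≤ (3 + 2 * Real.log T) ^ 4 := by
  have h1 : ∀ v ∈ (bl T).filter (· ≠ 0), 1 / vn v ^ 4 ≤ ∏ i, (1 : ℝ) / max 1 |(v i : ℝ)| := by
    intro v hv
    rw [Finset.mem_filter] at hv
    have hp := vn_pos hv.2
    have h2 : ∀ i, max 1 |(v i : ℝ)| ≤ vn v := by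
      intro i
      refine max_le (one_le_vn hv.2) ?_
      refine Real.abs_le_sqrt ?_
      exact_mod_cast sq_le_ip_self v i
    have h3 : ∀ i, 1 / vn v ≤ (1 : ℝ) / max 1 |(v i : ℝ)| := fun i =>
      one_div_le_one_div_of_le (by positivity) (h2 i)
    calc 1 / vn v ^ 4 = ∏ _i : Fin 4, 1 / vn v := by simp
      _ ≤ _ := Finset.prod_le_prod (fun i _ => by positivity) fun i _ => h3 i
  calc _ ≤ ∑ v ∈ (bl T).filter (· ≠ 0), ∏ i, (1 : ℝ) / max 1 |(v i : ℝ)| := Finset.sum_le_sum h1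
    _ ≤ ∑ v ∈ Fintype.piFinset (fun _ : Fin 4 => Finset.Icc (-⌊T⌋) ⌊T⌋),
        ∏ i, (1 : ℝ) / max 1 |(v i : ℝ)| := by
        refine Finset.sum_le_sum_of_subset_of_nonneg ?_ fun v _ _ =>
          Finset.prod_nonneg fun i _ => by positivity
        intro v hv
        rw [Finset.mem_filter, bl, Finset.mem_filter] at hv
        exact hv.1.1
    _ = ∏ _i : Fin 4, ∑ t ∈ Finset.Icc (-⌊T⌋) ⌊T⌋, (1 : ℝ) / max 1 |(t : ℝ)| :=
        by
        rw [Finset.prod_univ_sum (fun _ : Fin 4 => Finset.Icc (-⌊T⌋) ⌊T⌋)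
          (fun _ t => (1 : ℝ) / max 1 |(t : ℝ)|)]
    _ = (∑ t ∈ Finset.Icc (-⌊T⌋) ⌊T⌋, (1 : ℝ) / max 1 |(t : ℝ)|) ^ 4 := by simp
    _ ≤ _ := by
        have := sum_inv_max_le hT
        have h0 : (0 : ℝ) ≤ ∑ t ∈ Finset.Icc (-⌊T⌋) ⌊T⌋, (1 : ℝ) / max 1 |(t : ℝ)| :=
          Finset.sum_nonneg fun t _ => by positivity
        gcongr

/-- The sum of the weights over independent pairs with small covolume. -/
theorem sum_mu_le {Z X : ℝ} (hZ : 1 ≤ Z) (hX : 0 ≤ X) (S : Finset ((Fin 4 → ℤ) × (Fin 4 → ℤ)))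
    (hS : ∀ p ∈ S, gr p.1 p.2 ≠ 0 ∧ vn p.1 ≤ Z ∧ vn p.2 ≤ Z ∧ sg p.1 p.2 ≤ gm p.1 p.2 * X) :
    ∑ p ∈ S, mu p.1 p.2 ≤ 5184 * Z ^ 4 * X * (3 + 2 * Real.log (2 * Z)) ^ 8 := by
  classical
  set b := (bl (2 * Z)).filter (· ≠ 0) with hb
  set V := (b ×ˢ b).filter (fun q => vn q.1 * vn q.2 ≤ 2 * X) with hV
  have hVm : ∀ q ∈ V, q.1 ≠ 0 ∧ q.2 ≠ 0 ∧ vn q.1 ≤ 2 * Z ∧ vn q.2 ≤ 2 * Z ∧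
      vn q.1 * vn q.2 ≤ 2 * X := by
    intro q hq
    rw [hV, Finset.mem_filter, Finset.mem_product, hb, Finset.mem_filter, Finset.mem_filter,
      mem_bl_iff_vn (by linarith), mem_bl_iff_vn (by linarith)] at hq
    tauto
  have h1 : ∀ p ∈ S, mu p.1 p.2 ≤
      ∑ q ∈ V, 2 / (vn q.1 * vn q.2) * (if p ∈ lt Z q.1 q.2 ×ˢ lt Z q.1 q.2 then 1 else 0) := by
    intro p hp
    obtain ⟨a1, a2, a3, a4⟩ := hS p hp
    obtain ⟨u, v, b1, b2, b3, b4, b5, b6, b7, b8⟩ := exists_lt a1 a2 a3 a4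
    have hmem : (u, v) ∈ V := by
      rw [hV, Finset.mem_filter, Finset.mem_product, hb, Finset.mem_filter, Finset.mem_filter,
        mem_bl_iff_vn (by linarith), mem_bl_iff_vn (by linarith)]
      tauto
    refine le_trans ?_ (Finset.single_le_sum (fun q hq => ?_) hmem)
    · rw [if_pos (Finset.mem_product.mpr ⟨b7, b8⟩), mul_one]; exact b6
    · have := vn_nonneg q.1
      have := vn_nonneg q.2
      split_ifs <;> positivity
  calc _ ≤ ∑ p ∈ S, ∑ q ∈ V, 2 / (vn q.1 * vn q.2) *
        (if p ∈ lt Z q.1 q.2 ×ˢ lt Z q.1 q.2 then 1 else 0) := Finset.sum_le_sum h1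
    _ = ∑ q ∈ V, 2 / (vn q.1 * vn q.2) *
        ∑ p ∈ S, (if p ∈ lt Z q.1 q.2 ×ˢ lt Z q.1 q.2 then (1 : ℝ) else 0) := by
        rw [Finset.sum_comm]
        refine Finset.sum_congr rfl fun q _ => ?_
        rw [Finset.mul_sum]
    _ ≤ ∑ q ∈ V, (5184 * Z ^ 4 * X) * (1 / vn q.1 ^ 4 * (1 / vn q.2 ^ 4)) := by
        refine Finset.sum_le_sum fun q hq => ?_
        obtain ⟨a1, a2, a3, a4, a5⟩ := hVm q hq
        have p1 := vn_pos a1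
        have p2 := vn_pos a2
        have hc := card_lt_le a1 a2 a3 a4
        have hs : ∑ p ∈ S, (if p ∈ lt Z q.1 q.2 ×ˢ lt Z q.1 q.2 then (1 : ℝ) else 0) ≤
            (36 * Z ^ 2 / (vn q.1 * vn q.2)) ^ 2 := by
          rw [Finset.sum_boole]
          have : (S.filter fun p => p ∈ lt Z q.1 q.2 ×ˢ lt Z q.1 q.2).card ≤
              (lt Z q.1 q.2 ×ˢ lt Z q.1 q.2).card :=
            Finset.card_le_card fun p hp => (Finset.mem_filter.mp hp).2
          rw [Finset.card_product] at this
          calc _ ≤ ((lt Z q.1 q.2).card : ℝ) * (lt Z q.1 q.2).card := by exact_mod_cast this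
            _ ≤ _ := by rw [sq]; gcongr
        calc _ ≤ 2 / (vn q.1 * vn q.2) * (36 * Z ^ 2 / (vn q.1 * vn q.2)) ^ 2 := by gcongr
          _ = 2592 * Z ^ 4 * (vn q.1 * vn q.2) * (1 / vn q.1 ^ 4 * (1 / vn q.2 ^ 4)) := by
            field_simp; ring
          _ ≤ 2592 * Z ^ 4 * (2 * X) * (1 / vn q.1 ^ 4 * (1 / vn q.2 ^ 4)) := by gcongr
          _ = _ := by ring
    _ ≤ ∑ q ∈ b ×ˢ b, (5184 * Z ^ 4 * X) * (1 / vn q.1 ^ 4 * (1 / vn q.2 ^ 4)) := by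
        refine Finset.sum_le_sum_of_subset_of_nonneg (Finset.filter_subset _ _) fun q _ _ => ?_
        positivity
    _ = (5184 * Z ^ 4 * X) * (∑ v ∈ b, 1 / vn v ^ 4) ^ 2 := by
        rw [← Finset.mul_sum, sq, Finset.sum_mul_sum, Finset.sum_product]
    _ ≤ (5184 * Z ^ 4 * X) * ((3 + 2 * Real.log (2 * Z)) ^ 4) ^ 2 := by
        have h0 : 0 ≤ ∑ v ∈ b, 1 / vn v ^ 4 := Finset.sum_nonneg fun v _ => by positivity
        have := sum_inv_vn_pow_le (T := 2 * Z) (by linarith)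
        gcongr
    _ = _ := by ring

theorem pow_dvd_factorial_le {q N v : ℕ} (hq : q.Prime) (h : q ^ v ∣ N.factorial) : v ≤ N := by
  have : Fact q.Prime := ⟨hq⟩
  have h1 := sub_one_mul_padicValNat_factorial (p := q) N
  have h2 : v ≤ padicValNat q N.factorial :=
    (padicValNat_dvd_iff_le (Nat.factorial_ne_zero N)).mp h
  have h3 : 1 ≤ q - 1 := by have := hq.two_le; omega
  calc v ≤ padicValNat q N.factorial := h2
    _ ≤ (q - 1) * padicValNat q N.factorial := Nat.le_mul_of_pos_left _ h3
    _ ≤ N := by omega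

theorem exists_coprime_dvd_factorial (N d : ℕ) (hd : 1 ≤ d) :
    ∃ m, m ∣ N.factorial ∧ m.Coprime d ∧ N.factorial ≤ d ^ N * m := by
  set g := Nat.gcd N.factorial (d ^ N) with hg
  obtain ⟨m, hm⟩ := Nat.gcd_dvd_left N.factorial (d ^ N)
  rw [← hg] at hm
  refine ⟨m, ⟨g, by rw [mul_comm]; exact hm⟩, ?_, ?_⟩
  · refine Nat.Coprime.symm (Nat.coprime_of_dvd fun q hq h1 h2 => ?_)
    have hfin : FiniteMultiplicity q N.factorial :=
      Nat.finiteMultiplicity_iff.mpr ⟨hq.ne_one, Nat.factorial_pos N⟩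
    have a1 := pow_multiplicity_dvd q N.factorial
    have a2 := pow_dvd_factorial_le hq a1
    have a3 : q ^ multiplicity q N.factorial ∣ d ^ N :=
      (pow_dvd_pow q a2).trans (pow_dvd_pow_of_dvd h1 N)
    have a4 := Nat.dvd_gcd a1 a3
    rw [← hg] at a4
    have a5 : q ^ (multiplicity q N.factorial + 1) ∣ N.factorial := by
      rw [hm, pow_succ]
      rw [hm] at a4
      exact mul_dvd_mul a4 h2
    exact hfin.not_pow_dvd_of_multiplicity_lt (Nat.lt_succ_self _) a5
  · calc N.factorial = g * m := hm
      _ ≤ d ^ N * m := Nat.mul_le_mul_right _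
        (Nat.le_of_dvd (by positivity) (Nat.gcd_dvd_right _ _))

theorem dvd_prod_progression {N d m : ℕ} (a : ℕ) (h1 : m ∣ N.factorial) (h2 : m.Coprime d) :
    m ∣ ∏ n ∈ Finset.range N, (a + d * n) := by
  rcases Nat.eq_zero_or_pos m with rfl | hm
  · exact absurd (Nat.eq_zero_of_zero_dvd h1) (Nat.factorial_ne_zero N)
  obtain ⟨e, he⟩ : ∃ e : ℕ, d * e ≡ 1 [MOD m] := by
    obtain ⟨e, he⟩ := Nat.exists_mul_mod_eq_of_coprime 1 h2.symm hm.ne'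
    exact ⟨e, he.2⟩
  have h3 : e ^ N * ∏ n ∈ Finset.range N, (a + d * n) ≡ ∏ n ∈ Finset.range N, (e * a + n) [MOD m] := by
    have : e ^ N = ∏ _n ∈ Finset.range N, e := by simp
    rw [this, ← Finset.prod_mul_distrib]
    refine Nat.ModEq.prod fun n _ => ?_
    have : e * (a + d * n) = e * a + (d * e) * n := by ring
    rw [this]
    exact (Nat.ModEq.refl _).add (by simpa using he.mul_right n)
  have h4 : m ∣ ∏ n ∈ Finset.range N, (e * a + n) := by
    rw [← Nat.ascFactorial_eq_prod_range]
    exact h1.trans (Nat.factorial_dvd_ascFactorial _ _)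
  have h5 : m ∣ e ^ N * ∏ n ∈ Finset.range N, (a + d * n) :=
    (h3.dvd_iff dvd_rfl).mpr h4
  have h6 : m.Coprime (e ^ N) := by
    refine Nat.Coprime.pow_right _ ?_
    have := Nat.Coprime.symm (Nat.coprime_of_mul_modEq_one d (by rwa [mul_comm] at he))
    exact this
  exact h6.dvd_of_dvd_mul_left h5

/-- The product of the primes exceeding `N` in a progression of length `N`. -/
theorem prod_primes_mul_factorial_le {N d a : ℕ} (hd : 1 ≤ d) (ha : 1 ≤ a) (S : Finset ℕ)
    (hS : ∀ p ∈ S, p.Prime ∧ N < p ∧ ∃ n < N, p = a + d * n) {X : ℕ}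
    (hX : ∀ n < N, a + d * n ≤ X) :
    (∏ p ∈ S, p) * N.factorial ≤ (d * X) ^ N := by
  classical
  obtain ⟨m, h1, h2, h3⟩ := exists_coprime_dvd_factorial N d hd
  have hinj : Set.InjOn (fun n => a + d * n) (Finset.range N : Set ℕ) := by
    intro x _ y _ hxy
    simp only [add_right_inj] at hxy
    exact Nat.eq_of_mul_eq_mul_left hd hxy
  have hP : ∏ n ∈ Finset.range N, (a + d * n) = ∏ p ∈ (Finset.range N).image (fun n => a + d * n), p := by
    rw [Finset.prod_image hinj]
  have h4 : (∏ p ∈ S, p) ∣ ∏ n ∈ Finset.range N, (a + d * n) := by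
    rw [hP]
    refine Finset.prod_dvd_prod_of_subset _ _ _ fun p hp => ?_
    obtain ⟨_, _, n, hn, rfl⟩ := hS p hp
    exact Finset.mem_image.mpr ⟨n, Finset.mem_range.mpr hn, rfl⟩
  have h5 := dvd_prod_progression (N := N) a h1 h2
  have h6 : Nat.Coprime (∏ p ∈ S, p) m := by
    refine Nat.Coprime.prod_left fun p hp => ?_
    obtain ⟨hp1, hp2, _⟩ := hS p hp
    refine Nat.Coprime.coprime_dvd_right h1 ?_
    exact (hp1.coprime_iff_not_dvd).mpr fun h => by
      have := (hp1.dvd_factorial).mp h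
      omega
  have h7 := Nat.Coprime.mul_dvd_of_dvd_of_dvd h6 h4 h5
  have h8 : ∏ n ∈ Finset.range N, (a + d * n) ≤ X ^ N := by
    calc _ ≤ ∏ _n ∈ Finset.range N, X :=
          Finset.prod_le_prod' fun n hn => hX n (Finset.mem_range.mp hn)
      _ = X ^ N := by simp
  have h0 : 0 < ∏ n ∈ Finset.range N, (a + d * n) := Finset.prod_pos fun n _ => by omega
  calc (∏ p ∈ S, p) * N.factorial ≤ (∏ p ∈ S, p) * (d ^ N * m) := Nat.mul_le_mul_left _ h3
    _ = d ^ N * ((∏ p ∈ S, p) * m) := by ring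
    _ ≤ d ^ N * X ^ N := Nat.mul_le_mul_left _ ((Nat.le_of_dvd h0 h7).trans h8)
    _ = (d * X) ^ N := by rw [mul_pow]

theorem card_le_of_log {S : Finset ℕ} {B M : ℝ} (hB : 1 < B) (hS : ∀ p ∈ S, √B < p)
    (h : ∑ p ∈ S, Real.log p ≤ M) : (S.card : ℝ) ≤ 2 / Real.log B * M := by
  have hL : 0 < Real.log B := Real.log_pos hB
  have h1 : ∑ _p ∈ S, Real.log B / 2 ≤ ∑ p ∈ S, Real.log p := by
    refine Finset.sum_le_sum fun p hp => ?_
    rw [← Real.log_sqrt (by linarith)]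
    exact Real.log_le_log (Real.sqrt_pos.mpr (by linarith)) (hS p hp).le
  rw [Finset.sum_const, nsmul_eq_mul] at h1
  rw [div_mul_eq_mul_div, le_div_iff₀ hL]
  linarith

/-- An elementary Brun–Titchmarsh type bound. -/
theorem card_primes_modEq_le {B δ : ℝ} {d : ℕ} (S : Finset ℕ) (hp : ∀ p ∈ S, p.Prime ∧ (p : ℝ) ≤ B)
    (hmod : ∀ p ∈ S, ∀ q ∈ S, p ≡ q [MOD d]) (hdiam : ∀ p ∈ S, ∀ q ∈ S, (p : ℝ) - q ≤ δ)
    (hB : 2 ≤ B) (hd : 1 ≤ d) (hdδ : (d : ℝ) ≤ δ) (hδ : δ ≤ B) :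
    (S.card : ℝ) ≤ √B + 100 / Real.log B *
      ((δ / d) ^ (11 / 12 : ℝ) * (d * B) ^ (1 / 12 : ℝ)) := by
  classical
  have hL : 0 < Real.log B := Real.log_pos (by linarith)
  have hd0 : (1 : ℝ) ≤ d := by exact_mod_cast hd
  rcases S.eq_empty_or_nonempty with rfl | hne
  · simp only [Finset.card_empty, Nat.cast_zero]; have : 0 ≤ δ := by linarith
    positivity
  obtain ⟨a, ha, hamin⟩ : ∃ a ∈ S, ∀ p ∈ S, a ≤ p :=
    ⟨S.min' hne, S.min'_mem hne, fun p hp => S.min'_le p hp⟩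
  set M := δ / d with hM
  have hM1 : 1 ≤ M := by rw [hM, le_div_iff₀ (by linarith)]; linarith
  set N := ⌊M⌋₊ + 1 with hN
  have hNM : (N : ℝ) ≤ 2 * M := by
    rw [hN]; push_cast
    have := Nat.floor_le (show 0 ≤ M by linarith)
    linarith
  have hN1 : (1 : ℝ) ≤ N := by rw [hN]; push_cast; linarith [Nat.cast_nonneg (α := ℝ) ⌊M⌋₊]
  have hX : ∀ n < N, a + d * n ≤ ⌊2 * B⌋₊ := by
    intro n hn
    refine Nat.le_floor ?_
    push_cast
    have h1 : (n : ℝ) ≤ M := by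
      have : n ≤ ⌊M⌋₊ := by omega
      exact (Nat.cast_le.mpr this).trans (Nat.floor_le (by linarith))
    have h2 : (d : ℝ) * n ≤ δ := by
      calc (d : ℝ) * n ≤ d * M := by gcongr
        _ = δ := by rw [hM]; field_simp
    linarith [(hp a ha).2]
  have hprog : ∀ p ∈ S, ∃ n < N, p = a + d * n := by
    intro p hpS
    obtain ⟨k, hk⟩ := (Nat.modEq_iff_dvd' (hamin p hpS)).mp (hmod a ha p hpS)
    refine ⟨k, ?_, by have := hamin p hpS; omega⟩
    have h1 : p = a + d * k := by have := hamin p hpS; omega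
    have h2 := hdiam p hpS a ha
    rw [h1] at h2; push_cast at h2
    have h3 : (k : ℝ) ≤ M := by rw [hM, le_div_iff₀ (by linarith)]; linarith
    have := Nat.le_floor h3
    omega
  set S1 := S.filter (fun p : ℕ => (p : ℝ) ≤ √B) with hS1
  set S2 := S.filter (fun p : ℕ => √B < (p : ℝ) ∧ p ≤ N) with hS2
  set S3 := S.filter (fun p : ℕ => √B < (p : ℝ) ∧ N < p) with hS3
  have hsub : S ⊆ S1 ∪ (S2 ∪ S3) := by
    intro p hpS
    simp only [hS1, hS2, hS3, Finset.mem_union, Finset.mem_filter, hpS, true_and]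
    rcases le_or_gt (p : ℝ) (√B) with h | h
    · exact Or.inl h
    · rcases le_or_gt p N with h' | h'
      · exact Or.inr (Or.inl ⟨h, h'⟩)
      · exact Or.inr (Or.inr ⟨h, h'⟩)
  have hc : (S.card : ℝ) ≤ S1.card + (S2.card + S3.card) := by
    have h1 := Finset.card_le_card hsub
    have h2 := Finset.card_union_le S1 (S2 ∪ S3)
    have h3 := Finset.card_union_le S2 S3
    have h4 : S.card ≤ S1.card + (S2.card + S3.card) := by omega
    exact_mod_cast h4
  have hc1 : (S1.card : ℝ) ≤ √B := by
    have h1 : S1 ⊆ Finset.Icc 1 ⌊√B⌋₊ := by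
      intro p hpS
      rw [hS1, Finset.mem_filter] at hpS
      exact Finset.mem_Icc.mpr ⟨(hp p hpS.1).1.one_le, Nat.le_floor hpS.2⟩
    have h2 := Finset.card_le_card h1
    rw [Nat.card_Icc] at h2
    have h3 : S1.card ≤ ⌊√B⌋₊ := by omega
    exact (Nat.cast_le.mpr h3).trans (Nat.floor_le (Real.sqrt_nonneg _))
  have hc2 : (S2.card : ℝ) ≤ 2 / Real.log B * (Real.log 4 * N) := by
    refine card_le_of_log (by linarith) (fun p hpS => ((Finset.mem_filter.mp hpS).2).1) ?_
    refine le_trans ?_ (Chebyshev.theta_le_log4_mul_x (x := (N : ℝ)) (by linarith))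
    rw [Chebyshev.theta_eq_sum_Icc]
    refine Finset.sum_le_sum_of_subset_of_nonneg ?_ fun p hpS _ => ?_
    · intro p hpS
      rw [hS2, Finset.mem_filter] at hpS
      rw [Finset.mem_filter, Finset.mem_Icc, Nat.floor_natCast]
      exact ⟨⟨Nat.zero_le _, hpS.2.2⟩, (hp p hpS.1).1⟩
    · exact Real.log_natCast_nonneg p
  have hc3 : (S3.card : ℝ) ≤ 2 / Real.log B * (N * (1 + Real.log (2 * (d * B) / N))) := by
    refine card_le_of_log (by linarith) (fun p hpS => ((Finset.mem_filter.mp hpS).2).1) ?_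
    have h1 := prod_primes_mul_factorial_le (N := N) hd (hp a ha).1.one_le S3 (fun p hpS => by
      rw [hS3, Finset.mem_filter] at hpS
      exact ⟨(hp p hpS.1).1, hpS.2.2, hprog p hpS.1⟩) hX
    have h2 : (∏ p ∈ S3, (p : ℝ)) * (N.factorial : ℝ) ≤ (2 * (d * B)) ^ N := by
      have h3 : ((∏ p ∈ S3, p : ℕ) : ℝ) * (N.factorial : ℝ) ≤ ((d * ⌊2 * B⌋₊ : ℕ) : ℝ) ^ N := by
        exact_mod_cast h1
      push_cast at h3
      refine h3.trans ?_
      have h4 := Nat.floor_le (show 0 ≤ 2 * B by linarith)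
      calc ((d : ℝ) * ⌊2 * B⌋₊) ^ N ≤ (d * (2 * B)) ^ N := by gcongr
        _ = _ := by ring
    have hpos : ∀ p ∈ S3, (p : ℝ) ≠ 0 := fun p hpS => by
      have := (hp p (Finset.mem_filter.mp hpS).1).1.pos
      positivity
    have h3 := Real.log_le_log (mul_pos (Finset.prod_pos fun p hpS => by
      have := (hp p (Finset.mem_filter.mp hpS).1).1.pos
      positivity) (by positivity)) h2
    rw [Real.log_mul (Finset.prod_ne_zero_iff.mpr hpos) (by positivity), Real.log_prod hpos,
      Real.log_pow] at h3
    have h4 := Stirling.le_log_factorial_stirling (n := N) (by omega)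
    have h5 : 0 ≤ Real.log (2 * Real.pi) := Real.log_nonneg (by linarith [Real.pi_gt_three])
    have h6 : 0 ≤ Real.log (N : ℝ) := Real.log_nonneg hN1
    rw [Real.log_div (by positivity) (by positivity)]
    nlinarith
  have hkey : Real.log 4 * N + N * (1 + Real.log (2 * (d * B) / N)) ≤
      50 * (M ^ (11 / 12 : ℝ) * (d * B) ^ (1 / 12 : ℝ)) := by
    have hNpos : (0 : ℝ) < N := by linarith
    have h1 : Real.log 4 + 1 + Real.log (2 * (d * B) / N) ≤ Real.log (24 * (d * B) / N) := by
      have e1 : (24 : ℝ) * (d * B) / N = 4 * 3 * (2 * (d * B) / N) := by ring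
      rw [e1, Real.log_mul (by norm_num) (by positivity), Real.log_mul (by norm_num) (by norm_num)]
      have : (1 : ℝ) ≤ Real.log 3 := by
        rw [Real.le_log_iff_exp_le (by norm_num)]; exact Real.exp_one_lt_three.le
      linarith
    have h2 := Real.log_le_rpow_div (show 0 ≤ 24 * (d * B) / N by positivity)
      (show (0 : ℝ) < 1 / 12 by norm_num)
    have h3 : (N : ℝ) * (24 * (d * B) / N) ^ (1 / 12 : ℝ) =
        N ^ (11 / 12 : ℝ) * (24 : ℝ) ^ (1 / 12 : ℝ) * (d * B) ^ (1 / 12 : ℝ) := by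
      rw [Real.div_rpow (by positivity) hNpos.le, Real.mul_rpow (by norm_num) (by positivity)]
      have : (N : ℝ) = N ^ (11 / 12 : ℝ) * N ^ (1 / 12 : ℝ) := by
        rw [← Real.rpow_add hNpos]; norm_num
      have h0 : (0 : ℝ) < N ^ (1 / 12 : ℝ) := by positivity
      field_simp
      rw [mul_comm]; exact this
    have h4 : (N : ℝ) ^ (11 / 12 : ℝ) ≤ 2 * M ^ (11 / 12 : ℝ) := by
      calc (N : ℝ) ^ (11 / 12 : ℝ) ≤ (2 * M) ^ (11 / 12 : ℝ) := by gcongr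
        _ = 2 ^ (11 / 12 : ℝ) * M ^ (11 / 12 : ℝ) := Real.mul_rpow (by norm_num) (by linarith)
        _ ≤ 2 ^ (1 : ℝ) * M ^ (11 / 12 : ℝ) := by gcongr <;> norm_num
        _ = _ := by rw [Real.rpow_one]
    have h5 : (24 : ℝ) ^ (1 / 12 : ℝ) ≤ 2 := by
      rw [← Real.rpow_le_rpow_iff (z := 12) (by positivity) (by norm_num) (by norm_num),
        ← Real.rpow_mul (by norm_num)]
      norm_num
    calc Real.log 4 * N + N * (1 + Real.log (2 * (d * B) / N))
        = N * (Real.log 4 + 1 + Real.log (2 * (d * B) / N)) := by ring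
      _ ≤ N * ((24 * (d * B) / N) ^ (1 / 12 : ℝ) / (1 / 12)) := by gcongr; linarith
      _ = 12 * (N * (24 * (d * B) / N) ^ (1 / 12 : ℝ)) := by ring
      _ = 12 * (N ^ (11 / 12 : ℝ) * (24 : ℝ) ^ (1 / 12 : ℝ) * (d * B) ^ (1 / 12 : ℝ)) := by rw [h3]
      _ ≤ 12 * (2 * M ^ (11 / 12 : ℝ) * 2 * (d * B) ^ (1 / 12 : ℝ)) := by gcongr
      _ ≤ _ := by
        have : 0 ≤ M ^ (11 / 12 : ℝ) * (d * B) ^ (1 / 12 : ℝ) := by positivity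
        nlinarith
  calc (S.card : ℝ) ≤ √B + 2 / Real.log B *
        (Real.log 4 * N + N * (1 + Real.log (2 * (d * B) / N))) := by linarith
    _ ≤ √B + 2 / Real.log B * (50 * (M ^ (11 / 12 : ℝ) * (d * B) ^ (1 / 12 : ℝ))) := by gcongr
    _ = _ := by ring

/-- The primes up to `B`. -/
noncomputable def prn (B : ℝ) : Finset ℕ := (Finset.Icc 0 ⌊B⌋₊).filter Nat.Prime

/-- The primes up to `B`, as integers. -/
noncomputable def prz (B : ℝ) : Finset ℤ := (prn B).image (fun n : ℕ => (n : ℤ))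

/-- The quadruples of primes up to `B`, as integer vectors. -/
noncomputable def PF (B : ℝ) : Finset (Fin 4 → ℤ) := Fintype.piFinset fun _ => prz B

theorem mem_prn {B : ℝ} (hB : 0 ≤ B) {p : ℕ} : p ∈ prn B ↔ p.Prime ∧ (p : ℝ) ≤ B := by
  rw [prn, Finset.mem_filter, Finset.mem_Icc, Nat.le_floor_iff hB]
  simp [and_comm]

theorem mem_prz {B : ℝ} (hB : 0 ≤ B) {p : ℤ} : p ∈ prz B ↔ ∃ q : ℕ, q.Prime ∧ (q : ℝ) ≤ B ∧ p = q := by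
  rw [prz, Finset.mem_image]
  constructor
  · rintro ⟨q, hq, rfl⟩
    obtain ⟨h1, h2⟩ := (mem_prn hB).mp hq
    exact ⟨q, h1, h2, rfl⟩
  · rintro ⟨q, h1, h2, rfl⟩
    exact ⟨q, (mem_prn hB).mpr ⟨h1, h2⟩, rfl⟩

theorem mem_PF {B : ℝ} {x : Fin 4 → ℤ} : x ∈ PF B ↔ ∀ i, x i ∈ prz B := by
  rw [PF, Fintype.mem_piFinset]

theorem PF_pos {B : ℝ} (hB : 0 ≤ B) {x : Fin 4 → ℤ} (hx : x ∈ PF B) (i : Fin 4) : 2 ≤ x i := by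
  obtain ⟨q, h1, _, h3⟩ := (mem_prz hB).mp (mem_PF.mp hx i)
  rw [h3]; exact_mod_cast h1.two_le

theorem PF_le {B : ℝ} (hB : 0 ≤ B) {x : Fin 4 → ℤ} (hx : x ∈ PF B) (i : Fin 4) : (x i : ℝ) ≤ B := by
  obtain ⟨q, _, h2, h3⟩ := (mem_prz hB).mp (mem_PF.mp hx i)
  rw [h3]; exact_mod_cast h2

theorem PF_ne_zero {B : ℝ} (hB : 0 ≤ B) {x : Fin 4 → ℤ} (hx : x ∈ PF B) : x ≠ 0 := by
  rintro rfl
  have := PF_pos hB hx 0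
  simp at this

theorem PF_vn_le {B : ℝ} (hB : 0 ≤ B) {x : Fin 4 → ℤ} (hx : x ∈ PF B) : vn x ≤ 2 * B := by
  rw [vn]
  refine Real.sqrt_le_iff.mpr ⟨by linarith, ?_⟩
  have h : ∀ i, (x i : ℝ) * x i ≤ B * B := fun i => by
    have h1 := PF_le hB hx i
    have h2 : (0 : ℝ) ≤ x i := by exact_mod_cast (by linarith [PF_pos hB hx i] : (0 : ℤ) ≤ x i)
    gcongr
  rw [ip]; push_cast
  linarith [h 0, h 1, h 2, h 3]

theorem sum_prz (B : ℝ) (f : ℤ → ℝ) : ∑ p ∈ prz B, f p = ∑ p ∈ prn B, f p := by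
  rw [prz, Finset.sum_image]
  exact fun a _ b _ h => Nat.cast_injective h

theorem log_le_two_sqrt {B : ℝ} (hB : 0 < B) : Real.log B ≤ 2 * √B := by
  have h := Real.log_le_sub_one_of_pos (Real.sqrt_pos.mpr hB)
  rw [Real.log_sqrt hB.le] at h
  linarith

theorem log_four_le : Real.log 4 ≤ 7 / 5 := by
  have h : (4 : ℝ) = 2 ^ 2 := by norm_num
  rw [h, Real.log_pow]
  have := Real.log_two_lt_d9
  push_cast; linarith

theorem card_filter_le_sqrt {B : ℝ} (hB : 0 ≤ B) :
    (((prn B).filter (fun p : ℕ => (p : ℝ) ≤ √B)).card : ℝ) ≤ √B := by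
  have h1 : (prn B).filter (fun p : ℕ => (p : ℝ) ≤ √B) ⊆ Finset.Icc 1 ⌊√B⌋₊ := by
    intro p hp
    rw [Finset.mem_filter, mem_prn hB] at hp
    exact Finset.mem_Icc.mpr ⟨hp.1.1.one_le, Nat.le_floor hp.2⟩
  have h2 := Finset.card_le_card h1
  rw [Nat.card_Icc] at h2
  have h3 : ((prn B).filter (fun p : ℕ => (p : ℝ) ≤ √B)).card ≤ ⌊√B⌋₊ := by omega
  exact (Nat.cast_le.mpr h3).trans (Nat.floor_le (Real.sqrt_nonneg _))

theorem card_prn_le {B : ℝ} (hB : 2 ≤ B) : ((prn B).card : ℝ) ≤ 5 * B / Real.log B := by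
  have hL : 0 < Real.log B := Real.log_pos (by linarith)
  have h0 := Finset.card_filter_add_card_filter_not (s := prn B) (fun p : ℕ => (p : ℝ) ≤ √B)
  have h1 := card_filter_le_sqrt (B := B) (by linarith)
  have h2 : (((prn B).filter (fun p : ℕ => ¬ (p : ℝ) ≤ √B)).card : ℝ) ≤
      2 / Real.log B * (Real.log 4 * B) := by
    refine card_le_of_log (by linarith) (fun p hp => not_le.mp (Finset.mem_filter.mp hp).2) ?_
    refine le_trans ?_ (Chebyshev.theta_le_log4_mul_x (x := B) (by linarith))
    rw [Chebyshev.theta_eq_sum_Icc]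
    exact Finset.sum_le_sum_of_subset_of_nonneg (Finset.filter_subset _ _) fun p _ _ =>
      Real.log_natCast_nonneg p
  have h3 : ((prn B).card : ℝ) = (((prn B).filter (fun p : ℕ => (p : ℝ) ≤ √B)).card : ℝ) +
      ((prn B).filter (fun p : ℕ => ¬ (p : ℝ) ≤ √B)).card := by exact_mod_cast h0.symm
  have h4 : √B ≤ 2 * B / Real.log B := by
    rw [le_div_iff₀ hL]
    have := log_le_two_sqrt (B := B) (by linarith)
    have e := Real.mul_self_sqrt (show 0 ≤ B by linarith)
    nlinarith [Real.sqrt_nonneg B]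
  calc ((prn B).card : ℝ) ≤ 2 * B / Real.log B + 2 / Real.log B * (7 / 5 * B) := by
        have : 2 / Real.log B * (Real.log 4 * B) ≤ 2 / Real.log B * (7 / 5 * B) := by
          have := log_four_le
          gcongr
        linarith
    _ = (24 / 5) * B / Real.log B := by ring
    _ ≤ _ := by gcongr; norm_num

theorem sum_log_mul_rpow_le (n : ℕ) : ∀ B : ℝ, 0 ≤ B → ⌊B⌋₊ ≤ n →
    ∑ p ∈ prn B, Real.log p * (p : ℝ) ^ (-(1 / 4) : ℝ) ≤ 5 * B ^ (3 / 4 : ℝ) := by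
  induction n with
  | zero =>
    intro B hB h
    have : prn B = ∅ := by
      rw [prn, Finset.filter_eq_empty_iff]
      intro p hp
      rw [Finset.mem_Icc] at hp
      have : p = 0 := by omega
      rw [this]; exact Nat.not_prime_zero
    rw [this, Finset.sum_empty]; positivity
  | succ n ih =>
    intro B hB h
    rcases le_or_gt ⌊B⌋₊ 0 with h0 | h0
    · have : prn B = ∅ := by
        rw [prn, Finset.filter_eq_empty_iff]
        intro p hp
        rw [Finset.mem_Icc] at hp
        have : p = 0 := by omega
        rw [this]; exact Nat.not_prime_zero
      rw [this, Finset.sum_empty]; positivity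
    have hB1 : 1 ≤ B := Nat.floor_pos.mp h0
    have h1 := ih (B / 2) (by linarith) (by rw [Nat.floor_div_ofNat]; omega)
    have h2 : ∑ p ∈ (prn B).filter (fun p => ¬ p ∈ prn (B / 2)),
        Real.log p * (p : ℝ) ^ (-(1 / 4) : ℝ) ≤ (B / 2) ^ (-(1 / 4) : ℝ) * (Real.log 4 * B) := by
      have h3 := Chebyshev.theta_le_log4_mul_x (x := B) hB
      rw [Chebyshev.theta_eq_sum_Icc] at h3
      calc _ ≤ ∑ p ∈ (prn B).filter (fun p => ¬ p ∈ prn (B / 2)),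
            Real.log p * (B / 2) ^ (-(1 / 4) : ℝ) := by
            refine Finset.sum_le_sum fun p hp => ?_
            rw [Finset.mem_filter, mem_prn hB, mem_prn (by linarith)] at hp
            have hp2 : B / 2 ≤ p := by
              by_contra hc
              exact hp.2 ⟨hp.1.1, by linarith⟩
            have := Real.log_natCast_nonneg p
            refine mul_le_mul_of_nonneg_left ?_ this
            exact Real.rpow_le_rpow_of_nonpos (by linarith) hp2 (by norm_num)
        _ = (B / 2) ^ (-(1 / 4) : ℝ) * ∑ p ∈ (prn B).filter (fun p => ¬ p ∈ prn (B / 2)),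
            Real.log p := by rw [← Finset.sum_mul, mul_comm]
        _ ≤ (B / 2) ^ (-(1 / 4) : ℝ) * ∑ p ∈ prn B, Real.log p := by
            refine mul_le_mul_of_nonneg_left ?_ (by positivity)
            exact Finset.sum_le_sum_of_subset_of_nonneg (Finset.filter_subset _ _) fun p _ _ =>
              Real.log_natCast_nonneg p
        _ ≤ _ := mul_le_mul_of_nonneg_left h3 (by positivity)
    have h4 : ∑ p ∈ (prn B).filter (fun p => p ∈ prn (B / 2)),
        Real.log p * (p : ℝ) ^ (-(1 / 4) : ℝ) ≤ 5 * (B / 2) ^ (3 / 4 : ℝ) := by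
      refine le_trans (Finset.sum_le_sum_of_subset_of_nonneg (fun p hp =>
        (Finset.mem_filter.mp hp).2) fun p _ _ => ?_) h1
      have := Real.log_natCast_nonneg p
      positivity
    rw [← Finset.sum_filter_add_sum_filter_not (prn B) (fun p => p ∈ prn (B / 2))]
    have hlt : (0 : ℝ) < B := by linarith
    have e1 : (B / 2) ^ (-(1 / 4) : ℝ) * (Real.log 4 * B) = Real.log 4 * 2 * (B / 2) ^ (3 / 4 : ℝ) := by
      have : (B / 2) ^ (3 / 4 : ℝ) = (B / 2) ^ (-(1 / 4) : ℝ) * (B / 2) := by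
        rw [← Real.rpow_add_one (by positivity)]; norm_num
      rw [this]; ring
    have e2 : (B / 2) ^ (3 / 4 : ℝ) = B ^ (3 / 4 : ℝ) * (1 / 2 : ℝ) ^ (3 / 4 : ℝ) := by
      rw [← Real.mul_rpow hB (by norm_num)]; ring_nf
    have e3 : (1 / 2 : ℝ) ^ (3 / 4 : ℝ) ≤ 3 / 5 := by
      rw [← Real.rpow_le_rpow_iff (z := 4) (by positivity) (by norm_num) (by norm_num),
        ← Real.rpow_mul (by norm_num)]
      norm_num
    have e4 := log_four_le
    have e5 : (0 : ℝ) ≤ B ^ (3 / 4 : ℝ) := by positivity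
    have e6 : Real.log 4 * 2 * (B / 2) ^ (3 / 4 : ℝ) ≤ 14 / 5 * (B / 2) ^ (3 / 4 : ℝ) := by
      have : (0 : ℝ) ≤ (B / 2) ^ (3 / 4 : ℝ) := by positivity
      nlinarith
    have e7 : (B / 2) ^ (3 / 4 : ℝ) ≤ B ^ (3 / 4 : ℝ) * (3 / 5) := by rw [e2]; gcongr
    linarith

theorem sum_rpow_prn_le {B : ℝ} (hB : 2 ≤ B) :
    ∑ p ∈ prn B, (p : ℝ) ^ (-(1 / 4) : ℝ) ≤ 14 * B ^ (3 / 4 : ℝ) / Real.log B := by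
  have hL : 0 < Real.log B := Real.log_pos (by linarith)
  have hB0 : 0 < B := by linarith
  have hle1 : ∀ p ∈ prn B, (p : ℝ) ^ (-(1 / 4) : ℝ) ≤ 1 := fun p hp => by
    have := ((mem_prn hB0.le).mp hp).1.one_le
    exact Real.rpow_le_one_of_one_le_of_nonpos (by exact_mod_cast this) (by norm_num)
  have h1 : ∑ p ∈ (prn B).filter (fun p : ℕ => (p : ℝ) ≤ √B), (p : ℝ) ^ (-(1 / 4) : ℝ) ≤ √B := by
    refine le_trans ?_ (card_filter_le_sqrt hB0.le)
    rw [← nsmul_one, ← Finset.sum_const]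
    exact Finset.sum_le_sum fun p hp => hle1 p (Finset.mem_filter.mp hp).1
  have h2 : ∑ p ∈ (prn B).filter (fun p : ℕ => ¬ (p : ℝ) ≤ √B), (p : ℝ) ^ (-(1 / 4) : ℝ) ≤
      2 / Real.log B * (5 * B ^ (3 / 4 : ℝ)) := by
    refine le_trans ?_ (mul_le_mul_of_nonneg_left (sum_log_mul_rpow_le _ B hB0.le le_rfl)
      (by positivity))
    rw [Finset.mul_sum]
    calc _ ≤ ∑ p ∈ (prn B).filter (fun p : ℕ => ¬ (p : ℝ) ≤ √B),
          2 / Real.log B * (Real.log p * (p : ℝ) ^ (-(1 / 4) : ℝ)) := by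
          refine Finset.sum_le_sum fun p hp => ?_
          have hp2 := not_le.mp (Finset.mem_filter.mp hp).2
          have h3 := Real.log_le_log (Real.sqrt_pos.mpr hB0) hp2.le
          rw [Real.log_sqrt hB0.le] at h3
          have h4 : 1 ≤ 2 / Real.log B * Real.log p := by
            rw [div_mul_eq_mul_div, le_div_iff₀ hL]; linarith
          have h5 : (0 : ℝ) ≤ (p : ℝ) ^ (-(1 / 4) : ℝ) := by positivity
          calc (p : ℝ) ^ (-(1 / 4) : ℝ) ≤ 2 / Real.log B * Real.log p * (p : ℝ) ^ (-(1 / 4) : ℝ) := by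
                nlinarith
            _ = _ := by ring
      _ ≤ _ := Finset.sum_le_sum_of_subset_of_nonneg (Finset.filter_subset _ _) fun p _ _ => by
          have := Real.log_natCast_nonneg p
          positivity
  have h3 : √B ≤ 4 * B ^ (3 / 4 : ℝ) / Real.log B := by
    rw [le_div_iff₀ hL, Real.sqrt_eq_rpow]
    have h4 := Real.log_le_rpow_div hB0.le (show (0 : ℝ) < 1 / 4 by norm_num)
    have h5 : B ^ (3 / 4 : ℝ) = B ^ (1 / 2 : ℝ) * B ^ (1 / 4 : ℝ) := by
      rw [← Real.rpow_add hB0]; norm_num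
    rw [h5]
    have : (0 : ℝ) ≤ B ^ (1 / 2 : ℝ) := by positivity
    nlinarith
  rw [← Finset.sum_filter_add_sum_filter_not (prn B) (fun p : ℕ => (p : ℝ) ≤ √B)]
  calc _ ≤ 4 * B ^ (3 / 4 : ℝ) / Real.log B + 2 / Real.log B * (5 * B ^ (3 / 4 : ℝ)) := by linarith
    _ = _ := by ring

theorem sum_inv_vn_PF_le {B : ℝ} (hB : 2 ≤ B) :
    ∑ x ∈ PF B, 1 / vn x ≤ 14 ^ 4 * B ^ 3 / Real.log B ^ 4 := by
  have hB0 : 0 < B := by linarith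
  have h1 : ∀ x ∈ PF B, 1 / vn x ≤ ∏ i, (x i : ℝ) ^ (-(1 / 4) : ℝ) := by
    intro x hx
    have hv := vn_pos (PF_ne_zero hB0.le hx)
    have h2 : ∀ i, (0 : ℝ) < x i := fun i => by
      exact_mod_cast (by linarith [PF_pos hB0.le hx i] : (0 : ℤ) < x i)
    have h3 : ∀ i, (vn x) ^ (-(1 / 4) : ℝ) ≤ (x i : ℝ) ^ (-(1 / 4) : ℝ) := fun i => by
      refine Real.rpow_le_rpow_of_nonpos (h2 i) ?_ (by norm_num)
      refine Real.le_sqrt_of_sq_le ?_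
      exact_mod_cast sq_le_ip_self x i
    calc 1 / vn x = ∏ _i : Fin 4, (vn x) ^ (-(1 / 4) : ℝ) := by
          rw [Finset.prod_const, Finset.card_univ, Fintype.card_fin, ← Real.rpow_natCast,
            ← Real.rpow_mul hv.le]
          norm_num [Real.rpow_neg_one]
      _ ≤ _ := Finset.prod_le_prod (fun i _ => by positivity) fun i _ => h3 i
  have h2 := sum_rpow_prn_le hB
  have h0 : 0 ≤ ∑ p ∈ prn B, (p : ℝ) ^ (-(1 / 4) : ℝ) := Finset.sum_nonneg fun p _ => by positivity
  calc _ ≤ ∑ x ∈ PF B, ∏ i, (x i : ℝ) ^ (-(1 / 4) : ℝ) := Finset.sum_le_sum h1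
    _ = ∏ _i : Fin 4, ∑ p ∈ prz B, (p : ℝ) ^ (-(1 / 4) : ℝ) := by
        rw [Finset.prod_univ_sum (fun _ : Fin 4 => prz B) (fun _ t => (t : ℝ) ^ (-(1 / 4) : ℝ))]
        rfl
    _ = (∑ p ∈ prn B, (p : ℝ) ^ (-(1 / 4) : ℝ)) ^ 4 := by
        rw [sum_prz B (fun p => (p : ℝ) ^ (-(1 / 4) : ℝ))]; simp
    _ ≤ (14 * B ^ (3 / 4 : ℝ) / Real.log B) ^ 4 := by gcongr
    _ = _ := by
        rw [div_pow, mul_pow, ← Real.rpow_natCast (B ^ (3 / 4 : ℝ)), ← Real.rpow_mul hB0.le]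
        norm_num

/-- A dyadic summation bound. -/
theorem sum_one_div_le_dyadic {ι : Type*} {κ δ₀ : ℝ} (hκ : 0 ≤ κ) (hδ₀ : 0 < δ₀) (δ : ι → ℝ) (n : ℕ) :
    ∀ (S : Finset ι) (D : ℝ), (∀ y ∈ S, δ₀ ≤ δ y ∧ δ y ≤ D) → 0 ≤ D →
      (∀ D', δ₀ ≤ D' → D' ≤ D → ((S.filter fun y => δ y ≤ D').card : ℝ) ≤ κ * D' ^ 2) →
      D < δ₀ * 2 ^ n → ∑ y ∈ S, 1 / δ y ≤ 4 * κ * D := by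
  induction n with
  | zero =>
    intro S D hS hD0 hc hD
    have : S = ∅ := by
      rw [Finset.eq_empty_iff_forall_notMem]
      intro y hy
      have := hS y hy
      simp at hD; linarith
    rw [this, Finset.sum_empty]; positivity
  | succ n ih =>
    intro S D hS hD0 hc hD
    rcases lt_or_ge D δ₀ with h0 | h0
    · have : S = ∅ := by
        rw [Finset.eq_empty_iff_forall_notMem]
        intro y hy
        have := hS y hy
        linarith
      rw [this, Finset.sum_empty]; positivity
    have hDpos : 0 < D := by linarith
    rw [← Finset.sum_filter_add_sum_filter_not S (fun y => δ y ≤ D / 2)]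
    have h1 := ih (S.filter fun y => δ y ≤ D / 2) (D / 2)
      (fun y hy => ⟨(hS y (Finset.mem_filter.mp hy).1).1, (Finset.mem_filter.mp hy).2⟩)
      (by linarith) (fun D' h1 h2 => by
        refine le_trans ?_ (hc D' h1 (by linarith))
        rw [Finset.filter_filter]
        refine Nat.cast_le.mpr (Finset.card_le_card fun y hy => ?_)
        rw [Finset.mem_filter] at hy ⊢
        exact ⟨hy.1, hy.2.2⟩) (by rw [pow_succ] at hD; linarith)
    have h2 : ∑ y ∈ S.filter (fun y => ¬ δ y ≤ D / 2), 1 / δ y ≤ 2 * κ * D := by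
      calc _ ≤ ∑ _y ∈ S.filter (fun y => ¬ δ y ≤ D / 2), 2 / D := by
            refine Finset.sum_le_sum fun y hy => ?_
            have := not_le.mp (Finset.mem_filter.mp hy).2
            rw [div_le_div_iff₀ (by linarith) hDpos]; linarith
        _ = ((S.filter (fun y => ¬ δ y ≤ D / 2)).card : ℝ) * (2 / D) := by
            rw [Finset.sum_const, nsmul_eq_mul]
        _ ≤ κ * D ^ 2 * (2 / D) := by
            refine mul_le_mul_of_nonneg_right (le_trans ?_ (hc D h0 le_rfl)) (by positivity)
            refine Nat.cast_le.mpr (Finset.card_le_card fun y hy => ?_)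
            rw [Finset.mem_filter] at hy ⊢
            exact ⟨hy.1, (hS y hy.1).2⟩
        _ = _ := by field_simp
    linarith

/-- The distance of `y` from the line through `x`, normalised at the coordinate `i`. -/
noncomputable def dl (x : Fin 4 → ℤ) (i : Fin 4) (y : Fin 4 → ℤ) : ℝ :=
  (Finset.univ.sup' Finset.univ_nonempty fun j => |((mn x y i j : ℤ) : ℝ)|) / x i

theorem dl_le_iff {x : Fin 4 → ℤ} {i : Fin 4} (hx : 0 < x i) (y : Fin 4 → ℤ) (D : ℝ) :
    dl x i y ≤ D ↔ ∀ j, |((mn x y i j : ℤ) : ℝ)| ≤ x i * D := by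
  have hx' : (0 : ℝ) < x i := by exact_mod_cast hx
  rw [dl, div_le_iff₀ hx', Finset.sup'_le_iff]
  simp [mul_comm]

theorem mul_dl_le_sg {x : Fin 4 → ℤ} {i : Fin 4} (hx : 0 < x i) (y : Fin 4 → ℤ) :
    x i * dl x i y ≤ sg x y := by
  have hx' : (0 : ℝ) < x i := by exact_mod_cast hx
  have : dl x i y ≤ sg x y / x i := by
    rw [dl_le_iff hx]
    intro j
    rw [mul_div_cancel₀ _ hx'.ne']
    refine Real.abs_le_sqrt ?_
    have : mn x y i j ^ 2 ≤ gr x y := by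
      have e : ∀ a b, mn x y a b = - mn x y b a := fun a b => by unfold mn; ring
      have e0 : ∀ a, mn x y a a = 0 := fun a => by unfold mn; ring
      rw [gr_eq_mn]
      fin_cases i <;> fin_cases j <;> simp only [Fin.zero_eta, Fin.mk_one, Fin.reduceFinMk, e0] <;>
        first
          | positivity
          | nlinarith [sq_nonneg (mn x y 0 1), sq_nonneg (mn x y 0 2), sq_nonneg (mn x y 0 3),
              sq_nonneg (mn x y 1 2), sq_nonneg (mn x y 1 3), sq_nonneg (mn x y 2 3)]
          | (rw [e]; nlinarith [sq_nonneg (mn x y 0 1), sq_nonneg (mn x y 0 2), sq_nonneg (mn x y 0 3),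
              sq_nonneg (mn x y 1 2), sq_nonneg (mn x y 1 3), sq_nonneg (mn x y 2 3)])
    exact_mod_cast this
  rw [le_div_iff₀ hx'] at this
  linarith

theorem dl_nonneg {x : Fin 4 → ℤ} {i : Fin 4} (hx : 0 < x i) (y : Fin 4 → ℤ) : 0 ≤ dl x i y := by
  refine div_nonneg ?_ (by exact_mod_cast hx.le)
  exact le_trans (abs_nonneg _) (Finset.le_sup' (fun j => |((mn x y i j : ℤ) : ℝ)|) (Finset.mem_univ 0))

theorem vn_le_two_mul {x : Fin 4 → ℤ} {i : Fin 4} (hx : ∀ j, 0 ≤ x j ∧ x j ≤ x i) :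
    vn x ≤ 2 * x i := by
  have h0 : (0 : ℝ) ≤ x i := by exact_mod_cast (hx i).1
  rw [vn]
  refine Real.sqrt_le_iff.mpr ⟨by linarith, ?_⟩
  have h : ∀ j, (x j : ℝ) * x j ≤ x i * x i := fun j => by
    have h1 : (x j : ℝ) ≤ x i := by exact_mod_cast (hx j).2
    have h2 : (0 : ℝ) ≤ x j := by exact_mod_cast (hx j).1
    gcongr
  rw [ip]; push_cast
  nlinarith [h 0, h 1, h 2, h 3]

theorem sg_le_dl {x : Fin 4 → ℤ} {i : Fin 4} (hx : ∀ j, 0 ≤ x j ∧ x j ≤ x i) (hi : 0 < x i)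
    (y : Fin 4 → ℤ) : sg x y ≤ 4 * (x i * dl x i y) := by
  have hx' : (0 : ℝ) < x i := by exact_mod_cast hi
  have hd := dl_nonneg hi y
  have hm := (dl_le_iff hi y (dl x i y)).mp le_rfl
  set z : Fin 4 → ℤ := fun j => mn x y i j with hz
  have hgr : x i ^ 2 * gr x y = gr x z := by
    simp only [hz, gr, ip, mn]; ring
  have h1 : gr x z ≤ ip x x * ip z z := by unfold gr; nlinarith [sq_nonneg (ip x z)]
  have h2 : ((ip x x : ℤ) : ℝ) ≤ (2 * x i) ^ 2 := by
    rw [← vn_sq]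
    have := vn_nonneg x
    have := vn_le_two_mul hx
    gcongr
  have h3 : ((ip z z : ℤ) : ℝ) ≤ 4 * (x i * dl x i y) ^ 2 := by
    have : ∀ j, (z j : ℝ) * z j ≤ (x i * dl x i y) ^ 2 := fun j => by
      rw [← sq, ← sq_abs]
      have := hm j
      gcongr
    rw [ip]; push_cast
    nlinarith [this 0, this 1, this 2, this 3]
  have h4 : (x i : ℝ) ^ 2 * ((gr x y : ℤ) : ℝ) ≤ (2 * x i) ^ 2 * (4 * (x i * dl x i y) ^ 2) := by
    have e : (x i : ℝ) ^ 2 * ((gr x y : ℤ) : ℝ) = ((gr x z : ℤ) : ℝ) := by exact_mod_cast hgr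
    rw [e]
    calc ((gr x z : ℤ) : ℝ) ≤ (ip x x : ℤ) * (ip z z : ℤ) := by exact_mod_cast h1
      _ ≤ _ := by
        have : (0 : ℝ) ≤ (ip z z : ℤ) := by exact_mod_cast ip_self_nonneg z
        gcongr
  rw [sg]
  refine Real.sqrt_le_iff.mpr ⟨by positivity, ?_⟩
  have h5 : (x i : ℝ) ^ 2 * ((gr x y : ℤ) : ℝ) ≤ (x i : ℝ) ^ 2 * (4 * (x i * dl x i y)) ^ 2 := by
    linarith
  exact le_of_mul_le_mul_left h5 (by positivity)

theorem dl_le {B : ℝ} (hB : 0 ≤ B) {x y : Fin 4 → ℤ} {i : Fin 4} (hx : ∀ j, 0 ≤ x j ∧ x j ≤ x i)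
    (hi : 0 < x i) (hy : y ∈ PF B) : dl x i y ≤ B := by
  rw [dl_le_iff hi]
  intro j
  have hp : ∀ k, (0 : ℝ) ≤ y k := fun k => by
    exact_mod_cast (by linarith [PF_pos hB hy k] : (0 : ℤ) ≤ y k)
  have hq := fun k => PF_le hB hy k
  have h1 : (0 : ℝ) ≤ x j := by exact_mod_cast (hx j).1
  have h2 : (x j : ℝ) ≤ x i := by exact_mod_cast (hx j).2
  have h3 : (0 : ℝ) ≤ x i := h1.trans h2
  unfold mn; push_cast
  rw [abs_le]
  constructor <;> nlinarith [hp i, hp j, hq i, hq j, mul_nonneg h3 (hp j), mul_nonneg h1 (hp i),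
    mul_le_mul_of_nonneg_left (hq j) h3, mul_le_mul h2 (hq i) (hp i) h3]

/-- The number of primes in an interval and in a residue class given by a minor. -/
theorem card_slice_le {B D : ℝ} {d : ℕ} (hB : 2 ≤ B) (hd : 1 ≤ d) (hdB : (d : ℝ) ≤ B)
    (hdD : (d : ℝ) ≤ 2 * D) (m c : ℤ) (hm : 0 < m) (hmd : IsCoprime m (d : ℤ)) 
    (hH : √B * Real.log B ≤ (D / d) ^ (11 / 12 : ℝ)) :
    (((prn B).filter fun p : ℕ => (d : ℤ) ∣ m * p - c ∧ |((m * p - c : ℤ) : ℝ)| ≤ m * D).card : ℝ) ≤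
      201 / Real.log B * ((D / d) ^ (11 / 12 : ℝ) * (d * B) ^ (1 / 12 : ℝ)) := by
  have hL : 0 < Real.log B := Real.log_pos (by linarith)
  have hd1 : (1 : ℝ) ≤ d := by exact_mod_cast hd
  have hD : 0 < D := by linarith
  have hm' : (0 : ℝ) < m := by exact_mod_cast hm
  have h1 := card_primes_modEq_le (B := B) (δ := min (2 * D) B) (d := d)
    ((prn B).filter fun p : ℕ => (d : ℤ) ∣ m * p - c ∧ |((m * p - c : ℤ) : ℝ)| ≤ m * D)
    (fun p hp => (mem_prn (by linarith)).mp (Finset.mem_filter.mp hp).1) (fun p hp q hq => by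
      have a1 := (Finset.mem_filter.mp hp).2.1
      have a2 := (Finset.mem_filter.mp hq).2.1
      have a3 := dvd_sub a2 a1
      have e : m * (q : ℤ) - c - (m * (p : ℤ) - c) = m * ((q : ℤ) - p) := by ring
      rw [e] at a3
      have a4 := hmd.symm.dvd_of_dvd_mul_left a3
      exact (Nat.modEq_iff_dvd).mpr a4) (fun p hp q hq => by
      have a1 := (Finset.mem_filter.mp hp).2.2
      have a2 := (Finset.mem_filter.mp hq).2.2
      refine le_min ?_ ?_
      · rw [abs_le] at a1 a2
        push_cast at a1 a2
        have : (m : ℝ) * (p - q) ≤ m * (2 * D) := by linarith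
        exact le_of_mul_le_mul_left this hm'
      · have := ((mem_prn (by linarith)).mp (Finset.mem_filter.mp hp).1).2
        have : (0 : ℝ) ≤ q := by positivity
        linarith) hB hd (le_min hdD hdB) (min_le_right _ _)
  have h2 : (min (2 * D) B / d) ^ (11 / 12 : ℝ) ≤ 2 * (D / d) ^ (11 / 12 : ℝ) := by
    calc (min (2 * D) B / d) ^ (11 / 12 : ℝ) ≤ (2 * (D / d)) ^ (11 / 12 : ℝ) := by
          have : 0 ≤ min (2 * D) B := le_min (by linarith) (by linarith)
          refine Real.rpow_le_rpow (by positivity) ?_ (by norm_num)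
          rw [← mul_div_assoc]
          gcongr
          exact min_le_left _ _
      _ = 2 ^ (11 / 12 : ℝ) * (D / d) ^ (11 / 12 : ℝ) := Real.mul_rpow (by norm_num) (by positivity)
      _ ≤ 2 ^ (1 : ℝ) * (D / d) ^ (11 / 12 : ℝ) := by gcongr <;> norm_num
      _ = _ := by rw [Real.rpow_one]
  have h3 : (1 : ℝ) ≤ (d * B) ^ (1 / 12 : ℝ) := Real.one_le_rpow (by nlinarith) (by norm_num)
  have h4 : √B ≤ 1 / Real.log B * ((D / d) ^ (11 / 12 : ℝ) * (d * B) ^ (1 / 12 : ℝ)) := by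
    rw [div_mul_eq_mul_div, one_mul, le_div_iff₀ hL]
    have : (0 : ℝ) ≤ (D / d) ^ (11 / 12 : ℝ) := by positivity
    nlinarith
  refine h1.trans ?_
  calc _ ≤ 1 / Real.log B * ((D / d) ^ (11 / 12 : ℝ) * (d * B) ^ (1 / 12 : ℝ)) +
        100 / Real.log B * (2 * (D / d) ^ (11 / 12 : ℝ) * (d * B) ^ (1 / 12 : ℝ)) := by gcongr
    _ = _ := by ring

/-- The number of prime vectors close to a line, with all minors divisible by `d`. -/
theorem card_near_line_le {B D : ℝ} {d : ℕ} (hB : 2 ≤ B) (hd : 1 ≤ d) (hdB : (d : ℝ) ≤ B)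
    (hdD : (d : ℝ) ≤ 2 * D) (hDB : D ≤ B) (x : Fin 4 → ℤ) (i : Fin 4) (hi : 0 < x i)
    (hmd : IsCoprime (x i) (d : ℤ)) (hH : √B * Real.log B ≤ (D / d) ^ (11 / 12 : ℝ)) :
    (((PF B).filter fun y => (∀ j, (d : ℤ) ∣ mn x y i j) ∧ dl x i y ≤ D).card : ℝ) ≤
      5 * 201 ^ 3 * B ^ 2 * (d : ℝ) ^ (-(5 / 2) : ℝ) / Real.log B ^ 4 * D ^ 2 := by
  classical
  have hL : 0 < Real.log B := Real.log_pos (by linarith)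
  have hd1 : (1 : ℝ) ≤ d := by exact_mod_cast hd
  have hD : 0 < D := by linarith
  set K := 201 / Real.log B * ((D / d) ^ (11 / 12 : ℝ) * (d * B) ^ (1 / 12 : ℝ)) with hK
  have hK0 : 0 ≤ K := by positivity
  let T : ℤ → Fin 4 → Finset ℤ := fun q j => if j = i then {q} else
    ((prn B).filter fun p : ℕ => (d : ℤ) ∣ x i * p - x j * q ∧
      |((x i * p - x j * q : ℤ) : ℝ)| ≤ x i * D).image (fun n : ℕ => (n : ℤ))
  have hsub : ((PF B).filter fun y => (∀ j, (d : ℤ) ∣ mn x y i j) ∧ dl x i y ≤ D) ⊆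
      (prz B).biUnion fun q => Fintype.piFinset (T q) := by
    intro y hy
    rw [Finset.mem_filter, dl_le_iff hi] at hy
    obtain ⟨h1, h2, h3⟩ := hy
    rw [Finset.mem_biUnion]
    refine ⟨y i, mem_PF.mp h1 i, Fintype.mem_piFinset.mpr fun j => ?_⟩
    by_cases hj : j = i
    · simp [T, hj]
    · simp only [T, if_neg hj]
      obtain ⟨p, hp1, hp2, hp3⟩ := (mem_prz (by linarith)).mp (mem_PF.mp h1 j)
      have a2 := h2 j
      have a3 := h3 j
      unfold mn at a2 a3
      rw [hp3] at a2 a3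
      rw [Finset.mem_image]
      refine ⟨p, Finset.mem_filter.mpr ⟨(mem_prn (by linarith)).mpr ⟨hp1, hp2⟩, a2, a3⟩, hp3.symm⟩
  have hT : ∀ q j, j ≠ i → ((T q j).card : ℝ) ≤ K := by
    intro q j hj
    simp only [T, if_neg hj]
    rw [Finset.card_image_of_injective _ Nat.cast_injective]
    exact card_slice_le hB hd hdB hdD (x i) (x j * q) hi hmd hH
  have hTi : ∀ q, ((T q i).card : ℝ) = 1 := by intro q; simp [T]
  have hprod : ∀ q, (∏ j, ((T q j).card : ℝ)) ≤ K ^ 3 := by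
    intro q
    rw [← Finset.mul_prod_erase Finset.univ _ (Finset.mem_univ i), hTi, one_mul]
    calc _ ≤ ∏ _j ∈ Finset.univ.erase i, K := Finset.prod_le_prod (fun j _ => by positivity)
          fun j hj => hT q j (Finset.ne_of_mem_erase hj)
      _ = K ^ 3 := by simp
  have h1 : (((PF B).filter fun y => (∀ j, (d : ℤ) ∣ mn x y i j) ∧ dl x i y ≤ D).card : ℝ) ≤
      ∑ q ∈ prz B, ∏ j, ((T q j).card : ℝ) := by
    have a := (Finset.card_le_card hsub).trans Finset.card_biUnion_le
    refine (Nat.cast_le.mpr a).trans ?_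
    push_cast [Fintype.card_piFinset]
    exact le_rfl
  have h2 : K ^ 3 ≤ 201 ^ 3 / Real.log B ^ 3 * (B * (d : ℝ) ^ (-(5 / 2) : ℝ) * D ^ 2) := by
    rw [hK, mul_pow, div_pow]
    refine mul_le_mul_of_nonneg_left ?_ (by positivity)
    rw [mul_pow, ← Real.rpow_natCast, ← Real.rpow_natCast, ← Real.rpow_mul (by positivity),
      ← Real.rpow_mul (by positivity), Real.div_rpow hD.le (by positivity),
      Real.mul_rpow (by positivity) (by linarith)]
    norm_num
    have e1 : D ^ (11 / 4 : ℝ) = D ^ (2 : ℝ) * D ^ (3 / 4 : ℝ) := by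
      rw [← Real.rpow_add hD]; norm_num
    have e2 : B = B ^ (3 / 4 : ℝ) * B ^ (1 / 4 : ℝ) := by
      rw [← Real.rpow_add (by linarith)]; norm_num
    have e3 : D ^ (3 / 4 : ℝ) ≤ B ^ (3 / 4 : ℝ) := by gcongr
    have e4 : (d : ℝ) ^ (-(5 / 2) : ℝ) = (d : ℝ) ^ (1 / 4 : ℝ) / (d : ℝ) ^ (11 / 4 : ℝ) := by
      rw [← Real.rpow_sub (by linarith)]; norm_num
    have e5 : D ^ (2 : ℝ) = D ^ 2 := by norm_cast
    calc D ^ (11 / 4 : ℝ) / (d : ℝ) ^ (11 / 4 : ℝ) * ((d : ℝ) ^ (1 / 4 : ℝ) * B ^ (1 / 4 : ℝ))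
        = D ^ (3 / 4 : ℝ) * B ^ (1 / 4 : ℝ) * ((d : ℝ) ^ (1 / 4 : ℝ) / (d : ℝ) ^ (11 / 4 : ℝ)) * D ^ 2 := by
          rw [e1, e5]; ring
      _ ≤ B ^ (3 / 4 : ℝ) * B ^ (1 / 4 : ℝ) * ((d : ℝ) ^ (1 / 4 : ℝ) / (d : ℝ) ^ (11 / 4 : ℝ)) * D ^ 2 := by
          gcongr
      _ = _ := by rw [← e2, ← e4]
  calc _ ≤ ∑ q ∈ prz B, ∏ j, ((T q j).card : ℝ) := h1
    _ ≤ ∑ _q ∈ prz B, K ^ 3 := Finset.sum_le_sum fun q _ => hprod q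
    _ = ((prn B).card : ℝ) * K ^ 3 := by
        rw [Finset.sum_const, nsmul_eq_mul, prz, Finset.card_image_of_injective _ Nat.cast_injective]
    _ ≤ 5 * B / Real.log B * (201 ^ 3 / Real.log B ^ 3 * (B * (d : ℝ) ^ (-(5 / 2) : ℝ) * D ^ 2)) := by
        have := card_prn_le hB
        gcongr
    _ = _ := by ring

theorem sum_one_div_dl_le {B δ₀ D : ℝ} {d : ℕ} (hB : 2 ≤ B) (hd : 1 ≤ d) (hdB : (d : ℝ) ≤ B)
    (hdD : (d : ℝ) ≤ 2 * δ₀) (hD0 : 0 ≤ D) (hDB : D ≤ B) (x : Fin 4 → ℤ) (i : Fin 4) (hi : 0 < x i)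
    (hmd : IsCoprime (x i) (d : ℤ)) (hH : √B * Real.log B ≤ (δ₀ / d) ^ (11 / 12 : ℝ)) :
    ∑ y ∈ (PF B).filter (fun y => (∀ j, (d : ℤ) ∣ mn x y i j) ∧ δ₀ ≤ dl x i y ∧ dl x i y ≤ D),
      1 / dl x i y ≤
      4 * (5 * 201 ^ 3 * B ^ 2 * (d : ℝ) ^ (-(5 / 2) : ℝ) / Real.log B ^ 4) * D := by
  have hL : 0 < Real.log B := Real.log_pos (by linarith)
  have hd1 : (1 : ℝ) ≤ d := by exact_mod_cast hd
  have hδ₀ : 0 < δ₀ := by linarith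
  obtain ⟨n, hn⟩ := pow_unbounded_of_one_lt (D / δ₀) (show (1 : ℝ) < 2 by norm_num)
  refine sum_one_div_le_dyadic (δ₀ := δ₀) (by positivity) hδ₀ (dl x i) n _ D
    (fun y hy => (Finset.mem_filter.mp hy).2.2) hD0 (fun D' h1 h2 => ?_)
    (by rw [div_lt_iff₀ hδ₀] at hn; linarith)
  refine le_trans (Nat.cast_le.mpr (Finset.card_le_card fun y hy => ?_))
    (card_near_line_le hB hd hdB (D := D') (by linarith) (by linarith) x i hi hmd (hH.trans ?_))
  · rw [Finset.mem_filter, Finset.mem_filter] at hy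
    exact Finset.mem_filter.mpr ⟨hy.1.1, hy.1.2.1, hy.2⟩
  · refine Real.rpow_le_rpow (by positivity) ?_ (by norm_num)
    gcongr

theorem sg_le_vn_mul (x y : Fin 4 → ℤ) : sg x y ≤ vn x * vn y := by
  rw [sg]
  refine Real.sqrt_le_iff.mpr ⟨mul_nonneg (vn_nonneg _) (vn_nonneg _), ?_⟩
  rw [mul_pow, vn_sq, vn_sq]
  have : gr x y ≤ ip x x * ip y y := by unfold gr; nlinarith [sq_nonneg (ip x y)]
  exact_mod_cast this

theorem sum_rpow_tail_le : ∃ Z : ℝ, 0 < Z ∧ ∀ (w : ℝ) (n : ℕ), 0 < w →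
    ∑ d ∈ (Finset.Icc 1 n).filter (fun d : ℕ => w < d), (d : ℝ) ^ (-(3 / 2) : ℝ) ≤
      Z * w ^ (-(1 / 4) : ℝ) := by
  have hs : Summable fun n : ℕ => (n : ℝ) ^ (-(5 / 4) : ℝ) :=
    Real.summable_nat_rpow.mpr (by norm_num)
  have h0 : ∀ n : ℕ, 0 ≤ (n : ℝ) ^ (-(5 / 4) : ℝ) := fun n => by positivity
  refine ⟨∑' n : ℕ, (n : ℝ) ^ (-(5 / 4) : ℝ), ?_, fun w n hw => ?_⟩
  · exact hs.tsum_pos h0 1 (by norm_num)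
  calc _ ≤ ∑ d ∈ (Finset.Icc 1 n).filter (fun d : ℕ => w < d),
        (d : ℝ) ^ (-(5 / 4) : ℝ) * w ^ (-(1 / 4) : ℝ) := by
        refine Finset.sum_le_sum fun d hd => ?_
        have hd := (Finset.mem_filter.mp hd).2
        have e : (d : ℝ) ^ (-(3 / 2) : ℝ) = (d : ℝ) ^ (-(5 / 4) : ℝ) * (d : ℝ) ^ (-(1 / 4) : ℝ) := by
          rw [← Real.rpow_add (by linarith)]; norm_num
        rw [e]
        refine mul_le_mul_of_nonneg_left ?_ (h0 d)
        exact Real.rpow_le_rpow_of_nonpos hw hd.le (by norm_num)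
    _ = (∑ d ∈ (Finset.Icc 1 n).filter (fun d : ℕ => w < d),
        (d : ℝ) ^ (-(5 / 4) : ℝ)) * w ^ (-(1 / 4) : ℝ) := by rw [Finset.sum_mul]
    _ ≤ _ := by
        refine mul_le_mul_of_nonneg_right ?_ (by positivity)
        exact hs.sum_le_tsum _ fun n _ => h0 n

set_option maxHeartbeats 1000000 in
/-- The contribution of the bad pairs with a fixed first component. -/
theorem exists_sum_bad_le : ∃ K : ℝ, 0 < K ∧ ∀ (B L w : ℝ), 2 ≤ B → 1 ≤ L → 0 < w →
    2 ≤ Real.log B → 16 * L ^ 2 < B → √B * Real.log B ≤ (B / (16 * L ^ 2)) ^ (11 / 12 : ℝ) →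
    ∀ x ∈ PF B, ∀ Y : Finset (Fin 4 → ℤ), Y ⊆ PF B → (∀ y ∈ Y, gr x y ≠ 0 ∧
      gm x y * B ^ 2 < L * sg x y ∧ (w < gm x y ∨ 2 * Real.log B * sg x y < vn x * vn y)) →
    ∑ y ∈ Y, mu x y ≤ K * (B ^ 3 / Real.log B ^ 4) *
      (w ^ (-(1 / 4) : ℝ) + w / Real.log B) * (1 / vn x) := by
  classical
  obtain ⟨Z, hZ0, hZ⟩ := sum_rpow_tail_le
  refine ⟨4 * (5 * 201 ^ 3) * (2 * Z + 4), by positivity, ?_⟩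
  intro B L w hB hL hw hα hLB hH x hx Y hYP hY
  set α := Real.log B with hαd
  have hB0 : 0 < B := by linarith
  have hvx := vn_pos (PF_ne_zero hB0.le hx)
  rcases Y.eq_empty_or_nonempty with rfl | ⟨y₀, hy₀⟩
  · rw [Finset.sum_empty]; positivity
  obtain ⟨i, -, hi⟩ := Finset.exists_max_image (Finset.univ : Finset (Fin 4)) x Finset.univ_nonempty
  have hpos : ∀ j, 2 ≤ x j := PF_pos hB0.le hx
  have hxi : ∀ j, 0 ≤ x j ∧ x j ≤ x i := fun j => ⟨by linarith [hpos j], hi j (Finset.mem_univ j)⟩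
  have hi0 : 0 < x i := by linarith [hpos i]
  set M : ℝ := ((x i : ℤ) : ℝ) with hM
  have hM0 : 0 < M := by rw [hM]; exact_mod_cast hi0
  have hMB : M ≤ B := PF_le hB0.le hx i
  have hvM : vn x ≤ 2 * M := vn_le_two_mul hxi
  have hg1 : ∀ y ∈ Y, (1 : ℝ) ≤ gm x y := fun y hy => by
    have := gm_pos (lt_of_le_of_ne (gr_nonneg x y) (hY y hy).1.symm)
    exact_mod_cast this
  have hsg : ∀ y ∈ Y, sg x y ≤ 4 * (M * B) := fun y hy => by
    have h1 := sg_le_vn_mul x y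
    have h2 := PF_vn_le hB0.le (hYP hy)
    have h3 := vn_nonneg y
    nlinarith
  have hML : B ≤ 4 * L * M := by
    have h1 := (hY y₀ hy₀).2.1
    have h2 := hg1 y₀ hy₀
    have h3 := hsg y₀ hy₀
    have h4 : B * B ≤ B * (4 * L * M) := by nlinarith
    exact le_of_mul_le_mul_left h4 hB0
  set δ₀ := B / (4 * L) with hδ₀
  have hδp : 0 < δ₀ := by positivity
  have hdl : ∀ y ∈ Y, δ₀ ≤ dl x i y := fun y hy => by
    have h1 := (hY y hy).2.1
    have h2 := hg1 y hy
    have h3 := sg_le_dl hxi hi0 y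
    have h4 := dl_nonneg hi0 y
    rw [hδ₀, div_le_iff₀ (by positivity)]
    have h5 : M * dl x i y ≤ B * dl x i y := by gcongr
    have h6 : B * B ≤ B * (dl x i y * (4 * L)) := by nlinarith
    exact le_of_mul_le_mul_left h6 hB0
  have hdlB : ∀ y ∈ Y, dl x i y ≤ B := fun y hy => dl_le hB0.le hxi hi0 (hYP hy)
  have hgL : ∀ y ∈ Y, (gm x y : ℝ) ≤ 4 * L := fun y hy => by
    have h1 := (hY y hy).2.1
    have h3 := hsg y hy
    have h3' : sg x y ≤ 4 * (B * B) := h3.trans (by gcongr)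
    have h4 : B ^ 2 * gm x y ≤ B ^ 2 * (4 * L) := by nlinarith
    exact le_of_mul_le_mul_left h4 (by positivity)
  have hprime : (x i).natAbs.Prime := by
    obtain ⟨q, hq, _, hq2⟩ := (mem_prz hB0.le).mp (mem_PF.mp hx i)
    rw [hq2]; simpa using hq
  -- the sums attached to a divisor
  have hdiv : ∀ (d : ℕ) (D : ℝ), 1 ≤ d → (d : ℝ) ≤ 4 * L → 0 ≤ D → D ≤ B →
      ∑ y ∈ (PF B).filter (fun y => (∀ j, (d : ℤ) ∣ mn x y i j) ∧ δ₀ ≤ dl x i y ∧ dl x i y ≤ D),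
      1 / dl x i y ≤
      4 * (5 * 201 ^ 3 * B ^ 2 * (d : ℝ) ^ (-(5 / 2) : ℝ) / α ^ 4) * D := by
    intro d D hd hdL hD0 hDB
    have hd1 : (1 : ℝ) ≤ d := by exact_mod_cast hd
    refine sum_one_div_dl_le hB hd (by nlinarith) ?_ hD0 hDB x i hi0 ?_ (hH.trans ?_)
    · rw [hδ₀, ← mul_div_assoc, le_div_iff₀ (by positivity)]
      nlinarith
    · rw [Int.isCoprime_iff_nat_coprime]
      refine (hprime.coprime_iff_not_dvd).mpr fun h => ?_
      have h1 := Nat.le_of_dvd (by simp; omega) h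
      simp only [Int.natAbs_natCast] at h1
      have h2 : M ≤ d := by
        rw [hM]
        have : x i ≤ d := by omega
        exact_mod_cast this
      have h4 : (d : ℝ) * (4 * L) < M * (4 * L) := by nlinarith
      have h5 : (d : ℝ) < M := lt_of_mul_lt_mul_right h4 (by positivity)
      linarith
    · refine Real.rpow_le_rpow (by positivity) ?_ (by norm_num)
      rw [hδ₀, div_div]
      exact div_le_div_of_nonneg_left hB0.le (by positivity) (by nlinarith)
  set G : ℕ → ℝ := fun d => ∑ y ∈ (PF B).filter (fun y => (∀ j, (d : ℤ) ∣ mn x y i j) ∧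
    δ₀ ≤ dl x i y ∧ dl x i y ≤ B), 1 / dl x i y with hG
  set H : ℝ := ∑ y ∈ (PF B).filter (fun y => (∀ j, ((1 : ℕ) : ℤ) ∣ mn x y i j) ∧
    δ₀ ≤ dl x i y ∧ dl x i y ≤ 2 * B / α), 1 / dl x i y with hH'
  set I := (Finset.Icc 1 ⌊4 * L⌋₊).filter (fun d : ℕ => w < d) with hI
  have hsplit : M * ∑ y ∈ Y, mu x y ≤ ∑ d ∈ I, (d : ℝ) * G d + w * H := by
    have hterm : ∀ y ∈ Y, M * mu x y ≤ (∑ d ∈ I, (d : ℝ) *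
        (if (∀ j, (d : ℤ) ∣ mn x y i j) ∧ δ₀ ≤ dl x i y ∧ dl x i y ≤ B then 1 / dl x i y else 0)) +
        w * (if (∀ j, ((1 : ℕ) : ℤ) ∣ mn x y i j) ∧ δ₀ ≤ dl x i y ∧ dl x i y ≤ 2 * B / α then
          1 / dl x i y else 0) := by
      intro y hy
      have hd := hdl y hy
      have hdp : 0 < dl x i y := by linarith
      have hms := mul_dl_le_sg hi0 y
      have hsp : 0 < sg x y := by
        have : 0 < M * dl x i y := by positivity
        linarith
      have h1 : M * mu x y ≤ gm x y * (1 / dl x i y) := by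
        rw [mu, mul_one_div, ← mul_div_assoc, div_le_div_iff₀ hsp hdp]
        have := hg1 y hy
        nlinarith
      have hn1 : 0 ≤ ∑ d ∈ I, (d : ℝ) *
        (if (∀ j, (d : ℤ) ∣ mn x y i j) ∧ δ₀ ≤ dl x i y ∧ dl x i y ≤ B then 1 / dl x i y else 0) :=
        Finset.sum_nonneg fun d _ => by split_ifs <;> positivity
      rcases lt_or_ge w (gm x y) with hwg | hwg
      · set d := (gm x y).natAbs with hdd
        have hdz : ((d : ℕ) : ℤ) = gm x y := Int.natAbs_of_nonneg (gm_nonneg x y)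
        have hdr : (d : ℝ) = gm x y := by exact_mod_cast hdz
        have hdI : d ∈ I := by
          rw [hI, Finset.mem_filter, Finset.mem_Icc, hdr]
          refine ⟨⟨?_, Nat.le_floor (by rw [hdr]; exact hgL y hy)⟩, hwg⟩
          have := hg1 y hy
          rw [← hdr] at this
          exact_mod_cast this
        have h2 := Finset.single_le_sum (f := fun d : ℕ => (d : ℝ) *
          (if (∀ j, (d : ℤ) ∣ mn x y i j) ∧ δ₀ ≤ dl x i y ∧ dl x i y ≤ B then 1 / dl x i y else 0))
          (fun d _ => by split_ifs <;> positivity) hdI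
        rw [if_pos ⟨fun j => by rw [hdz]; exact gm_dvd x y i j, hd, hdlB y hy⟩, hdr] at h2
        have h3 : 0 ≤ w * (if (∀ j, ((1 : ℕ) : ℤ) ∣ mn x y i j) ∧ δ₀ ≤ dl x i y ∧
          dl x i y ≤ 2 * B / α then 1 / dl x i y else 0) := by split_ifs <;> positivity
        linarith
      · have h2 : 2 * α * sg x y < vn x * vn y :=
          (hY y hy).2.2.resolve_left (not_lt.mpr hwg)
        have h3 : dl x i y ≤ 2 * B / α := by
          rw [le_div_iff₀ (by linarith)]
          have h4 := PF_vn_le hB0.le (hYP hy)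
          have h5 : vn x * vn y ≤ 2 * M * (2 * B) :=
            mul_le_mul hvM h4 (vn_nonneg y) (by positivity)
          have h6 : 2 * M * (dl x i y * α) ≤ 2 * M * (2 * B) := by nlinarith
          exact le_of_mul_le_mul_left h6 (by positivity)
        rw [if_pos ⟨fun j => by simp, hd, h3⟩]
        have h4 : gm x y * (1 / dl x i y) ≤ w * (1 / dl x i y) := by gcongr
        linarith
    rw [Finset.mul_sum]
    refine (Finset.sum_le_sum hterm).trans ?_
    rw [Finset.sum_add_distrib]
    refine add_le_add ?_ ?_
    · rw [Finset.sum_comm]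
      refine Finset.sum_le_sum fun d _ => ?_
      rw [← Finset.mul_sum]
      simp only [hG]
      rw [Finset.sum_filter]
      refine mul_le_mul_of_nonneg_left ?_ (by positivity)
      exact Finset.sum_le_sum_of_subset_of_nonneg hYP fun y _ _ => by
        split_ifs with h
        · have := hδp.trans_le h.2.1
          positivity
        · exact le_rfl
    · rw [← Finset.mul_sum, hH', Finset.sum_filter]
      refine mul_le_mul_of_nonneg_left ?_ hw.le
      exact Finset.sum_le_sum_of_subset_of_nonneg hYP fun y _ _ => by
        split_ifs with h
        · have := hδp.trans_le h.2.1
          positivity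
        · exact le_rfl
  have hGs : ∑ d ∈ I, (d : ℝ) * G d ≤ 4 * (5 * 201 ^ 3) * (B ^ 3 / α ^ 4) * (Z * w ^ (-(1 / 4) : ℝ)) := by
    calc _ ≤ ∑ d ∈ I, 4 * (5 * 201 ^ 3) * (B ^ 3 / α ^ 4) * (d : ℝ) ^ (-(3 / 2) : ℝ) := by
          refine Finset.sum_le_sum fun d hd => ?_
          rw [hI, Finset.mem_filter, Finset.mem_Icc] at hd
          have hd1 : (0 : ℝ) < d := by exact_mod_cast hd.1.1
          have hdL : (d : ℝ) ≤ 4 * L :=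
            (Nat.cast_le.mpr hd.1.2).trans (Nat.floor_le (by positivity))
          have e : (d : ℝ) ^ (-(3 / 2) : ℝ) = d * (d : ℝ) ^ (-(5 / 2) : ℝ) := by
            have : (d : ℝ) ^ (-(3 / 2) : ℝ) = (d : ℝ) ^ (1 : ℝ) * (d : ℝ) ^ (-(5 / 2) : ℝ) := by
              rw [← Real.rpow_add hd1]; norm_num
            rwa [Real.rpow_one] at this
          calc (d : ℝ) * G d ≤ d * (4 * (5 * 201 ^ 3 * B ^ 2 * (d : ℝ) ^ (-(5 / 2) : ℝ) / α ^ 4) * B) :=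
                mul_le_mul_of_nonneg_left (hdiv d B hd.1.1 hdL hB0.le le_rfl) hd1.le
            _ = _ := by rw [e]; ring
      _ = 4 * (5 * 201 ^ 3) * (B ^ 3 / α ^ 4) * ∑ d ∈ I, (d : ℝ) ^ (-(3 / 2) : ℝ) := by
          rw [Finset.mul_sum]
      _ ≤ _ := mul_le_mul_of_nonneg_left (hZ w _ hw) (by positivity)
  have hHs : H ≤ 4 * (5 * 201 ^ 3) * (B ^ 3 / α ^ 4) * (2 / α) := by
    have h1 := hdiv 1 (2 * B / α) le_rfl (by push_cast; linarith) (by positivity) (by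
      rw [div_le_iff₀ (by linarith)]; nlinarith)
    refine h1.trans (le_of_eq ?_)
    rw [Nat.cast_one, Real.one_rpow]; ring
  have hfin : M * ∑ y ∈ Y, mu x y ≤ 4 * (5 * 201 ^ 3) * (B ^ 3 / α ^ 4) *
      (Z * w ^ (-(1 / 4) : ℝ) + 2 * (w / α)) := by
    have : w * H ≤ w * (4 * (5 * 201 ^ 3) * (B ^ 3 / α ^ 4) * (2 / α)) :=
      mul_le_mul_of_nonneg_left hHs hw.le
    calc _ ≤ _ := hsplit
      _ ≤ 4 * (5 * 201 ^ 3) * (B ^ 3 / α ^ 4) * (Z * w ^ (-(1 / 4) : ℝ)) +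
          w * (4 * (5 * 201 ^ 3) * (B ^ 3 / α ^ 4) * (2 / α)) := add_le_add hGs this
      _ = _ := by ring
  have hsum0 : 0 ≤ ∑ y ∈ Y, mu x y := Finset.sum_nonneg fun y _ => mu_nonneg x y
  have h1 : vn x * ∑ y ∈ Y, mu x y ≤ 2 * M * ∑ y ∈ Y, mu x y := by gcongr
  rw [mul_one_div, le_div_iff₀ hvx, mul_comm]
  have hw4 : (0 : ℝ) ≤ w ^ (-(1 / 4) : ℝ) := by positivity
  have hwα : 0 ≤ w / α := by positivity
  have hc : 0 ≤ 4 * (5 * 201 ^ 3) * (B ^ 3 / α ^ 4) := by positivity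
  calc vn x * ∑ y ∈ Y, mu x y ≤ 2 * (4 * (5 * 201 ^ 3) * (B ^ 3 / α ^ 4) *
        (Z * w ^ (-(1 / 4) : ℝ) + 2 * (w / α))) := by linarith
    _ = 4 * (5 * 201 ^ 3) * (B ^ 3 / α ^ 4) * (2 * Z * w ^ (-(1 / 4) : ℝ) + 4 * (w / α)) := by ring
    _ ≤ 4 * (5 * 201 ^ 3) * (B ^ 3 / α ^ 4) * ((2 * Z + 4) * w ^ (-(1 / 4) : ℝ) + (2 * Z + 4) * (w / α)) := by
        have h2 : 0 ≤ Z * (w / α) := by positivity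
        refine mul_le_mul_of_nonneg_left ?_ hc
        nlinarith
    _ = _ := by ring

/-- The contribution of all bad pairs with large covolume. -/
theorem exists_sum_bad_pairs_le : ∃ K : ℝ, 0 < K ∧ ∀ (B L w : ℝ), 2 ≤ B → 1 ≤ L → 0 < w →
    2 ≤ Real.log B → 16 * L ^ 2 < B → √B * Real.log B ≤ (B / (16 * L ^ 2)) ^ (11 / 12 : ℝ) →
    ∀ S : Finset ((Fin 4 → ℤ) × (Fin 4 → ℤ)), S ⊆ PF B ×ˢ PF B → (∀ p ∈ S, gr p.1 p.2 ≠ 0 ∧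
      gm p.1 p.2 * B ^ 2 < L * sg p.1 p.2 ∧
      (w < gm p.1 p.2 ∨ 2 * Real.log B * sg p.1 p.2 < vn p.1 * vn p.2)) →
    ∑ p ∈ S, mu p.1 p.2 ≤ K * (B ^ 6 / Real.log B ^ 8) * (w ^ (-(1 / 4) : ℝ) + w / Real.log B) := by
  classical
  obtain ⟨K, hK, h⟩ := exists_sum_bad_le
  refine ⟨14 ^ 4 * K, by positivity, ?_⟩
  intro B L w hB hL hw hα hLB hH S hS hp
  have h1 : ∑ p ∈ S, mu p.1 p.2 = ∑ x ∈ PF B, ∑ y ∈ (PF B).filter (fun y => (x, y) ∈ S), mu x y := by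
    have e : S = (PF B ×ˢ PF B).filter (fun p => p ∈ S) := by
      ext p
      rw [Finset.mem_filter]
      exact ⟨fun h => ⟨hS h, h⟩, fun h => h.2⟩
    conv_lhs => rw [e]
    rw [Finset.sum_filter, Finset.sum_product]
    refine Finset.sum_congr rfl fun x _ => ?_
    rw [Finset.sum_filter]
  rw [h1]
  have h0 : 0 ≤ w ^ (-(1 / 4) : ℝ) + w / Real.log B := by positivity
  calc _ ≤ ∑ x ∈ PF B, K * (B ^ 3 / Real.log B ^ 4) * (w ^ (-(1 / 4) : ℝ) + w / Real.log B) *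
        (1 / vn x) := by
        refine Finset.sum_le_sum fun x hx => ?_
        refine h B L w hB hL hw hα hLB hH x hx _ (Finset.filter_subset _ _) fun y hy => ?_
        exact hp (x, y) (Finset.mem_filter.mp hy).2
    _ = K * (B ^ 3 / Real.log B ^ 4) * (w ^ (-(1 / 4) : ℝ) + w / Real.log B) *
        ∑ x ∈ PF B, 1 / vn x := by rw [Finset.mul_sum]
    _ ≤ K * (B ^ 3 / Real.log B ^ 4) * (w ^ (-(1 / 4) : ℝ) + w / Real.log B) *
        (14 ^ 4 * B ^ 3 / Real.log B ^ 4) := by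
        have := sum_inv_vn_PF_le hB
        gcongr
    _ = _ := by ring

theorem ip_eq_sum {R : Type*} [CommRing R] (u v : Fin 4 → R) : ip u v = ∑ i, u i * v i := (sum_eq_ip u v).symm

theorem card_hyperplane_le {S : Finset ℤ} {c : Fin 4 → ℤ} (hc : c ≠ 0) (F : Finset (Fin 4 → ℤ))
    (hS : ∀ z ∈ F, ∀ t, z t ∈ S) (hF : ∀ z ∈ F, ip c z = 0) : F.card ≤ S.card ^ 3 := by
  obtain ⟨i, hi⟩ := Function.ne_iff.mp hc
  have hcard : Fintype.card {t : Fin 4 // t ≠ i} = 3 := by clear hi; revert i; decide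
  have hcard' : (Fintype.piFinset fun _ : {t : Fin 4 // t ≠ i} => S).card = S.card ^ 3 := by
    rw [Fintype.card_piFinset, Finset.prod_const, Finset.card_univ, hcard]
  rw [← hcard']
  refine Finset.card_le_card_of_injOn (fun z t => z t.1) ?_ ?_
  · intro z hz
    simp only [Finset.mem_coe, Fintype.mem_piFinset]
    exact fun t => hS z hz _
  · intro z hz z' hz' h
    have h1 : ∀ t, t ≠ i → z t = z' t := fun t ht => congrFun h ⟨t, ht⟩
    have h2 : ip c (z - z') = 0 := by rw [ip_sub, hF z hz, hF z' hz', sub_zero]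
    rw [ip_eq_sum, Finset.sum_eq_single i] at h2
    · have h3 : z i - z' i = 0 := (mul_eq_zero.mp h2).resolve_left hi
      funext t
      by_cases ht : t = i
      · rw [ht]; linarith
      · exact h1 t ht
    · intro t _ ht
      rw [Pi.sub_apply, h1 t ht, sub_self, mul_zero]
    · simp

theorem mem_bl_coord {T : ℝ} {a : Fin 4 → ℤ} (h : a ∈ bl T) (t : Fin 4) :
    a t ∈ Finset.Icc (-⌊T⌋) ⌊T⌋ := by
  rw [bl, Finset.mem_filter, Fintype.mem_piFinset] at h
  exact h.1 t

theorem card_Icc_floor_le {T : ℝ} (hT : 1 ≤ T) :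
    ((Finset.Icc (-⌊T⌋) ⌊T⌋).card : ℝ) ≤ 3 * T := by
  have h1 : 1 ≤ ⌊T⌋ := Int.le_floor.mpr (by exact_mod_cast hT)
  have h2 := Int.floor_le T
  rw [Int.card_Icc]
  have h3 : (((⌊T⌋ + 1 - -⌊T⌋).toNat : ℤ) : ℝ) ≤ 3 * T := by
    rw [Int.toNat_of_nonneg (by omega)]
    push_cast; linarith
  exact_mod_cast h3

theorem card_bl_le {T : ℝ} (hT : 1 ≤ T) : ((bl T).card : ℝ) ≤ 81 * T ^ 4 := by
  have h1 : (bl T).card ≤ (Finset.Icc (-⌊T⌋) ⌊T⌋).card ^ 4 := by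
    rw [bl]
    refine (Finset.card_filter_le _ _).trans (le_of_eq ?_)
    rw [Fintype.card_piFinset_const]
  have h2 := card_Icc_floor_le hT
  calc ((bl T).card : ℝ) ≤ ((Finset.Icc (-⌊T⌋) ⌊T⌋).card : ℝ) ^ 4 := by exact_mod_cast h1
    _ ≤ (3 * T) ^ 4 := by gcongr
    _ = _ := by ring

theorem card_bl_orth_le {T : ℝ} (hT : 1 ≤ T) {x : Fin 4 → ℤ} (hx : x ≠ 0) :
    (((bl T).filter fun a => ip x a = 0).card : ℝ) ≤ 27 * T ^ 3 := by
  have h1 := card_hyperplane_le hx ((bl T).filter fun a => ip x a = 0)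
    (S := Finset.Icc (-⌊T⌋) ⌊T⌋) (fun z hz t => mem_bl_coord (Finset.mem_filter.mp hz).1 t)
    (fun z hz => (Finset.mem_filter.mp hz).2)
  have h2 := card_Icc_floor_le hT
  calc _ ≤ ((Finset.Icc (-⌊T⌋) ⌊T⌋).card : ℝ) ^ 3 := by exact_mod_cast h1
    _ ≤ (3 * T) ^ 3 := by gcongr
    _ = _ := by ring

/-- A hyperplane orthogonal to a vector with two coprime coordinates. -/
theorem card_bl_orth_le_of_coprime {T : ℝ} (hT : 1 ≤ T) {x : Fin 4 → ℤ} {i j : Fin 4} (hij : i ≠ j)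
    (hi : 0 < x i) (hc : IsCoprime (x i) (x j)) (hxT : (x i : ℝ) ≤ T) :
    (((bl T).filter fun a => ip x a = 0).card : ℝ) ≤ 36 * T ^ 3 / x i := by
  set K := Finset.Icc (-⌊T⌋) ⌊T⌋ with hK
  set I := Finset.Icc ((-⌊T⌋) / x i) (⌊T⌋ / x i) with hI
  have hcard : Fintype.card {t : Fin 4 // t ≠ i ∧ t ≠ j} = 2 := by
    clear hI I hi hc hxT; revert i j; decide
  have hcard' : (Fintype.piFinset fun _ : {t : Fin 4 // t ≠ i ∧ t ≠ j} => K).card = K.card ^ 2 := by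
    rw [Fintype.card_piFinset, Finset.prod_const, Finset.card_univ, hcard]
  have h1 : ((bl T).filter fun a => ip x a = 0).card ≤ I.card * K.card ^ 2 := by
    rw [← hcard', ← Finset.card_product]
    refine Finset.card_le_card_of_injOn (fun z => (z j / x i, fun t => z t.1)) ?_ ?_
    · intro z hz
      have hz := (Finset.mem_filter.mp (Finset.mem_coe.mp hz)).1
      simp only [Finset.mem_coe, Finset.mem_product, Fintype.mem_piFinset]
      refine ⟨?_, fun t => mem_bl_coord hz _⟩
      have := Finset.mem_Icc.mp (mem_bl_coord hz j)
      exact Finset.mem_Icc.mpr ⟨Int.ediv_le_ediv hi this.1, Int.ediv_le_ediv hi this.2⟩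
    · intro z hz z' hz' h
      have e1 := (Prod.ext_iff.mp h).1
      have e2 := (Prod.ext_iff.mp h).2
      simp only at e1 e2
      have h1 : ∀ t, t ≠ i → t ≠ j → z t = z' t := fun t h h' => congrFun e2 ⟨t, h, h'⟩
      have h2 : ip x (z - z') = 0 := by
        rw [ip_sub, (Finset.mem_filter.mp hz).2, (Finset.mem_filter.mp hz').2, sub_zero]
      rw [ip_eq_sum, ← Finset.add_sum_erase _ _ (Finset.mem_univ i),
        ← Finset.add_sum_erase _ _ (Finset.mem_erase.mpr ⟨hij.symm, Finset.mem_univ j⟩),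
        Finset.sum_eq_zero] at h2
      · have hd : x i ∣ z j - z' j := by
          refine hc.dvd_of_dvd_mul_left ⟨-(z i - z' i), ?_⟩
          simp only [Pi.sub_apply] at h2
          linarith
        have hj : z j = z' j := by
          obtain ⟨k, hk⟩ := hd
          have : z j = z' j + x i * k := by linarith
          rw [this, Int.add_mul_ediv_left _ _ hi.ne'] at e1
          have : k = 0 := by linarith
          rw [this] at hk; linarith
        have h3 : z i - z' i = 0 := by
          simp only [Pi.sub_apply, hj, sub_self, mul_zero, add_zero] at h2
          exact (mul_eq_zero.mp h2).resolve_left hi.ne'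
        funext t
        by_cases ht : t = i
        · rw [ht]; linarith
        · by_cases ht' : t = j
          · rw [ht', hj]
          · exact h1 t ht ht'
      · intro t ht
        rw [Finset.mem_erase, Finset.mem_erase] at ht
        rw [Pi.sub_apply, h1 t ht.2.1 ht.1, sub_self, mul_zero]
  have h2 := card_Icc_floor_le hT
  have hxi : (0 : ℝ) < x i := by exact_mod_cast hi
  have h3 : (I.card : ℝ) ≤ 4 * T / x i := by
    have hT1 : 1 ≤ ⌊T⌋ := Int.le_floor.mpr (by exact_mod_cast hT)
    have hT2 := Int.floor_le T
    have a1 : ((⌊T⌋ / x i : ℤ) : ℝ) ≤ ⌊T⌋ / x i := by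
      rw [le_div_iff₀ hxi]; exact_mod_cast Int.ediv_mul_le _ hi.ne'
    have a2 : (-⌊T⌋ : ℝ) / x i - 1 ≤ ((-⌊T⌋ / x i : ℤ) : ℝ) := by
      rw [sub_le_iff_le_add, div_le_iff₀ hxi]
      have := (Int.lt_ediv_add_one_mul_self (-⌊T⌋) hi).le
      exact_mod_cast this
    have a3 : -⌊T⌋ / x i ≤ ⌊T⌋ / x i := Int.ediv_le_ediv hi (by omega)
    have a4 : 1 ≤ T / x i := by rw [one_le_div hxi]; exact hxT
    have a5 : (⌊T⌋ : ℝ) / x i ≤ T / x i := by gcongr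
    have a6 : (-⌊T⌋ : ℝ) / x i = -((⌊T⌋ : ℝ) / x i) := by ring
    have e : (((⌊T⌋ / x i + 1 - -⌊T⌋ / x i).toNat : ℤ) : ℝ) ≤ 4 * T / x i := by
      rw [Int.toNat_of_nonneg (by omega), mul_div_assoc]
      push_cast at a2 ⊢
      linarith
    rw [hI, Int.card_Icc]
    exact_mod_cast e
  calc _ ≤ (I.card : ℝ) * (K.card : ℝ) ^ 2 := by exact_mod_cast h1
    _ ≤ 4 * T / x i * (3 * T) ^ 2 := by gcongr
    _ = _ := by ring

theorem card_prz_le {B : ℝ} (hB : 0 ≤ B) : ((prz B).card : ℝ) ≤ B := by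
  have h : prn B ⊆ Finset.Icc 1 ⌊B⌋₊ := fun p hp => by
    have := (mem_prn hB).mp hp
    exact Finset.mem_Icc.mpr ⟨this.1.one_le, Nat.le_floor this.2⟩
  have h1 := Finset.card_le_card h
  rw [Nat.card_Icc, Nat.add_sub_cancel] at h1
  rw [prz, Finset.card_image_of_injective _ Nat.cast_injective]
  exact (Nat.cast_le.mpr h1).trans (Nat.floor_le hB)

theorem card_PF_le_pow {B : ℝ} (hB : 0 ≤ B) : ((PF B).card : ℝ) ≤ B ^ 4 := by
  have h := card_prz_le hB
  rw [PF, Fintype.card_piFinset_const]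
  push_cast
  gcongr

theorem sum_ee_PF_le {B : ℝ} (hB : 0 ≤ B) {a : Fin 4 → ℤ} (ha : a ≠ 0) :
    ∑ x ∈ PF B, ee x a ≤ B ^ 3 := by
  have h1 := card_hyperplane_le ha ((PF B).filter fun x => ip x a = 0) (S := prz B)
    (fun z hz t => mem_PF.mp (Finset.mem_filter.mp hz).1 t)
    (fun z hz => by rw [ip_comm]; exact (Finset.mem_filter.mp hz).2)
  have h2 := card_prz_le hB
  simp only [ee]
  rw [Finset.sum_boole]
  calc _ ≤ ((prz B).card : ℝ) ^ 3 := by exact_mod_cast h1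
    _ ≤ _ := by gcongr

/-- Linearly dependent prime quadruples are equal or constant. -/
theorem PF_eq_of_gr_eq_zero {B : ℝ} (hB : 0 ≤ B) {x y : Fin 4 → ℤ} (hx : x ∈ PF B) (hy : y ∈ PF B)
    (h : gr x y = 0) {i j : Fin 4} (hij : x i ≠ x j) : y = x := by
  have hp : ∀ z ∈ PF B, ∀ t, Prime (z t) := fun z hz t => by
    obtain ⟨q, hq, _, h2⟩ := (mem_prz hB).mp (mem_PF.mp hz t)
    rw [h2]; exact Nat.prime_iff_prime_int.mp hq
  have hpos : ∀ t, x t ≠ 0 := fun t => (hp x hx t).ne_zero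
  have hm : ∀ s t, x s * y t = x t * y s := fun s t => by
    have := mn_eq_zero_of_gr h s t
    unfold mn at this
    linarith
  have hdd : ∀ z ∈ PF B, ∀ w ∈ PF B, ∀ s t, z s ∣ w t → z s = w t := fun z hz w hw s t hd => by
    have ha := ((hp z hz s).associated_of_dvd (hp w hw t) hd)
    have h1 := PF_pos hB hz s
    have h2 := PF_pos hB hw t
    exact Int.eq_of_associated_of_nonneg ha (by linarith) (by linarith)
  have hi : x i = y i := by
    have : x i ∣ x j * y i := ⟨y j, by linarith [hm i j]⟩
    rcases (hp x hx i).dvd_or_dvd this with h' | h'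
    · exact absurd (hdd x hx x hx i j h') hij
    · exact hdd x hx y hy i i h'
  funext t
  have := hm i t
  rw [← hi, mul_comm (x t)] at this
  exact mul_left_cancel₀ (hpos i) this

/-- The squared deviation at a point. -/
noncomputable def dv (α : ℝ) (W : ℤ) (B : ℝ) (a : Fin 4 → ℤ) : ℝ :=
  (∑ x ∈ PF B, (ee x a - ff α W x a)) ^ 2

theorem dv_nonneg (α : ℝ) (W : ℤ) (B : ℝ) (a : Fin 4 → ℤ) : 0 ≤ dv α W B a := sq_nonneg _

theorem ff_le {α : ℝ} {W : ℤ} (hα : 0 ≤ α) (hW : 0 ≤ W) {r : ℝ} (hr : 0 < r) {x a : Fin 4 → ℤ}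
    (hx : x ≠ 0) (ha : r ≤ vn a) : ff α W x a ≤ α * W / r := by
  have h1 := one_le_vn hx
  have hW' : (0 : ℝ) ≤ W := by exact_mod_cast hW
  unfold ff
  split_ifs
  · refine div_le_div_of_nonneg_left (by positivity) hr ?_
    nlinarith
  · positivity

theorem ff_le_mul {α : ℝ} {W : ℤ} (hα : 0 ≤ α) (hW : 0 ≤ W) {x : Fin 4 → ℤ} (a : Fin 4 → ℤ)
    (hx : x ≠ 0) : ff α W x a ≤ α * W := by
  have hW' : (0 : ℝ) ≤ W := by exact_mod_cast hW
  by_cases ha : a = 0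
  · have : vn a = 0 := by rw [ha, vn, ip_zero]; simp
    unfold ff
    rw [this]
    split_ifs
    · simp; positivity
    · positivity
  · have := ff_le hα hW one_pos hx (one_le_vn ha)
    rwa [div_one] at this

theorem dv_le {α : ℝ} {W : ℤ} {B : ℝ} (hα : 0 ≤ α) (hW : 0 ≤ W) (hB : 0 ≤ B) (a : Fin 4 → ℤ) :
    dv α W B a ≤ (B ^ 4 * (1 + α * W)) ^ 2 := by
  have hW' : (0 : ℝ) ≤ W := by exact_mod_cast hW
  unfold dv
  rw [sq_le_sq, abs_of_nonneg (by positivity : (0 : ℝ) ≤ B ^ 4 * (1 + α * W))]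
  calc _ ≤ ∑ x ∈ PF B, |ee x a - ff α W x a| := Finset.abs_sum_le_sum_abs _ _
    _ ≤ ∑ x ∈ PF B, (1 + α * W) := by
        refine Finset.sum_le_sum fun x hx => ?_
        have h1 := ee_nonneg x a
        have h2 := ee_le_one x a
        have h3 := ff_nonneg hα hW x a
        have h4 := ff_le_mul hα hW a (PF_ne_zero hB hx)
        rw [abs_le]
        constructor <;> linarith
    _ = (PF B).card * (1 + α * W) := by rw [Finset.sum_const, nsmul_eq_mul]
    _ ≤ _ := by
        have := card_PF_le_pow hB
        gcongr

theorem sum_shl_dv (α : ℝ) (W : ℤ) (B r r' : ℝ) :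
    ∑ a ∈ shl r r', dv α W B a = ∑ p ∈ PF B ×ˢ PF B, ssum α W r r' p.1 p.2 := by
  simp only [dv, ssum, pow_two]
  rw [Finset.sum_comm]
  refine Finset.sum_congr rfl fun a _ => ?_
  rw [Finset.sum_mul_sum, Finset.sum_product]

/-- The pairs for which the orthogonal counts do not match their local model. -/
def Unbal (α : ℝ) (W : ℤ) (x y : Fin 4 → ℤ) : Prop :=
  ¬ (gm x y ∣ W ∧ vn x * vn y ≤ 2 * α * sg x y)

section Shell

variable {α η ρ R : ℝ} {W : ℤ} {x y : Fin 4 → ℤ}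

open Classical in
theorem ssum_le_of_gr_ne_zero (h : gr x y ≠ 0) (hα : 0 < α) (hW : 0 < W) (hρ : 0 < ρ)
    (hη : 0 < η) (hη1 : η ≤ 1 / 8) (hαW : α * W ≤ η * ρ) (hR : 1 ≤ R) :
    ssum α W ρ ((1 + η) * ρ) x y ≤
      Real.pi * (((1 + η) ^ 2 - 1) * ρ ^ 2) *
        (12 * η * mu x y + 3 * (if Unbal α W x y then mu x y else 0)) +
      12 * (24 * ρ * (1 / R + ∑ a ∈ (bl R).erase 0, ee x a * ee y a) + 2) := by
  obtain ⟨u, v, ho⟩ := exists_orthBasis h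
  obtain ⟨hx0, hy0⟩ := ho.ne_zero
  have hx : α * W ≤ η * (ρ * vn x) := by
    have := one_le_vn hx0
    have h2 : 0 < η * ρ := by positivity
    nlinarith
  have hy : α * W ≤ η * (ρ * vn y) := by
    have := one_le_vn hy0
    have h2 : 0 < η * ρ := by positivity
    nlinarith
  have hu0 : u ≠ 0 := by
    rintro rfl
    have := ho.pos
    rw [ip_zero] at this
    exact lt_irrefl _ this
  have hup := vn_pos hu0
  have hE0 : 0 ≤ ∑ a ∈ (bl R).erase 0, ee x a * ee y a :=
    Finset.sum_nonneg fun a _ => mul_nonneg (ee_nonneg x a) (ee_nonneg y a)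
  have hR0 : 0 < R := by linarith
  have hu : 1 / vn u ≤ 1 / R + ∑ a ∈ (bl R).erase 0, ee x a * ee y a := by
    rcases le_or_gt (vn u) R with hle | hlt
    · have hmem : u ∈ (bl R).erase 0 :=
        Finset.mem_erase.mpr ⟨hu0, (mem_bl_iff_vn hR0.le u).mpr hle⟩
      have h1 := Finset.single_le_sum (f := fun a => ee x a * ee y a)
        (fun a _ => mul_nonneg (ee_nonneg x a) (ee_nonneg y a)) hmem
      have h2 : ee x u * ee y u = 1 := by
        unfold ee; rw [if_pos ho.xu, if_pos ho.yu, one_mul]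
      have h3 : 1 / vn u ≤ 1 := by rw [div_le_one hup]; exact one_le_vn hu0
      have h4 : 0 < 1 / R := by positivity
      have h1' : ee x u * ee y u ≤ ∑ a ∈ (bl R).erase 0, ee x a * ee y a := h1
      linarith
    · have : 1 / vn u ≤ 1 / R := one_div_le_one_div_of_le hR0 hlt.le
      linarith
  have hD : 0 ≤ ((1 + η) ^ 2 - 1) * ρ ^ 2 := by
    have : 0 ≤ (1 + η) ^ 2 - 1 := by nlinarith
    positivity
  have hE : 12 * (24 * ρ / vn u + 2) ≤
      12 * (24 * ρ * (1 / R + ∑ a ∈ (bl R).erase 0, ee x a * ee y a) + 2) := by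
    have e : 24 * ρ / vn u = 24 * ρ * (1 / vn u) := by ring
    rw [e]
    gcongr
  have hπ := ho.pi_div_le
  have hmu := mu_nonneg x y
  have hπ' : Real.pi / sg u v * (((1 + η) ^ 2 - 1) * ρ ^ 2) ≤
      Real.pi * mu x y * (((1 + η) ^ 2 - 1) * ρ ^ 2) := mul_le_mul_of_nonneg_right hπ hD
  split_ifs with hb
  · have h1 := ho.ssum_le hα hW hρ hη hη1 hx hy
    have h2 : 0 ≤ Real.pi * (((1 + η) ^ 2 - 1) * ρ ^ 2) * (12 * η * mu x y) := by
      have := Real.pi_pos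
      positivity
    refine h1.trans ?_
    linarith
  · obtain ⟨h3, h4⟩ := not_not.mp hb
    have h1 := ho.ssum_le_of_good hα hW hρ hη hη1 hx hy h3 h4
    refine h1.trans ?_
    have := mul_le_mul_of_nonneg_left hπ' (by positivity : 0 ≤ 12 * η)
    linarith

theorem ssum_le_of_dependent (hx : x ≠ 0) (hy : y ≠ 0) (hα : 0 < α) (hW : 0 < W) (hρ : 1 ≤ ρ)
    (hη : 0 < η) (hη1 : η ≤ 1 / 8) :
    ssum α W ρ ((1 + η) * ρ) x y ≤
      ∑ a ∈ shl ρ ((1 + η) * ρ), ee x a * ee y a + 162 * (α * W) ^ 2 * ρ ^ 2 := by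
  have hρ0 : 0 < ρ := by linarith
  have hW' : (0 : ℝ) < W := by exact_mod_cast hW
  have hr' : 1 ≤ (1 + η) * ρ := by nlinarith
  have h1 : ssum α W ρ ((1 + η) * ρ) x y ≤
      ∑ a ∈ shl ρ ((1 + η) * ρ), (ee x a * ee y a + (α * W / ρ) ^ 2) := by
    refine Finset.sum_le_sum fun a ha => ?_
    have ha1 := ((mem_shl hρ0.le (by linarith) a).mp ha).1.le
    have e1 := ee_nonneg x a
    have e2 := ee_nonneg y a
    have f1 := ff_nonneg hα.le hW.le x a
    have f2 := ff_nonneg hα.le hW.le y a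
    have g1 := ff_le hα.le hW.le hρ0 hx ha1
    have g2 := ff_le hα.le hW.le hρ0 hy ha1
    have h3 : ff α W x a * ff α W y a ≤ (α * W / ρ) ^ 2 := by
      rw [pow_two]; gcongr
    have h4 := mul_nonneg e1 f2
    have h5 := mul_nonneg e2 f1
    nlinarith
  have h2 : ((shl ρ ((1 + η) * ρ)).card : ℝ) ≤ 162 * ρ ^ 4 := by
    have h3 : (shl ρ ((1 + η) * ρ)).card ≤ (bl ((1 + η) * ρ)).card :=
      Finset.card_le_card Finset.sdiff_subset
    have h4 := card_bl_le hr'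
    have h5 : (1 + η) ^ 4 ≤ (9 / 8) ^ 4 := by gcongr; linarith
    calc _ ≤ ((bl ((1 + η) * ρ)).card : ℝ) := by exact_mod_cast h3
      _ ≤ 81 * ((1 + η) * ρ) ^ 4 := h4
      _ = 81 * (1 + η) ^ 4 * ρ ^ 4 := by ring
      _ ≤ 162 * ρ ^ 4 := by
          have : 0 ≤ ρ ^ 4 := by positivity
          nlinarith
  refine h1.trans ?_
  rw [Finset.sum_add_distrib, Finset.sum_const, nsmul_eq_mul]
  refine add_le_add le_rfl ?_
  calc _ ≤ 162 * ρ ^ 4 * (α * W / ρ) ^ 2 := by gcongr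
    _ = _ := by field_simp

end Shell

theorem sum_sum_ee_le {B R : ℝ} (hB : 0 ≤ B) (hR : 1 ≤ R) :
    ∑ p ∈ PF B ×ˢ PF B, ∑ a ∈ (bl R).erase 0, ee p.1 a * ee p.2 a ≤ 81 * R ^ 4 * B ^ 6 := by
  rw [Finset.sum_comm]
  calc _ ≤ ∑ a ∈ (bl R).erase 0, B ^ 6 := by
        refine Finset.sum_le_sum fun a ha => ?_
        have h := sum_ee_PF_le hB (Finset.ne_of_mem_erase ha)
        have h0 : 0 ≤ ∑ x ∈ PF B, ee x a := Finset.sum_nonneg fun x _ => ee_nonneg x a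
        have e : ∑ p ∈ PF B ×ˢ PF B, ee p.1 a * ee p.2 a = (∑ x ∈ PF B, ee x a) * ∑ x ∈ PF B, ee x a := by
          rw [Finset.sum_mul_sum, Finset.sum_product]
        rw [e]
        calc _ ≤ B ^ 3 * B ^ 3 := by gcongr
          _ = _ := by ring
    _ = ((bl R).erase 0).card * B ^ 6 := by rw [Finset.sum_const, nsmul_eq_mul]
    _ ≤ _ := by
        have h1 : ((bl R).erase 0).card ≤ (bl R).card := Finset.card_le_card (Finset.erase_subset _ _)
        have h2 : (((bl R).erase 0).card : ℝ) ≤ (bl R).card := by exact_mod_cast h1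
        have h3 := card_bl_le hR
        gcongr
        linarith

/-- Sums over linearly dependent pairs of prime quadruples. -/
theorem sum_dependent_le {B : ℝ} (hB : 0 ≤ B) (f : (Fin 4 → ℤ) × (Fin 4 → ℤ) → ℝ) (hf : ∀ p, 0 ≤ f p) :
    ∑ p ∈ (PF B ×ˢ PF B).filter (fun p => gr p.1 p.2 = 0), f p ≤
      ∑ x ∈ (PF B).filter (fun x => ∃ i j, x i ≠ x j), f (x, x) +
      ∑ p ∈ prz B ×ˢ prz B, f (fun _ => p.1, fun _ => p.2) := by
  classical
  rw [← Finset.sum_filter_add_sum_filter_not _ (fun p => ∃ i j, p.1 i ≠ p.1 j)]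
  refine add_le_add ?_ ?_
  · rw [← Finset.sum_image (s := (PF B).filter (fun x => ∃ i j, x i ≠ x j)) (g := fun x => (x, x)) (f := f)
      (fun a _ b _ h => (Prod.ext_iff.mp h).1)]
    refine Finset.sum_le_sum_of_subset_of_nonneg ?_ fun p _ _ => hf p
    rintro ⟨x, y⟩ h
    simp only [Finset.mem_filter, Finset.mem_product] at h
    obtain ⟨⟨⟨hx, hy⟩, h0⟩, i, j, hij⟩ := h
    have := PF_eq_of_gr_eq_zero hB hx hy h0 hij
    subst this
    exact Finset.mem_image.mpr ⟨y, Finset.mem_filter.mpr ⟨hx, i, j, hij⟩, rfl⟩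
  · rw [← Finset.sum_image (s := prz B ×ˢ prz B)
      (g := fun p : ℤ × ℤ => ((fun _ => p.1 : Fin 4 → ℤ), (fun _ => p.2 : Fin 4 → ℤ))) (f := f)
      (fun a _ b _ h => Prod.ext (congrFun (Prod.ext_iff.mp h).1 0) (congrFun (Prod.ext_iff.mp h).2 0))]
    refine Finset.sum_le_sum_of_subset_of_nonneg ?_ fun p _ _ => hf p
    rintro ⟨x, y⟩ h
    simp only [Finset.mem_filter, Finset.mem_product] at h
    obtain ⟨⟨⟨hx, hy⟩, h0⟩, hij⟩ := h
    push Not at hij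
    have hx0 : x 0 ≠ 0 := by have := PF_pos hB hx 0; omega
    have hyc : ∀ t, y t = y 0 := fun t => by
      have h1 := mn_eq_zero_of_gr h0 0 t
      unfold mn at h1
      rw [hij t 0, ← mul_sub] at h1
      have := (mul_eq_zero.mp h1).resolve_left hx0
      linarith
    refine Finset.mem_image.mpr ⟨(x 0, y 0), Finset.mem_product.mpr ⟨mem_PF.mp hx 0, mem_PF.mp hy 0⟩, ?_⟩
    exact Prod.ext (funext fun t => hij 0 t) (funext fun t => (hyc t).symm)

theorem card_dependent_le {B : ℝ} (hB : 1 ≤ B) :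
    (((PF B ×ˢ PF B).filter (fun p => gr p.1 p.2 = 0)).card : ℝ) ≤ 2 * B ^ 4 := by
  have hB0 : 0 ≤ B := by linarith
  have h := sum_dependent_le hB0 (fun _ => 1) fun _ => zero_le_one
  simp only [Finset.sum_const, nsmul_eq_mul, mul_one] at h
  rw [Finset.card_product] at h
  have h1 : (((PF B).filter (fun x => ∃ i j, x i ≠ x j)).card : ℝ) ≤ (PF B).card := by
    exact_mod_cast Finset.card_filter_le _ _
  have h2 := card_PF_le_pow hB0
  have h3 := card_prz_le hB0
  have h4 : (((prz B).card * (prz B).card : ℕ) : ℝ) ≤ B * B := by push_cast; gcongr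
  have h5 : B * B ≤ B ^ 4 := by
    rw [← pow_two]; exact pow_le_pow_right₀ hB (by norm_num)
  linarith

/-- The diagonal contribution. -/
theorem sum_dependent_ee_le {B M : ℝ} (hB : 1 ≤ B) (hM : B ≤ M) :
    ∑ p ∈ (PF B ×ˢ PF B).filter (fun p => gr p.1 p.2 = 0), ∑ a ∈ bl M, ee p.1 a * ee p.2 a ≤
      72 * M ^ 3 * ∑ x ∈ PF B, 1 / vn x + 27 * M ^ 3 * B ^ 2 := by
  have hB0 : 0 ≤ B := by linarith
  have hM1 : 1 ≤ M := by linarith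
  have hcount : ∀ x y, ∑ a ∈ bl M, ee x a * ee y a ≤ (((bl M).filter fun a => ip x a = 0).card : ℝ) := by
    intro x y
    rw [← Finset.sum_boole]
    refine Finset.sum_le_sum fun a _ => ?_
    have h1 := ee_nonneg x a
    have h2 := ee_le_one y a
    have : ee x a * ee y a ≤ ee x a := by nlinarith
    exact this
  refine (sum_dependent_le hB0 _ fun p => Finset.sum_nonneg fun a _ =>
    mul_nonneg (ee_nonneg p.1 a) (ee_nonneg p.2 a)).trans (add_le_add ?_ ?_)
  · calc _ ≤ ∑ x ∈ (PF B).filter (fun x => ∃ i j, x i ≠ x j), 72 * M ^ 3 * (1 / vn x) := by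
          refine Finset.sum_le_sum fun x hx => (hcount x x).trans ?_
          rw [Finset.mem_filter] at hx
          obtain ⟨hx, i', j', hij⟩ := hx
          obtain ⟨i, -, hi⟩ := Finset.exists_max_image (Finset.univ : Finset (Fin 4)) x Finset.univ_nonempty
          obtain ⟨j, hj⟩ : ∃ j, x i ≠ x j := by
            by_contra! hc
            exact hij ((hc i').symm.trans (hc j'))
          have hpos := PF_pos hB0 hx
          have hne : i ≠ j := fun h => hj (by rw [h])
          have hc : IsCoprime (x i) (x j) := by
            obtain ⟨q, hq, _, h2⟩ := (mem_prz hB0).mp (mem_PF.mp hx i)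
            obtain ⟨q', hq', _, h2'⟩ := (mem_prz hB0).mp (mem_PF.mp hx j)
            rw [h2, h2', Nat.isCoprime_iff_coprime]
            exact (Nat.coprime_primes hq hq').mpr fun h => hj (by rw [h2, h2', h])
          have hi0 : 0 < x i := by linarith [hpos i]
          have hxi : (0 : ℝ) < x i := by exact_mod_cast hi0
          refine (card_bl_orth_le_of_coprime hM1 hne hi0 hc ((PF_le hB0 hx i).trans hM)).trans ?_
          have hv := vn_le_two_mul (x := x) (i := i) fun j =>
            ⟨by linarith [hpos j], hi j (Finset.mem_univ j)⟩
          have hvp := vn_pos (PF_ne_zero hB0 hx)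
          rw [mul_one_div, div_le_div_iff₀ hxi hvp]
          have : 0 ≤ M ^ 3 := by positivity
          nlinarith
      _ ≤ ∑ x ∈ PF B, 72 * M ^ 3 * (1 / vn x) :=
          Finset.sum_le_sum_of_subset_of_nonneg (Finset.filter_subset _ _) fun x _ _ => by
            have := vn_nonneg x
            positivity
      _ = _ := by rw [Finset.mul_sum]
  · calc _ ≤ ∑ p ∈ prz B ×ˢ prz B, 27 * M ^ 3 := by
          refine Finset.sum_le_sum fun p hp => (hcount _ _).trans ?_
          refine card_bl_orth_le hM1 fun h => ?_
          obtain ⟨q, hq, _, h2⟩ := (mem_prz hB0).mp (Finset.mem_product.mp hp).1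
          have := congrFun h 0
          have h3 : p.1 = 0 := this
          rw [h2] at h3
          exact hq.ne_zero (by exact_mod_cast h3)
      _ = ((prz B).card : ℝ) ^ 2 * (27 * M ^ 3) := by
          rw [Finset.sum_const, nsmul_eq_mul, Finset.card_product]; push_cast; ring
      _ ≤ B ^ 2 * (27 * M ^ 3) := by
          have := card_prz_le hB0
          gcongr
      _ = _ := by ring

open Classical in
/-- The variance over a single shell. -/
theorem sum_shl_dv_le {α η ρ R B : ℝ} {W : ℤ} (hB : 1 ≤ B) (hα : 0 < α) (hW : 0 < W) (hρ : 1 ≤ ρ)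
    (hη : 0 < η) (hη1 : η ≤ 1 / 8) (hαW : α * W ≤ η * ρ) (hR : 1 ≤ R) :
    ∑ a ∈ shl ρ ((1 + η) * ρ), dv α W B a ≤
      Real.pi * (((1 + η) ^ 2 - 1) * ρ ^ 2) *
        (12 * η * ∑ p ∈ (PF B ×ˢ PF B).filter (fun p => gr p.1 p.2 ≠ 0), mu p.1 p.2 +
          3 * ∑ p ∈ (PF B ×ˢ PF B).filter (fun p => gr p.1 p.2 ≠ 0 ∧ Unbal α W p.1 p.2),
            mu p.1 p.2) +
      12 * (24 * ρ * (B ^ 8 / R + 81 * R ^ 4 * B ^ 6) + 2 * B ^ 8) +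
      (∑ p ∈ (PF B ×ˢ PF B).filter (fun p => gr p.1 p.2 = 0),
        ∑ a ∈ shl ρ ((1 + η) * ρ), ee p.1 a * ee p.2 a + 324 * B ^ 4 * (α * W) ^ 2 * ρ ^ 2) := by
  have hB0 : 0 ≤ B := by linarith
  have hρ0 : 0 < ρ := by linarith
  have hW' : (0 : ℝ) < W := by exact_mod_cast hW
  set P := PF B ×ˢ PF B with hP
  rw [sum_shl_dv, ← Finset.sum_filter_add_sum_filter_not P (fun p => gr p.1 p.2 ≠ 0)]
  refine add_le_add ?_ ?_
  · calc _ ≤ ∑ p ∈ P.filter (fun p => gr p.1 p.2 ≠ 0), (Real.pi * (((1 + η) ^ 2 - 1) * ρ ^ 2) *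
        (12 * η * mu p.1 p.2 + 3 * (if Unbal α W p.1 p.2 then mu p.1 p.2 else 0)) +
        12 * (24 * ρ * (1 / R + ∑ a ∈ (bl R).erase 0, ee p.1 a * ee p.2 a) + 2)) :=
          Finset.sum_le_sum fun p hp => ssum_le_of_gr_ne_zero (Finset.mem_filter.mp hp).2
            hα hW hρ0 hη hη1 hαW hR
      _ = Real.pi * (((1 + η) ^ 2 - 1) * ρ ^ 2) *
        (12 * η * ∑ p ∈ P.filter (fun p => gr p.1 p.2 ≠ 0), mu p.1 p.2 +
          3 * ∑ p ∈ P.filter (fun p => gr p.1 p.2 ≠ 0 ∧ Unbal α W p.1 p.2), mu p.1 p.2) +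
        ∑ p ∈ P.filter (fun p => gr p.1 p.2 ≠ 0),
          12 * (24 * ρ * (1 / R + ∑ a ∈ (bl R).erase 0, ee p.1 a * ee p.2 a) + 2) := by
          rw [Finset.sum_add_distrib, ← Finset.mul_sum, Finset.sum_add_distrib, ← Finset.mul_sum,
            ← Finset.mul_sum, ← Finset.sum_filter, Finset.filter_filter]
      _ ≤ _ := by
          refine add_le_add le_rfl ?_
          have h0 : ∀ p : (Fin 4 → ℤ) × (Fin 4 → ℤ), 0 ≤ ∑ a ∈ (bl R).erase 0, ee p.1 a * ee p.2 a :=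
            fun p => Finset.sum_nonneg fun a _ => mul_nonneg (ee_nonneg _ a) (ee_nonneg _ a)
          calc _ ≤ ∑ p ∈ P, 12 * (24 * ρ * (1 / R + ∑ a ∈ (bl R).erase 0, ee p.1 a * ee p.2 a) + 2) :=
                Finset.sum_le_sum_of_subset_of_nonneg (Finset.filter_subset _ _) fun p _ _ => by
                  have := h0 p
                  positivity
            _ = 12 * (24 * ρ * ((P.card : ℝ) / R + ∑ p ∈ P, ∑ a ∈ (bl R).erase 0, ee p.1 a * ee p.2 a) +
                  2 * P.card) := by
                rw [← Finset.mul_sum, Finset.sum_add_distrib, ← Finset.mul_sum, Finset.sum_add_distrib,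
                  Finset.sum_const, Finset.sum_const]
                simp only [nsmul_eq_mul]
                ring
            _ ≤ _ := by
                have h1 := sum_sum_ee_le (B := B) hB0 hR
                have h2 : (P.card : ℝ) ≤ B ^ 8 := by
                  rw [hP, Finset.card_product]; push_cast
                  have := card_PF_le_pow hB0
                  calc _ ≤ B ^ 4 * B ^ 4 := by gcongr
                    _ = _ := by ring
                gcongr
  · have e : P.filter (fun p => ¬ gr p.1 p.2 ≠ 0) = P.filter (fun p => gr p.1 p.2 = 0) :=
      Finset.filter_congr fun p _ => not_not
    rw [e]
    calc _ ≤ ∑ p ∈ P.filter (fun p => gr p.1 p.2 = 0),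
          (∑ a ∈ shl ρ ((1 + η) * ρ), ee p.1 a * ee p.2 a + 162 * (α * W) ^ 2 * ρ ^ 2) := by
          refine Finset.sum_le_sum fun p hp => ?_
          have hp' := Finset.mem_product.mp (Finset.mem_filter.mp hp).1
          exact ssum_le_of_dependent (PF_ne_zero hB0 hp'.1) (PF_ne_zero hB0 hp'.2) hα hW hρ hη hη1
      _ ≤ _ := by
          rw [Finset.sum_add_distrib, Finset.sum_const, nsmul_eq_mul]
          refine add_le_add le_rfl ?_
          have := card_dependent_le hB
          calc _ ≤ 2 * B ^ 4 * (162 * (α * W) ^ 2 * ρ ^ 2) := by gcongr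
            _ = _ := by ring

theorem bl_subset {r r' : ℝ} (hr : 0 ≤ r) (h : r ≤ r') : bl r ⊆ bl r' := fun a ha => by
  rw [mem_bl_iff_vn hr] at ha
  rw [mem_bl_iff_vn (hr.trans h)]
  exact ha.trans h

theorem sum_bl_eq (F : (Fin 4 → ℤ) → ℝ) {Q η : ℝ} (hQ : 0 < Q) (hη : 0 < η) (K : ℕ) :
    ∑ a ∈ bl (Q * (1 + η) ^ K), F a = ∑ a ∈ bl Q, F a +
      ∑ k ∈ Finset.range K, ∑ a ∈ shl (Q * (1 + η) ^ k) ((1 + η) * (Q * (1 + η) ^ k)), F a := by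
  induction K with
  | zero => simp
  | succ K ih =>
    rw [Finset.sum_range_succ, ← add_assoc, ← ih]
    have e : Q * (1 + η) ^ (K + 1) = (1 + η) * (Q * (1 + η) ^ K) := by ring
    rw [e, shl]
    have h1 : 0 < Q * (1 + η) ^ K := by positivity
    have h2 : Q * (1 + η) ^ K ≤ (1 + η) * (Q * (1 + η) ^ K) := by nlinarith
    have h3 := Finset.sum_sdiff (f := F) (bl_subset h1.le h2)
    linarith

theorem sum_shell_terms (f r s q : ℕ → ℝ) (P M c b d : ℝ) (n : ℕ) :
    ∑ k ∈ Finset.range n, (P * f k * M + 12 * (24 * r k * c + 2 * b) + (s k + d * q k)) =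
      P * (∑ k ∈ Finset.range n, f k) * M + (288 * (∑ k ∈ Finset.range n, r k) * c + 24 * b * n) +
      (∑ k ∈ Finset.range n, s k + d * ∑ k ∈ Finset.range n, q k) := by
  induction n with
  | zero => simp
  | succ n ih =>
    simp only [Finset.sum_range_succ, ih, Nat.cast_succ]
    ring

set_option maxHeartbeats 1000000 in
open Classical in
/-- The variance over a ball, by decomposition in shells. -/
theorem sum_bl_dv_le {α T A B : ℝ} {W : ℤ} (hB : 1 ≤ B) (hα : 0 < α) (hW : 0 < W) (hT : 8 ≤ T)
    (hαW : α * W ≤ T ^ 2) (hA : T ^ 3 ≤ A) (hBA : B ≤ A) :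
    ∑ a ∈ bl A, dv α W B a ≤
      81 * T ^ 12 * (B ^ 4 * (1 + α * W)) ^ 2 +
      4 * Real.pi * A ^ 2 * (12 / T * ∑ p ∈ (PF B ×ˢ PF B).filter (fun p => gr p.1 p.2 ≠ 0), mu p.1 p.2 +
          3 * ∑ p ∈ (PF B ×ˢ PF B).filter (fun p => gr p.1 p.2 ≠ 0 ∧ Unbal α W p.1 p.2),
            mu p.1 p.2) +
      24 * (A * T) * (26 * B ^ 8 / T ^ 3 + 24 * 81 * T ^ 12 * B ^ 6) +
      (576 * A ^ 3 * ∑ x ∈ PF B, 1 / vn x + 216 * A ^ 3 * B ^ 2) +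
      1296 * B ^ 4 * (α * W) ^ 2 * (A ^ 2 * T) := by
  have hT0 : 0 < T := by linarith
  have hW' : (0 : ℝ) < W := by exact_mod_cast hW
  set Q := T ^ 3 with hQ
  have hQ0 : 0 < Q := by positivity
  have hT1 : 1 ≤ T := by linarith
  have hQ1 : 1 ≤ Q := one_le_pow₀ hT1
  have hA0 : 0 < A := by linarith
  set η := 1 / T with hη
  have hη0 : 0 < η := by positivity
  have hη1 : η ≤ 1 / 8 := one_div_le_one_div_of_le (by norm_num) hT
  obtain ⟨n, hn1, hn2⟩ := exists_nat_pow_near (x := A / Q) (y := 1 + η) (by rwa [one_le_div hQ0]) (by linarith)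
  set K := n + 1 with hK
  set ρ : ℕ → ℝ := fun k => Q * (1 + η) ^ k with hρ
  have hAK : A ≤ ρ K := by
    rw [div_lt_iff₀ hQ0] at hn2
    simp only [hρ]; linarith
  have hKA : ρ K ≤ 2 * A := by
    rw [le_div_iff₀ hQ0] at hn1
    simp only [hρ, hK, pow_succ]
    have h1 : Q * ((1 + η) ^ n * (1 + η)) = ((1 + η) ^ n * Q) * (1 + η) := by ring
    rw [h1]
    calc _ ≤ A * (1 + η) := by gcongr
      _ ≤ _ := by nlinarith
  have hρQ : ∀ k, Q ≤ ρ k := fun k => by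
    have : 1 ≤ (1 + η) ^ k := one_le_pow₀ (by linarith)
    simp only [hρ]; nlinarith
  have hs1 : ∑ k ∈ Finset.range K, ρ k ≤ 2 * (A * T) := by
    have h : ∀ m : ℕ, η * ∑ k ∈ Finset.range m, ρ k = ρ m - Q := fun m => by
      induction m with
      | zero => simp [hρ]
      | succ m ih => rw [Finset.sum_range_succ, mul_add, ih]; simp only [hρ, pow_succ]; ring
    have h1 := h K
    rw [hη, one_div, inv_mul_eq_div, div_eq_iff hT0.ne'] at h1
    rw [h1]
    nlinarith
  have hs2 : ∑ k ∈ Finset.range K, ((1 + η) ^ 2 - 1) * ρ k ^ 2 ≤ 4 * A ^ 2 := by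
    have h : ∀ m : ℕ, ∑ k ∈ Finset.range m, ((1 + η) ^ 2 - 1) * ρ k ^ 2 = ρ m ^ 2 - Q ^ 2 := fun m => by
      induction m with
      | zero => simp [hρ]
      | succ m ih => rw [Finset.sum_range_succ, ih]; simp only [hρ, pow_succ]; ring
    rw [h K]
    have h1 := hρQ K
    have h2 : ρ K ^ 2 ≤ (2 * A) ^ 2 := by gcongr
    nlinarith [sq_nonneg Q]
  have hs3 : ∑ k ∈ Finset.range K, ρ k ^ 2 ≤ 4 * (A ^ 2 * T) := by
    have h1 : η * ∑ k ∈ Finset.range K, ρ k ^ 2 ≤ 4 * A ^ 2 := by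
      refine le_trans ?_ hs2
      rw [Finset.mul_sum]
      refine Finset.sum_le_sum fun k _ => mul_le_mul_of_nonneg_right (by nlinarith) (sq_nonneg _)
    rw [hη, one_div, inv_mul_eq_div, div_le_iff₀ hT0] at h1
    linarith
  have hs4 : (K : ℝ) ≤ 2 * (A * T) / Q := by
    rw [le_div_iff₀ hQ0]
    refine le_trans ?_ hs1
    calc (K : ℝ) * Q = ∑ k ∈ Finset.range K, Q := by simp
      _ ≤ _ := Finset.sum_le_sum fun k _ => hρQ k
  set M1 := ∑ p ∈ (PF B ×ˢ PF B).filter (fun p => gr p.1 p.2 ≠ 0), mu p.1 p.2 with hM1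
  set M2 := ∑ p ∈ (PF B ×ˢ PF B).filter (fun p => gr p.1 p.2 ≠ 0 ∧ Unbal α W p.1 p.2), mu p.1 p.2 with hM2
  have hM1' : 0 ≤ M1 := Finset.sum_nonneg fun p _ => mu_nonneg _ _
  have hM2' : 0 ≤ M2 := Finset.sum_nonneg fun p _ => mu_nonneg _ _
  set S := (PF B ×ˢ PF B).filter (fun p => gr p.1 p.2 = 0) with hS
  have hball : ∑ a ∈ bl Q, dv α W B a ≤ 81 * T ^ 12 * (B ^ 4 * (1 + α * W)) ^ 2 := by
    calc _ ≤ ∑ a ∈ bl Q, (B ^ 4 * (1 + α * W)) ^ 2 :=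
          Finset.sum_le_sum fun a _ => dv_le hα.le hW.le (by linarith) a
      _ = (bl Q).card * (B ^ 4 * (1 + α * W)) ^ 2 := by rw [Finset.sum_const, nsmul_eq_mul]
      _ ≤ 81 * Q ^ 4 * (B ^ 4 * (1 + α * W)) ^ 2 := by
          have := card_bl_le hQ1
          gcongr
      _ = _ := by rw [hQ]; ring
  have hdep : ∑ k ∈ Finset.range K, ∑ p ∈ S, ∑ a ∈ shl (ρ k) ((1 + η) * ρ k), ee p.1 a * ee p.2 a ≤
      576 * A ^ 3 * ∑ x ∈ PF B, 1 / vn x + 216 * A ^ 3 * B ^ 2 := by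
    have h1 : ∑ k ∈ Finset.range K, ∑ p ∈ S, ∑ a ∈ shl (ρ k) ((1 + η) * ρ k), ee p.1 a * ee p.2 a ≤
        ∑ p ∈ S, ∑ a ∈ bl (ρ K), ee p.1 a * ee p.2 a := by
      rw [Finset.sum_comm]
      refine Finset.sum_le_sum fun p _ => ?_
      have := sum_bl_eq (fun a => ee p.1 a * ee p.2 a) hQ0 hη0 K
      rw [this]
      have : 0 ≤ ∑ a ∈ bl Q, ee p.1 a * ee p.2 a :=
        Finset.sum_nonneg fun a _ => mul_nonneg (ee_nonneg _ a) (ee_nonneg _ a)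
      linarith
    refine h1.trans ((sum_dependent_ee_le hB (hBA.trans hAK)).trans ?_)
    have h2 : ρ K ^ 3 ≤ (2 * A) ^ 3 := by gcongr
    have h3 : 0 ≤ ∑ x ∈ PF B, 1 / vn x := Finset.sum_nonneg fun x _ => by
      have := vn_nonneg x; positivity
    calc _ ≤ 72 * (2 * A) ^ 3 * ∑ x ∈ PF B, 1 / vn x + 27 * (2 * A) ^ 3 * B ^ 2 := by gcongr
      _ = _ := by ring
  have hshell : ∑ k ∈ Finset.range K, ∑ a ∈ shl (ρ k) ((1 + η) * ρ k), dv α W B a ≤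
      ∑ k ∈ Finset.range K, (Real.pi * (((1 + η) ^ 2 - 1) * ρ k ^ 2) * (12 * η * M1 + 3 * M2) +
      12 * (24 * ρ k * (B ^ 8 / Q + 81 * Q ^ 4 * B ^ 6) + 2 * B ^ 8) +
      (∑ p ∈ S, ∑ a ∈ shl (ρ k) ((1 + η) * ρ k), ee p.1 a * ee p.2 a +
        324 * B ^ 4 * (α * W) ^ 2 * ρ k ^ 2)) := by
    refine Finset.sum_le_sum fun k _ => ?_
    refine sum_shl_dv_le hB hα hW (hQ1.trans (hρQ k)) hη0 hη1 ?_ hQ1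
    calc α * W ≤ T ^ 2 := hαW
      _ = η * Q := by rw [hη, hQ]; field_simp
      _ ≤ _ := by have := hρQ k; gcongr
  have hsum : ∑ k ∈ Finset.range K, (Real.pi * (((1 + η) ^ 2 - 1) * ρ k ^ 2) * (12 * η * M1 + 3 * M2) +
      12 * (24 * ρ k * (B ^ 8 / Q + 81 * Q ^ 4 * B ^ 6) + 2 * B ^ 8) +
      (∑ p ∈ S, ∑ a ∈ shl (ρ k) ((1 + η) * ρ k), ee p.1 a * ee p.2 a +
        324 * B ^ 4 * (α * W) ^ 2 * ρ k ^ 2)) =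
      Real.pi * (∑ k ∈ Finset.range K, ((1 + η) ^ 2 - 1) * ρ k ^ 2) * (12 * η * M1 + 3 * M2) +
      (288 * (∑ k ∈ Finset.range K, ρ k) * (B ^ 8 / Q + 81 * Q ^ 4 * B ^ 6) + 24 * B ^ 8 * K) +
      (∑ k ∈ Finset.range K, ∑ p ∈ S, ∑ a ∈ shl (ρ k) ((1 + η) * ρ k), ee p.1 a * ee p.2 a +
        324 * B ^ 4 * (α * W) ^ 2 * ∑ k ∈ Finset.range K, ρ k ^ 2) := by
    exact sum_shell_terms (fun k => ((1 + η) ^ 2 - 1) * ρ k ^ 2) ρ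
      (fun k => ∑ p ∈ S, ∑ a ∈ shl (ρ k) ((1 + η) * ρ k), ee p.1 a * ee p.2 a) (fun k => ρ k ^ 2)
      Real.pi (12 * η * M1 + 3 * M2) (B ^ 8 / Q + 81 * Q ^ 4 * B ^ 6) (B ^ 8)
      (324 * B ^ 4 * (α * W) ^ 2) K
  have htot : ∑ a ∈ bl A, dv α W B a ≤ ∑ a ∈ bl (ρ K), dv α W B a :=
    Finset.sum_le_sum_of_subset_of_nonneg (bl_subset hA0.le hAK) fun a _ _ => dv_nonneg _ _ _ a
  have hpi := Real.pi_pos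
  have e1 : Real.pi * (∑ k ∈ Finset.range K, ((1 + η) ^ 2 - 1) * ρ k ^ 2) * (12 * η * M1 + 3 * M2) ≤
      4 * Real.pi * A ^ 2 * (12 / T * M1 + 3 * M2) := by
    calc _ ≤ Real.pi * (4 * A ^ 2) * (12 * η * M1 + 3 * M2) := by gcongr
      _ = _ := by rw [hη]; ring
  have e2 : 288 * (∑ k ∈ Finset.range K, ρ k) * (B ^ 8 / Q + 81 * Q ^ 4 * B ^ 6) + 24 * B ^ 8 * K ≤
      24 * (A * T) * (26 * B ^ 8 / T ^ 3 + 24 * 81 * T ^ 12 * B ^ 6) := by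
    calc _ ≤ 288 * (2 * (A * T)) * (B ^ 8 / Q + 81 * Q ^ 4 * B ^ 6) + 24 * B ^ 8 * (2 * (A * T) / Q) := by
          gcongr
      _ = _ := by rw [hQ]; ring
  have e3 : 324 * B ^ 4 * (α * W) ^ 2 * ∑ k ∈ Finset.range K, ρ k ^ 2 ≤
      1296 * B ^ 4 * (α * W) ^ 2 * (A ^ 2 * T) := by
    calc _ ≤ 324 * B ^ 4 * (α * W) ^ 2 * (4 * (A ^ 2 * T)) := by gcongr
      _ = _ := by ring
  have hbl := sum_bl_eq (dv α W B) hQ0 hη0 K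
  have hbl' : ∑ a ∈ bl (ρ K), dv α W B a = ∑ a ∈ bl Q, dv α W B a +
      ∑ k ∈ Finset.range K, ∑ a ∈ shl (ρ k) ((1 + η) * ρ k), dv α W B a := hbl
  linarith

/-- Natural-number quadruples as integer quadruples. -/
def castQ (x : Fin 4 → ℕ) : Fin 4 → ℤ := fun i => (x i : ℤ)

theorem castQ_injective : Function.Injective castQ := fun x y h => by
  funext i
  have := congrFun h i
  simpa [castQ] using this

theorem image_castQ_PP {B : ℝ} (hB : 0 ≤ B) (P : (Fin 4 → ℤ) → Prop) [DecidablePred P] :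
    castQ '' {x | x ∈ PP B ∧ P (castQ x)} = ↑((PF B).filter P) := by
  ext y
  simp only [Set.mem_image, Set.mem_ofPred_eq, Finset.coe_filter, mem_PF]
  constructor
  · rintro ⟨x, ⟨h1, h2⟩, rfl⟩
    exact ⟨fun i => (mem_prz hB).mpr ⟨x i, (h1 i).1, (h1 i).2, rfl⟩, h2⟩
  · rintro ⟨h1, h2⟩
    choose q hq using fun i => (mem_prz hB).mp (h1 i)
    have e : castQ q = y := by funext i; exact (hq i).2.2.symm
    exact ⟨q, ⟨fun i => ⟨(hq i).1, (hq i).2.1⟩, by rwa [e]⟩, e⟩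

theorem znorm_eq_vn (a : Fin 4 → ℤ) : znorm a = vn a := by
  rw [znorm, vn, ip_eq_sum]
  congr 1
  push_cast
  exact Finset.sum_congr rfl fun i _ => by ring

theorem pnorm_eq_vn (x : Fin 4 → ℕ) : pnorm x = vn (castQ x) := by
  rw [pnorm, vn, ip_eq_sum]
  congr 1
  push_cast [castQ]
  exact Finset.sum_congr rfl fun i _ => by ring

theorem sum_mul_castQ (a : Fin 4 → ℤ) (x : Fin 4 → ℕ) : ∑ i, a i * (x i : ℤ) = ip (castQ x) a := by
  rw [ip_eq_sum]
  exact Finset.sum_congr rfl fun i _ => mul_comm _ _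

theorem sum_mul_castQ_real (a : Fin 4 → ℤ) (x : Fin 4 → ℕ) :
    ∑ i, (x i : ℝ) * (a i : ℝ) = ((ip (castQ x) a : ℤ) : ℝ) := by
  rw [ip_eq_sum]
  push_cast [castQ]
  rfl

theorem NB_eq {B : ℝ} (hB : 0 ≤ B) (a : Fin 4 → ℤ) :
    NB a B = Real.log B ^ 4 * ∑ x ∈ PF B, ee x a := by
  classical
  have h := image_castQ_PP hB (fun x => ip x a = 0)
  rw [NB]
  congr 1
  simp only [sum_mul_castQ]
  rw [← Set.ncard_image_of_injective _ castQ_injective, h, Set.ncard_coe_finset]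
  simp only [ee, Finset.sum_boole]

theorem NlocB_eq {B : ℝ} (hB : 0 ≤ B) (a : Fin 4 → ℤ) :
    NlocB a B = Real.log B ^ 4 * ∑ x ∈ PF B, ff (Real.log B) (WB B) x a := by
  classical
  have h := image_castQ_PP hB (fun x => (WB B : ℤ) ∣ ip x a ∧
    |((ip x a : ℤ) : ℝ)| ≤ vn x * vn a / (2 * Real.log B))
  rw [NlocB]
  simp only [sum_mul_castQ, sum_mul_castQ_real, pnorm_eq_vn, znorm_eq_vn]
  rw [← finsum_mem_image (f := fun y => 1 / vn y) (castQ_injective.injOn), h, finsum_mem_coe_finset,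
    mul_assoc, Finset.mul_sum, Finset.sum_filter]
  congr 1
  refine Finset.sum_congr rfl fun x _ => ?_
  simp only [ff]
  split_ifs
  · push_cast
    rw [div_mul_div_comm, mul_one]
  · rfl

theorem sq_abs_sub_eq {B : ℝ} (hB : 0 ≤ B) (a : Fin 4 → ℤ) :
    |NB a B - NlocB a B| ^ 2 = Real.log B ^ 8 * dv (Real.log B) (WB B) B a := by
  rw [NB_eq hB, NlocB_eq hB, ← mul_sub, ← Finset.sum_sub_distrib, sq_abs, mul_pow, dv]
  ring

theorem finsum_primA_le {A B : ℝ} (hA : 0 ≤ A) (hB : 0 ≤ B) :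
    ∑ᶠ a ∈ primA A, |NB a B - NlocB a B| ^ 2 ≤
      Real.log B ^ 8 * ∑ a ∈ bl A, dv (Real.log B) (WB B) B a := by
  classical
  have h : primA A = ↑((bl A).filter fun a => Finset.univ.gcd a = 1) := by
    ext a
    rw [primA, Set.mem_ofPred_eq, Finset.coe_filter, Set.mem_ofPred_eq, mem_bl_iff_vn hA, znorm_eq_vn,
      and_comm]
  rw [h, finsum_mem_coe_finset, Finset.mul_sum]
  calc _ = ∑ a ∈ (bl A).filter (fun a => Finset.univ.gcd a = 1),
        Real.log B ^ 8 * dv (Real.log B) (WB B) B a :=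
        Finset.sum_congr rfl fun a _ => sq_abs_sub_eq hB a
    _ ≤ _ := Finset.sum_le_sum_of_subset_of_nonneg (Finset.filter_subset _ _) fun a _ _ =>
        mul_nonneg (by positivity) (dv_nonneg _ _ _ _)

theorem sum_mu_PF_le {B Y : ℝ} (hB : 2 ≤ B) (hα : 2 ≤ Real.log B) (hY : 0 ≤ Y)
    (S : Finset ((Fin 4 → ℤ) × (Fin 4 → ℤ))) (hS : S ⊆ PF B ×ˢ PF B)
    (hg : ∀ p ∈ S, gr p.1 p.2 ≠ 0 ∧ sg p.1 p.2 ≤ gm p.1 p.2 * (B ^ 2 * Y)) :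
    ∑ p ∈ S, mu p.1 p.2 ≤ 5184 * 16 * 6 ^ 8 * B ^ 6 * Real.log B ^ 8 * Y := by
  have hB0 : 0 ≤ B := by linarith
  have h := sum_mu_le (Z := 2 * B) (X := B ^ 2 * Y) (by linarith) (by positivity) S
    fun p hp => ⟨(hg p hp).1, PF_vn_le hB0 (Finset.mem_product.mp (hS hp)).1,
      PF_vn_le hB0 (Finset.mem_product.mp (hS hp)).2, (hg p hp).2⟩
  have h4 : Real.log (2 * (2 * B)) = 2 * Real.log 2 + Real.log B := by
    rw [Real.log_mul (by norm_num) (by positivity), Real.log_mul (by norm_num) (by positivity)]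
    ring
  have h5 : 0 ≤ Real.log (2 * (2 * B)) := Real.log_nonneg (by linarith)
  have h6 := Real.log_two_lt_d9
  refine h.trans ?_
  calc _ ≤ 5184 * (2 * B) ^ 4 * (B ^ 2 * Y) * (6 * Real.log B) ^ 8 := by
        gcongr
        linarith
    _ = _ := by ring

theorem sum_mu_all_le {B : ℝ} (hB : 2 ≤ B) (hα : 2 ≤ Real.log B) :
    ∑ p ∈ (PF B ×ˢ PF B).filter (fun p => gr p.1 p.2 ≠ 0), mu p.1 p.2 ≤
      5184 * 64 * 6 ^ 8 * B ^ 6 * Real.log B ^ 8 := by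
  have hB0 : 0 ≤ B := by linarith
  refine (sum_mu_PF_le hB hα (Y := 4) (by norm_num) _ (Finset.filter_subset _ _) fun p hp => ?_).trans
    (le_of_eq (by ring))
  obtain ⟨h1, h2⟩ := Finset.mem_filter.mp hp
  obtain ⟨h3, h4⟩ := Finset.mem_product.mp h1
  have h5 : (1 : ℝ) ≤ gm p.1 p.2 := by
    exact_mod_cast gm_pos (lt_of_le_of_ne (gr_nonneg p.1 p.2) (Ne.symm h2))
  refine ⟨h2, (sg_le_vn_mul p.1 p.2).trans ?_⟩
  calc _ ≤ (2 * B) * (2 * B) :=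
        mul_le_mul (PF_vn_le hB0 h3) (PF_vn_le hB0 h4) (vn_nonneg _) (by linarith)
    _ = 1 * (B ^ 2 * 4) := by ring
    _ ≤ _ := by gcongr

open Classical in
theorem exists_sum_unbal_le : ∃ K : ℝ, 0 < K ∧ ∀ (B L w : ℝ) (W : ℤ), 2 ≤ B → 1 ≤ L → 0 < w →
    2 ≤ Real.log B → 16 * L ^ 2 < B → √B * Real.log B ≤ (B / (16 * L ^ 2)) ^ (11 / 12 : ℝ) →
    (∀ n : ℤ, 0 < n → (n : ℝ) ≤ w → n ∣ W) →
    ∑ p ∈ (PF B ×ˢ PF B).filter (fun p => gr p.1 p.2 ≠ 0 ∧ Unbal (Real.log B) W p.1 p.2),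
      mu p.1 p.2 ≤ K * (B ^ 6 / Real.log B ^ 8) * (w ^ (-(1 / 4) : ℝ) + w / Real.log B) +
        5184 * 16 * 6 ^ 8 * B ^ 6 * Real.log B ^ 8 * (1 / L) := by
  obtain ⟨K, hK, h⟩ := exists_sum_bad_pairs_le
  refine ⟨K, hK, fun B L w W hB hL hw hα h16 hs hW => ?_⟩
  rw [← Finset.sum_filter_add_sum_filter_not _ (fun p : (Fin 4 → ℤ) × (Fin 4 → ℤ) =>
    gm p.1 p.2 * B ^ 2 < L * sg p.1 p.2)]
  refine add_le_add (h B L w hB hL hw hα h16 hs _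
    ((Finset.filter_subset _ _).trans (Finset.filter_subset _ _)) fun p hp => ?_)
    (sum_mu_PF_le hB hα (by positivity) _
    ((Finset.filter_subset _ _).trans (Finset.filter_subset _ _)) fun p hp => ?_)
  · obtain ⟨h1, h2⟩ := Finset.mem_filter.mp hp
    obtain ⟨-, h3, h4⟩ := Finset.mem_filter.mp h1
    refine ⟨h3, h2, ?_⟩
    by_contra! hc
    have hg := gm_pos (lt_of_le_of_ne (gr_nonneg p.1 p.2) (Ne.symm h3))
    exact h4 ⟨hW _ hg hc.1, hc.2⟩
  · obtain ⟨h1, h2⟩ := Finset.mem_filter.mp hp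
    obtain ⟨-, h3, h4⟩ := Finset.mem_filter.mp h1
    refine ⟨h3, ?_⟩
    have hL0 : 0 < L := by linarith
    rw [not_lt] at h2
    rw [mul_one_div, mul_div_assoc', le_div_iff₀ hL0, mul_comm]
    exact h2

theorem mem_filter_range_of_le {w : ℝ} {p : ℕ} (hp : p.Prime) (h : (p : ℝ) ≤ w) :
    p ∈ Finset.filter Nat.Prime (Finset.range (⌊w⌋₊ + 1)) :=
  Finset.mem_filter.mpr ⟨Finset.mem_range.mpr (Nat.lt_succ_of_le (Nat.le_floor h)), hp⟩

theorem nat_dvd_WB {B : ℝ} {n : ℕ} (hn : 0 < n) (h : (n : ℝ) ≤ wB B) : n ∣ WB B := by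
  rw [Nat.dvd_iff_prime_pow_dvd_dvd]
  intro p k hp hk
  rcases Nat.eq_zero_or_pos k with rfl | hk0
  · simp
  have h1 : ((p ^ k : ℕ) : ℝ) ≤ wB B := le_trans (by exact_mod_cast Nat.le_of_dvd hn hk) h
  have hp1 : (1 : ℝ) < p := by exact_mod_cast hp.one_lt
  have h2 : (p : ℝ) ≤ wB B := le_trans (by exact_mod_cast Nat.le_self_pow hk0.ne' p) h1
  have h3 : (k : ℝ) ≤ Real.log (wB B) / Real.log p := by
    rw [le_div_iff₀ (Real.log_pos hp1), ← Real.log_pow]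
    push_cast at h1
    exact Real.log_le_log (by positivity) h1
  have h4 : k ≤ ⌈Real.log (wB B) / Real.log (p : ℝ)⌉₊ := by
    exact_mod_cast h3.trans (Nat.le_ceil _)
  exact (pow_dvd_pow p (h4.trans (Nat.le_succ _))).trans
    (Finset.dvd_prod_of_mem (fun q : ℕ => q ^ (⌈Real.log (wB B) / Real.log (q : ℝ)⌉₊ + 1))
      (mem_filter_range_of_le hp h2))

theorem int_dvd_WB {B : ℝ} {n : ℤ} (hn : 0 < n) (h : (n : ℝ) ≤ wB B) : n ∣ (WB B : ℤ) := by
  lift n to ℕ using hn.le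
  exact Int.natCast_dvd_natCast.mpr (nat_dvd_WB (by exact_mod_cast hn) (by exact_mod_cast h))

theorem WB_pos (B : ℝ) : 0 < WB B :=
  Finset.prod_pos fun _ hp => pow_pos (Finset.mem_filter.mp hp).2.pos _

theorem WB_le {B M : ℝ} (hM : 1 ≤ M) (h : wB B ≤ M) : (WB B : ℝ) ≤ M ^ (3 * M) := by
  have hM0 : 0 < M := by linarith
  rw [WB]
  push_cast
  have h1 : ∀ p ∈ Finset.filter Nat.Prime (Finset.range (⌊wB B⌋₊ + 1)),
      (p : ℝ) ^ (⌈Real.log (wB B) / Real.log (p : ℝ)⌉₊ + 1) ≤ M ^ 3 := by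
    intro p hp
    obtain ⟨h2, hp⟩ := Finset.mem_filter.mp hp
    have h3 : p ≤ ⌊wB B⌋₊ := Nat.lt_succ_iff.mp (Finset.mem_range.mp h2)
    have h4 : (p : ℝ) ≤ wB B := (Nat.le_floor_iff' hp.pos.ne').mp h3
    have hp1 : (1 : ℝ) < p := by exact_mod_cast hp.one_lt
    have hw0 : 0 < wB B := by linarith
    have hl := Real.log_pos hp1
    have h5 : 0 ≤ Real.log (wB B) / Real.log (p : ℝ) :=
      div_nonneg (Real.log_nonneg (by linarith)) hl.le
    rw [← Real.rpow_natCast]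
    calc (p : ℝ) ^ ((⌈Real.log (wB B) / Real.log (p : ℝ)⌉₊ + 1 : ℕ) : ℝ)
        ≤ (p : ℝ) ^ (Real.log (wB B) / Real.log (p : ℝ) + 2) := by
          refine Real.rpow_le_rpow_of_exponent_le hp1.le ?_
          push_cast
          linarith [(Nat.ceil_lt_add_one h5).le]
      _ = wB B * (p : ℝ) ^ 2 := by
          rw [Real.rpow_add (by linarith), Real.rpow_two, Real.rpow_def_of_pos (by linarith : (0 : ℝ) < p),
            mul_div_cancel₀ _ hl.ne', Real.exp_log hw0]
      _ ≤ M * M ^ 2 := by gcongr; exact h4.trans h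
      _ = M ^ 3 := by ring
  refine (Finset.prod_le_prod (fun _ _ => by positivity) h1).trans ?_
  rw [Finset.prod_const, ← Real.rpow_natCast, ← Real.rpow_natCast, ← Real.rpow_mul hM0.le]
  refine Real.rpow_le_rpow_of_exponent_le hM ?_
  have h2 : (Finset.filter Nat.Prime (Finset.range (⌊wB B⌋₊ + 1))).card ≤ ⌊wB B⌋₊ := by
    calc _ ≤ (Finset.Icc 1 ⌊wB B⌋₊).card := by
          refine Finset.card_le_card fun p hp => ?_
          obtain ⟨h2, hp⟩ := Finset.mem_filter.mp hp
          exact Finset.mem_Icc.mpr ⟨hp.pos, Nat.lt_succ_iff.mp (Finset.mem_range.mp h2)⟩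
      _ = _ := by simp
  have h3 : ((Finset.filter Nat.Prime (Finset.range (⌊wB B⌋₊ + 1))).card : ℝ) ≤ M := by
    rcases le_or_gt 0 (wB B) with h4 | h4
    · exact le_trans (by exact_mod_cast h2) ((Nat.floor_le h4).trans h)
    · rw [Nat.floor_of_nonpos h4.le] at h2 ⊢
      have : (Finset.filter Nat.Prime (Finset.range (0 + 1))).card = 0 := Nat.le_zero.mp h2
      rw [this]; simpa using hM0.le
  push_cast
  linarith

theorem wB_bounds {B : ℝ} (hα : 0 < Real.log B) (h : Real.exp 1 ≤ Real.log (Real.log B)) :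
    √(Real.log (Real.log B)) / 2 ≤ wB B ∧ wB B ≤ Real.log (Real.log B) ∧
      (WB B : ℝ) ≤ Real.log B ^ 3 := by
  have hw : wB B = Real.log (Real.log B) / Real.log (Real.log (Real.log B)) := rfl
  set l := Real.log (Real.log B) with hl
  have hl0 : 0 < l := (Real.exp_pos 1).trans_le h
  have h3 : 1 ≤ Real.log l := (Real.le_log_iff_exp_le hl0).mpr h
  have h3' : 0 < Real.log l := by linarith
  have h1 : 1 ≤ wB B := by
    rw [hw, one_le_div h3']
    linarith [Real.log_le_sub_one_of_pos hl0]
  have h2 : wB B ≤ l := by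
    rw [hw]
    exact div_le_self hl0.le h3
  refine ⟨?_, h2, ?_⟩
  · have h4 : Real.log l ≤ 2 * √l := by
      have h5 := Real.log_le_sub_one_of_pos (Real.sqrt_pos.mpr hl0)
      rw [Real.log_sqrt hl0.le] at h5
      linarith
    rw [hw, div_le_div_iff₀ (by norm_num) h3']
    calc √l * Real.log l ≤ √l * (2 * √l) := by gcongr
      _ = l * 2 := by rw [mul_left_comm, Real.mul_self_sqrt hl0.le, mul_comm]
  · have h5 := WB_le h1 le_rfl
    have hw0 : 0 < wB B := by linarith
    have h6 : wB B * Real.log (wB B) ≤ l := by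
      calc _ ≤ wB B * Real.log l := by gcongr
        _ = l := by rw [hw]; exact div_mul_cancel₀ _ h3'.ne'
    refine h5.trans ?_
    have e : Real.log B ^ 3 = Real.exp (l * 3) := by
      rw [← Real.exp_log hα, ← hl, ← Real.exp_nat_mul]
      norm_num [mul_comm]
    rw [Real.rpow_def_of_pos hw0, e, Real.exp_le_exp]
    nlinarith

theorem size_cond {T B α L : ℝ} (hα : 2 ≤ α) (hT : α ^ 100 ≤ T) (hB : B = T ^ 20) (hL : L = α ^ 20) :
    16 * L ^ 2 < B ∧ √B * α ≤ (B / (16 * L ^ 2)) ^ (11 / 12 : ℝ) := by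
  have hα1 : 1 ≤ α := by linarith
  have hT1 : 1 ≤ T := (one_le_pow₀ hα1).trans hT
  have h16 : 16 * L ^ 2 ≤ T := by
    calc 16 * L ^ 2 = 2 ^ 4 * α ^ 40 := by rw [hL]; ring
      _ ≤ α ^ 4 * α ^ 40 := by gcongr
      _ = α ^ 44 := by ring
      _ ≤ α ^ 100 := pow_le_pow_right₀ hα1 (by norm_num)
      _ ≤ T := hT
  have hT2 : 2 ≤ T := by
    calc (2 : ℝ) ≤ α ^ 1 := by simpa
      _ ≤ α ^ 100 := pow_le_pow_right₀ hα1 (by norm_num)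
      _ ≤ T := hT
  have hL0 : 0 < 16 * L ^ 2 := by rw [hL]; positivity
  constructor
  · calc 16 * L ^ 2 ≤ T := h16
      _ < T ^ 20 := by
        have : T ^ 1 < T ^ 20 := pow_lt_pow_right₀ (by linarith) (by norm_num)
        simpa using this
      _ = B := hB.symm
  · have hs : √B = T ^ 10 := by
      rw [hB, show T ^ 20 = (T ^ 10) ^ 2 by ring]
      exact Real.sqrt_sq (by positivity)
    have hαT : α ≤ T := by
      calc α = α ^ 1 := by simp
        _ ≤ α ^ 100 := pow_le_pow_right₀ hα1 (by norm_num)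
        _ ≤ T := hT
    have h1 : T ^ 19 ≤ B / (16 * L ^ 2) := by
      rw [le_div_iff₀ hL0, hB]
      calc T ^ 19 * (16 * L ^ 2) ≤ T ^ 19 * T := by gcongr
        _ = T ^ 20 := by ring
    calc √B * α ≤ T ^ 10 * T := by rw [hs]; gcongr
      _ = T ^ (11 : ℝ) := by rw [← pow_succ]; exact_mod_cast (Real.rpow_natCast T 11).symm
      _ ≤ T ^ ((19 : ℝ) * (11 / 12)) := Real.rpow_le_rpow_of_exponent_le hT1 (by norm_num)
      _ = (T ^ 19) ^ (11 / 12 : ℝ) := by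
        rw [Real.rpow_mul (by linarith)]
        congr 1
        exact_mod_cast Real.rpow_natCast T 19
      _ ≤ _ := by gcongr

theorem rpow_bounds {l α w : ℝ} (hl : 1 ≤ l) (hα : α = Real.exp l) (hw : √l / 2 ≤ w) (hw2 : w ≤ l) :
    1 / l ≤ l ^ (-(1 / 8) : ℝ) ∧ w ^ (-(1 / 4) : ℝ) + w / α ≤ 4 * l ^ (-(1 / 8) : ℝ) := by
  have hl0 : 0 < l := by linarith
  have h1 : 1 / l ≤ l ^ (-(1 / 8) : ℝ) := by
    rw [one_div, ← Real.rpow_neg_one]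
    exact Real.rpow_le_rpow_of_exponent_le hl (by norm_num)
  refine ⟨h1, ?_⟩
  have h2 : w ^ (-(1 / 4) : ℝ) ≤ 2 * l ^ (-(1 / 8) : ℝ) := by
    have h0 : 0 < √l / 2 := by positivity
    calc w ^ (-(1 / 4) : ℝ) ≤ (√l / 2) ^ (-(1 / 4) : ℝ) :=
          Real.rpow_le_rpow_of_nonpos h0 hw (by norm_num)
      _ = (1 / 2 : ℝ) ^ (-(1 / 4) : ℝ) * l ^ (-(1 / 8) : ℝ) := by
          rw [div_eq_mul_one_div, mul_comm, Real.mul_rpow (by norm_num) (Real.sqrt_nonneg _),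
            Real.sqrt_eq_rpow, ← Real.rpow_mul hl0.le]
          norm_num
      _ ≤ 2 * l ^ (-(1 / 8) : ℝ) := by
          gcongr
          calc (1 / 2 : ℝ) ^ (-(1 / 4) : ℝ) ≤ (1 / 2 : ℝ) ^ (-1 : ℝ) :=
                Real.rpow_le_rpow_of_exponent_ge (by norm_num) (by norm_num) (by norm_num)
            _ = 2 := by rw [Real.rpow_neg_one]; norm_num
  have h3 : w / α ≤ 2 * l ^ (-(1 / 8) : ℝ) := by
    have h4 := Real.quadratic_le_exp_of_nonneg hl0.le
    rw [← hα] at h4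
    have hα0 : 0 < α := by rw [hα]; exact Real.exp_pos _
    calc w / α ≤ 2 * (1 / l) := by
          rw [mul_one_div, div_le_div_iff₀ hα0 hl0]
          nlinarith
      _ ≤ _ := by gcongr
  linarith

set_option maxHeartbeats 1000000 in
theorem exists_sum_bl_dv_le : ∃ K : ℝ, 0 < K ∧ ∀ A B : ℝ, 0 < Real.log B →
    Real.exp 1 ≤ Real.log (Real.log B) → Real.log B ^ 2000 ≤ B → B ^ 2 * Real.log B < A →
    A ≤ B ^ 3 * ((Real.log B) ^ 4)⁻¹ * (Real.log (Real.log B))⁻¹ →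
    Real.log B ^ 8 * ∑ a ∈ bl A, dv (Real.log B) (WB B) B a ≤
      K * (A ^ 2 * B ^ 6 * Real.log (Real.log B) ^ (-(1 / 8) : ℝ)) := by
  classical
  obtain ⟨K, hK, hu⟩ := exists_sum_unbal_le
  refine ⟨81 * 4 + 4 * Real.pi * (12 * (5184 * 64 * 6 ^ 8) + 3 * (K * 4 + 5184 * 16 * 6 ^ 8)) +
    24 * (26 + 24 * 81) + (576 * 14 ^ 4 + 216) + 1296, by positivity, ?_⟩
  intro A B hα0 hl hB hBA hA
  obtain ⟨hw1, hw2, hW3⟩ := wB_bounds hα0 hl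
  have hexp : Real.log B = Real.exp (Real.log (Real.log B)) := (Real.exp_log hα0).symm
  have hWp : (0 : ℝ) < WB B := by exact_mod_cast WB_pos B
  have hdvd : ∀ n : ℤ, 0 < n → (n : ℝ) ≤ wB B → n ∣ (WB B : ℤ) := fun n => int_dvd_WB
  have hWZ : (0 : ℤ) < (WB B : ℤ) := by exact_mod_cast WB_pos B
  set α := Real.log B with hαd
  set l := Real.log α with hld
  set W : ℤ := (WB B : ℤ) with hWd
  have hWc : ((W : ℤ) : ℝ) = (WB B : ℝ) := by rw [hWd]; simp
  have he : (2 : ℝ) ≤ Real.exp 1 := by linarith [Real.add_one_le_exp (1 : ℝ)]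
  have hl2 : 2 ≤ l := he.trans hl
  have hα2 : 2 ≤ α := by rw [hexp]; linarith [Real.add_one_le_exp l]
  have hlα : l ≤ α := by rw [hexp]; linarith [Real.add_one_le_exp l]
  have hα1 : 1 ≤ α := by linarith
  have hB1 : 1 ≤ B := (one_le_pow₀ hα1).trans hB
  have hB0 : 0 < B := by linarith
  obtain ⟨hδ, hwδ⟩ := rpow_bounds (by linarith) hexp hw1 hw2
  set δ := l ^ (-(1 / 8) : ℝ) with hδd
  have hl0 : 0 < l := by linarith
  have hδ0 : 0 < δ := Real.rpow_pos_of_pos hl0 _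
  have hδα : 1 ≤ δ * α := by
    have : 1 / α ≤ δ := (one_div_le_one_div_of_le hl0 hlα).trans hδ
    rwa [div_le_iff₀ hα0] at this
  set T := B ^ (1 / 20 : ℝ) with hTd
  have hT20 : B = T ^ 20 := by
    rw [hTd, ← Real.rpow_natCast, ← Real.rpow_mul hB0.le]
    norm_num
  have hT0 : 0 < T := Real.rpow_pos_of_pos hB0 _
  have hTα : α ^ 100 ≤ T := by
    have : (α ^ 100) ^ 20 ≤ T ^ 20 := by rw [← hT20, ← pow_mul]; exact hB
    exact le_of_pow_le_pow_left₀ (by norm_num) hT0.le this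
  have hpow : ∀ k, k ≤ 100 → α ^ k ≤ T := fun k hk => (pow_le_pow_right₀ hα1 hk).trans hTα
  have hT1 : 1 ≤ T := by simpa using hpow 0 (by norm_num)
  have hT8 : 8 ≤ T := by
    calc (8 : ℝ) = 2 ^ 3 := by norm_num
      _ ≤ α ^ 3 := by gcongr
      _ ≤ T := hpow 3 (by norm_num)
  have hA0 : 0 < A := lt_trans (by positivity) hBA
  have hBA' : B ^ 2 ≤ A := by nlinarith
  have hTA : T ^ 40 ≤ A := by
    calc T ^ 40 = B ^ 2 := by rw [hT20]; ring
      _ ≤ A := hBA'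
  have hαW : α * W ≤ α ^ 4 := by
    rw [hWc]
    calc α * (WB B : ℝ) ≤ α * α ^ 3 := by gcongr
      _ = α ^ 4 := by ring
  have hαW0 : 0 < α * W := by rw [hWc]; positivity
  obtain ⟨hs1, hs2⟩ := size_cond hα2 hTα hT20 (rfl : α ^ 20 = α ^ 20)
  have hB2 : 2 ≤ B := by
    rw [hT20]
    calc (2 : ℝ) ≤ T ^ 1 := by linarith
      _ ≤ T ^ 20 := pow_le_pow_right₀ hT1 (by norm_num)
  have hL1 : 1 ≤ α ^ 20 := one_le_pow₀ hα1
  have hw0 : 0 < wB B := lt_of_lt_of_le (by positivity) hw1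
  have hU := hu B (α ^ 20) (wB B) W hB2 hL1 hw0 hα2 hs1 hs2 hdvd
  have hM := sum_mu_all_le hB2 hα2
  have hR := sum_inv_vn_PF_le hB2
  have hmain := sum_bl_dv_le (W := W) hB1 hα0 hWZ hT8
    (hαW.trans ((hpow 4 (by norm_num)).trans (by nlinarith)))
    (le_trans (pow_le_pow_right₀ hT1 (by norm_num)) hTA)
    (le_trans (by nlinarith) hBA')
  set M := ∑ p ∈ (PF B ×ˢ PF B).filter (fun p => gr p.1 p.2 ≠ 0), mu p.1 p.2
  set U := ∑ p ∈ (PF B ×ˢ PF B).filter (fun p => gr p.1 p.2 ≠ 0 ∧ Unbal α W p.1 p.2), mu p.1 p.2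
  set R := ∑ x ∈ PF B, 1 / vn x
  have hX : A * (α ^ 4 * l) ≤ B ^ 3 := by
    have h0 : 0 < α ^ 4 * l := by positivity
    rw [mul_assoc, ← mul_inv, ← div_eq_mul_inv, le_div_iff₀ h0] at hA
    exact hA
  have t1 : α ^ 8 * (81 * T ^ 12 * (B ^ 4 * (1 + α * W)) ^ 2) ≤ 81 * 4 * (A ^ 2 * B ^ 6 * δ) := by
    have h1 : 1 + α * W ≤ 2 * α ^ 4 := by linarith [one_le_pow₀ hα1 (n := 4)]
    calc _ ≤ α ^ 8 * (81 * T ^ 12 * (B ^ 4 * (2 * α ^ 4)) ^ 2) * (δ * α) := by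
          refine le_trans ?_ (le_mul_of_one_le_right (by positivity) hδα)
          gcongr
      _ = 81 * 4 * (T ^ 12 * α ^ 17 * B ^ 2 * B ^ 6 * δ) := by ring
      _ ≤ 81 * 4 * (T ^ 12 * T * B ^ 2 * B ^ 6 * δ) := by
          gcongr
          exact hpow 17 (by norm_num)
      _ = 81 * 4 * (T ^ 13 * B ^ 2 * B ^ 6 * δ) := by ring
      _ ≤ 81 * 4 * (T ^ 40 * B ^ 2 * B ^ 6 * δ) := by
          gcongr
          norm_num
      _ ≤ 81 * 4 * (A * A * B ^ 6 * δ) := by gcongr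
      _ = _ := by ring
  have t2 : α ^ 8 * (4 * Real.pi * A ^ 2 * (12 / T * M + 3 * U)) ≤
      4 * Real.pi * (12 * (5184 * 64 * 6 ^ 8) + 3 * (K * 4 + 5184 * 16 * 6 ^ 8)) *
        (A ^ 2 * B ^ 6 * δ) := by
    have h1 : α ^ 8 * (12 / T * M) ≤ 12 * (5184 * 64 * 6 ^ 8) * (B ^ 6 * δ) := by
      calc _ ≤ α ^ 8 * (12 / T * (5184 * 64 * 6 ^ 8 * B ^ 6 * α ^ 8)) * (δ * α) := by
            refine le_trans ?_ (le_mul_of_one_le_right (by positivity) hδα)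
            gcongr
        _ = 12 * (5184 * 64 * 6 ^ 8) * (B ^ 6 * δ) * (α ^ 17 / T) := by ring
        _ ≤ 12 * (5184 * 64 * 6 ^ 8) * (B ^ 6 * δ) * 1 := by
            gcongr
            exact div_le_one_of_le₀ (hpow 17 (by norm_num)) hT0.le
        _ = _ := by ring
    have h2 : α ^ 8 * U ≤ (K * 4 + 5184 * 16 * 6 ^ 8) * (B ^ 6 * δ) := by
      calc _ ≤ α ^ 8 * (K * (B ^ 6 / α ^ 8) * (4 * δ) +
            5184 * 16 * 6 ^ 8 * B ^ 6 * α ^ 8 * (1 / α ^ 20)) := by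
            gcongr
            refine hU.trans ?_
            gcongr
        _ = K * 4 * (B ^ 6 * δ) + 5184 * 16 * 6 ^ 8 * B ^ 6 * (1 / α ^ 4) := by
            field_simp
        _ ≤ K * 4 * (B ^ 6 * δ) + 5184 * 16 * 6 ^ 8 * B ^ 6 * δ := by
            gcongr
            rw [div_le_iff₀ (by positivity)]
            calc (1 : ℝ) ≤ δ * α := hδα
              _ = δ * α ^ 1 := by ring
              _ ≤ δ * α ^ 4 := by gcongr; norm_num [hα1]
        _ = _ := by ring
    calc _ = 4 * Real.pi * A ^ 2 * (α ^ 8 * (12 / T * M) + 3 * (α ^ 8 * U)) := by ring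
      _ ≤ 4 * Real.pi * A ^ 2 * (12 * (5184 * 64 * 6 ^ 8) * (B ^ 6 * δ) +
          3 * ((K * 4 + 5184 * 16 * 6 ^ 8) * (B ^ 6 * δ))) := by gcongr
      _ = _ := by ring
  have t3 : α ^ 8 * (24 * (A * T) * (26 * B ^ 8 / T ^ 3 + 24 * 81 * T ^ 12 * B ^ 6)) ≤
      24 * (26 + 24 * 81) * (A ^ 2 * B ^ 6 * δ) := by
    have h1 : B ^ 8 / T ^ 3 = T ^ 37 * B ^ 6 := by
      rw [div_eq_iff (by positivity), hT20]; ring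
    calc _ ≤ α ^ 8 * (24 * (A * T) * (26 * (B ^ 8 / T ^ 3) + 24 * 81 * T ^ 12 * B ^ 6)) * (δ * α) := by
          rw [mul_div_assoc]
          exact le_mul_of_one_le_right (by positivity) hδα
      _ ≤ α ^ 8 * (24 * (A * T) * (26 * (T ^ 37 * B ^ 6) + 24 * 81 * T ^ 37 * B ^ 6)) * (δ * α) := by
          rw [h1]
          gcongr
          norm_num
      _ = 24 * (26 + 24 * 81) * (A * (α ^ 9 * T ^ 38) * B ^ 6 * δ) := by ring
      _ ≤ 24 * (26 + 24 * 81) * (A * (T * T ^ 38) * B ^ 6 * δ) := by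
          gcongr
          exact hpow 9 (by norm_num)
      _ = 24 * (26 + 24 * 81) * (A * T ^ 39 * B ^ 6 * δ) := by ring
      _ ≤ 24 * (26 + 24 * 81) * (A * A * B ^ 6 * δ) := by
          gcongr
          exact (pow_le_pow_right₀ hT1 (by norm_num)).trans hTA
      _ = _ := by ring
  have t4 : α ^ 8 * (576 * A ^ 3 * R + 216 * A ^ 3 * B ^ 2) ≤
      (576 * 14 ^ 4 + 216) * (A ^ 2 * B ^ 6 * δ) := by
    have h0 : A ≤ B ^ 3 * δ := by
      calc A = A * (1 * l) * (1 / l) := by field_simp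
        _ ≤ A * (α ^ 4 * l) * (1 / l) := by gcongr; exact one_le_pow₀ hα1
        _ ≤ B ^ 3 * δ := by gcongr
    have h1 : A * α ^ 4 ≤ B ^ 3 * δ := by
      calc A * α ^ 4 = A * (α ^ 4 * l) * (1 / l) := by field_simp
        _ ≤ B ^ 3 * δ := by gcongr
    calc _ ≤ α ^ 8 * (576 * A ^ 3 * (14 ^ 4 * B ^ 3 / α ^ 4) + 216 * A ^ 3 * B ^ 2) := by gcongr
      _ = 576 * 14 ^ 4 * (A ^ 2 * (A * α ^ 4) * B ^ 3) + 216 * (A ^ 2 * A * (α ^ 8 * B ^ 2)) := by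
          field_simp
      _ ≤ 576 * 14 ^ 4 * (A ^ 2 * (B ^ 3 * δ) * B ^ 3) +
            216 * (A ^ 2 * (B ^ 3 * δ) * (B * B ^ 2)) := by
          gcongr
          exact (pow_le_pow_right₀ hα1 (by norm_num)).trans hB
      _ = _ := by ring
  have t5 : α ^ 8 * (1296 * B ^ 4 * (α * W) ^ 2 * (A ^ 2 * T)) ≤ 1296 * (A ^ 2 * B ^ 6 * δ) := by
    calc _ ≤ α ^ 8 * (1296 * B ^ 4 * (α ^ 4) ^ 2 * (A ^ 2 * T)) * (δ * α) := by
          refine le_trans ?_ (le_mul_of_one_le_right (by positivity) hδα)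
          gcongr
      _ = 1296 * (A ^ 2 * B ^ 4 * (α ^ 17 * T) * δ) := by ring
      _ ≤ 1296 * (A ^ 2 * B ^ 4 * (T * T) * δ) := by
          gcongr
          exact hpow 17 (by norm_num)
      _ = 1296 * (A ^ 2 * B ^ 4 * T ^ 2 * δ) := by ring
      _ ≤ 1296 * (A ^ 2 * B ^ 4 * T ^ 40 * δ) := by
          gcongr
          norm_num
      _ = 1296 * (A ^ 2 * B ^ 6 * δ) := by rw [hT20]; ring
  have h8 : 0 ≤ α ^ 8 := by positivity
  refine (mul_le_mul_of_nonneg_left hmain h8).trans ?_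
  linarith

theorem one_lt_log_three : 1 < Real.log 3 := by
  rw [Real.lt_log_iff_exp_lt (by norm_num)]
  linarith [Real.exp_one_lt_d9]

theorem wB_le_of_log_pow_lt {B : ℝ} (hB : 3 ≤ B)
    (h : Real.log B ^ 5 * Real.log (Real.log B) < B) : wB B ≤ 3 * Real.log (Real.log B) := by
  have hB0 : 0 < B := by linarith
  have hα1 : 1 < Real.log B := one_lt_log_three.trans_le (Real.log_le_log (by norm_num) hB)
  have hw : wB B = Real.log (Real.log B) / Real.log (Real.log (Real.log B)) := rfl
  have hBe : B = Real.exp (Real.log B) := (Real.exp_log hB0).symm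
  set α := Real.log B
  have hα0 : 0 < α := by linarith
  have hl0 : 0 < Real.log α := Real.log_pos hα1
  rw [hw]
  rcases le_or_gt α (Real.exp 1) with hα | hα
  · have hl : Real.log α ≤ 1 := (Real.log_le_iff_le_exp hα0).mpr hα
    exact (div_nonpos_of_nonneg_of_nonpos hl0.le (Real.log_nonpos hl0.le hl)).trans (by positivity)
  · have hl : 1 ≤ Real.log α := ((Real.lt_log_iff_exp_lt hα0).mpr hα).le
    have h5 : 5 < α := by
      by_contra! hc
      have h6 : Real.exp α ≤ α ^ 5 := by
        calc Real.exp α ≤ Real.exp 5 := Real.exp_le_exp.mpr hc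
          _ = Real.exp 1 ^ 5 := by rw [← Real.exp_nat_mul]; norm_num
          _ ≤ α ^ 5 := by gcongr
      rw [hBe] at h
      have : α ^ 5 ≤ α ^ 5 * Real.log α := le_mul_of_one_le_right (by positivity) hl
      linarith
    have h7 : 3 / 2 ≤ Real.log α := by
      rw [Real.le_log_iff_exp_le hα0]
      refine le_trans ?_ h5.le
      have h8 : Real.exp (3 / 2) ^ 2 = Real.exp 1 ^ 3 := by
        rw [← Real.exp_nat_mul, ← Real.exp_nat_mul]; norm_num
      have h9 : Real.exp 1 ^ 3 ≤ 3 ^ 3 := by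
        gcongr
        linarith [Real.exp_one_lt_d9]
      have h10 : Real.exp 1 ^ 3 ≤ 2.72 ^ 3 := by
        gcongr
        linarith [Real.exp_one_lt_d9]
      refine le_of_sq_le_sq ?_ (by norm_num)
      rw [h8]
      norm_num at h10 ⊢
      linarith
    have h8 : 1 / 3 ≤ Real.log (Real.log α) := by
      have h9 := Real.one_sub_inv_le_log_of_pos hl0
      have : (Real.log α)⁻¹ ≤ (3 / 2)⁻¹ := inv_anti₀ (by norm_num) h7
      linarith
    rw [div_le_iff₀ (by linarith)]
    nlinarith

theorem exists_sum_bl_dv_le_of_le (B₀ : ℝ) : ∃ K : ℝ, 0 < K ∧ ∀ A B : ℝ, 3 ≤ B → B ≤ B₀ →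
    B ^ 2 * Real.log B < A →
    A ≤ B ^ 3 * ((Real.log B) ^ 4)⁻¹ * (Real.log (Real.log B))⁻¹ →
    Real.log B ^ 8 * ∑ a ∈ bl A, dv (Real.log B) (WB B) B a ≤
      K * (A ^ 2 * B ^ 6 * Real.log (Real.log B) ^ (-(1 / 8) : ℝ)) := by
  set α₀ := Real.log B₀ with hα₀
  set l₀ := Real.log (Real.log 3)
  set l₁ := Real.log (Real.log B₀)
  set M := 1 + 3 * l₁
  have hl₀ : 0 < l₀ := Real.log_pos one_lt_log_three
  refine ⟨81 * (B₀ ^ 4 * (1 + α₀ * M ^ (3 * M))) ^ 2 / l₀ ^ 2 * (1 + |l₁|) + 1, by positivity, ?_⟩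
  intro A B hB hBB hBA hA
  have hB0 : 0 < B := by linarith
  have hα1 : 1 < Real.log B := one_lt_log_three.trans_le (Real.log_le_log (by norm_num) hB)
  have hαα : Real.log B ≤ α₀ := Real.log_le_log hB0 hBB
  have hll : Real.log (Real.log B) ≤ l₁ := Real.log_le_log (by linarith) hαα
  have hll0 : l₀ ≤ Real.log (Real.log B) :=
    Real.log_le_log (by linarith [one_lt_log_three]) (Real.log_le_log (by norm_num) hB)
  have hd := fun a => dv_le (α := Real.log B) (W := (WB B : ℤ)) (B := B) (by linarith) (by positivity)
    hB0.le a
  have hw := wB_le_of_log_pow_lt hB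
  set α := Real.log B
  set l := Real.log α
  have hl0 : 0 < l := by linarith
  have hα0 : 0 < α := by linarith
  have hX : A * (α ^ 4 * l) ≤ B ^ 3 := by
    have h0 : 0 < α ^ 4 * l := by positivity
    rw [mul_assoc, ← mul_inv, ← div_eq_mul_inv, le_div_iff₀ h0] at hA
    exact hA
  have h5 : α ^ 5 * l < B := by
    have : B ^ 2 * (α ^ 5 * l) < B ^ 2 * B := by
      calc B ^ 2 * (α ^ 5 * l) = B ^ 2 * α * (α ^ 4 * l) := by ring
        _ < A * (α ^ 4 * l) := by gcongr
        _ ≤ B ^ 3 := hX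
        _ = _ := by ring
    exact lt_of_mul_lt_mul_left this (by positivity)
  have hA1 : 1 ≤ A := by nlinarith
  have hα₀0 : 0 ≤ α₀ := by linarith
  have hM1 : 1 ≤ M := by simp only [M]; linarith
  have hW : (WB B : ℝ) ≤ M ^ (3 * M) := WB_le hM1 ((hw h5).trans (by simp only [M]; linarith))
  set D := B₀ ^ 4 * (1 + α₀ * M ^ (3 * M))
  have hD : ∀ a, dv α (WB B) B a ≤ D ^ 2 := fun a => (hd a).trans (by
    push_cast
    simp only [D]
    gcongr)
  have hs : ∑ a ∈ bl A, dv α (WB B) B a ≤ 81 * A ^ 4 * D ^ 2 := by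
    calc _ ≤ ∑ a ∈ bl A, D ^ 2 := Finset.sum_le_sum fun a _ => hD a
      _ = (bl A).card * D ^ 2 := by rw [Finset.sum_const, nsmul_eq_mul]
      _ ≤ _ := by gcongr; exact card_bl_le hA1
  have hA2 : α ^ 8 * A ^ 2 ≤ B ^ 6 / l ^ 2 := by
    rw [le_div_iff₀ (by positivity)]
    calc α ^ 8 * A ^ 2 * l ^ 2 = (A * (α ^ 4 * l)) ^ 2 := by ring
      _ ≤ (B ^ 3) ^ 2 := by gcongr
      _ = B ^ 6 := by ring
  have hδ0 : 0 < l ^ (-(1 / 8) : ℝ) := Real.rpow_pos_of_pos hl0 _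
  have hδ : 1 ≤ (1 + |l₁|) * l ^ (-(1 / 8) : ℝ) := by
    have h1 : l ^ (1 / 8 : ℝ) ≤ 1 + |l₁| := by
      calc l ^ (1 / 8 : ℝ) ≤ (1 + |l₁|) ^ (1 / 8 : ℝ) := by
            gcongr
            linarith [le_abs_self l₁]
        _ ≤ (1 + |l₁|) ^ (1 : ℝ) := Real.rpow_le_rpow_of_exponent_le
            (by linarith [abs_nonneg l₁]) (by norm_num)
        _ = _ := Real.rpow_one _
    rw [Real.rpow_neg hl0.le, ← div_eq_mul_inv, one_le_div (Real.rpow_pos_of_pos hl0 _)]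
    exact h1
  calc α ^ 8 * ∑ a ∈ bl A, dv α (WB B) B a ≤ α ^ 8 * (81 * A ^ 4 * D ^ 2) := by gcongr
    _ = 81 * D ^ 2 * A ^ 2 * (α ^ 8 * A ^ 2) := by ring
    _ ≤ 81 * D ^ 2 * A ^ 2 * (B ^ 6 / l₀ ^ 2) * ((1 + |l₁|) * l ^ (-(1 / 8) : ℝ)) := by
        refine le_trans ?_ (le_mul_of_one_le_right (by positivity) hδ)
        gcongr
        exact hA2.trans (by gcongr)
    _ = 81 * D ^ 2 / l₀ ^ 2 * (1 + |l₁|) * (A ^ 2 * B ^ 6 * l ^ (-(1 / 8) : ℝ)) := by ring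
    _ ≤ _ := by
        gcongr
        linarith

theorem eventually_large : ∀ᶠ B : ℝ in atTop, 0 < Real.log B ∧
    Real.exp 1 ≤ Real.log (Real.log B) ∧ Real.log B ^ 2000 ≤ B := by
  have h1 : Tendsto (fun B : ℝ => Real.log (Real.log B)) atTop atTop :=
    Real.tendsto_log_atTop.comp Real.tendsto_log_atTop
  have h2 := (Real.isLittleO_pow_log_id_atTop (n := 2000)).bound (c := 1) one_pos
  filter_upwards [Real.tendsto_log_atTop.eventually_gt_atTop 0, h1.eventually_ge_atTop (Real.exp 1), h2,
    eventually_ge_atTop 0] with B h3 h4 h5 h6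
  refine ⟨h3, h4, ?_⟩
  rw [one_mul, id, Real.norm_of_nonneg (by positivity), Real.norm_of_nonneg h6] at h5
  exact h5

/-- Proposition 2.1: the variance upper bound. -/
theorem variance_upper_bound :
    ∃ C > (0 : ℝ), ∃ K > (0 : ℝ), ∀ A B : ℝ, 3 ≤ B →
      B ^ 2 * Real.log B < A →
      A ≤ B ^ 3 * ((Real.log B) ^ 4)⁻¹ * (Real.log (Real.log B))⁻¹ →
      ∑ᶠ a ∈ primA A, |NB a B - NlocB a B| ^ 2 ≤
        K * A ^ 2 * B ^ 6 / (Real.log (Real.log B)) ^ C := by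
  obtain ⟨B₀, hB₀⟩ := eventually_atTop.mp eventually_large
  obtain ⟨K₁, hK₁, h₁⟩ := exists_sum_bl_dv_le
  obtain ⟨K₂, hK₂, h₂⟩ := exists_sum_bl_dv_le_of_le B₀
  refine ⟨1 / 8, by norm_num, K₁ + K₂, by positivity, fun A B hB hBA hA => ?_⟩
  have hB0 : 0 < B := by linarith
  have hα1 : 1 < Real.log B := one_lt_log_three.trans_le (Real.log_le_log (by norm_num) hB)
  have hl0 : 0 < Real.log (Real.log B) := Real.log_pos hα1
  have hA0 : 0 < A := lt_trans (by positivity) hBA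
  have hδ0 : 0 < Real.log (Real.log B) ^ (-(1 / 8) : ℝ) := Real.rpow_pos_of_pos hl0 _
  have e : (K₁ + K₂) * A ^ 2 * B ^ 6 / Real.log (Real.log B) ^ (1 / 8 : ℝ) =
      (K₁ + K₂) * (A ^ 2 * B ^ 6 * Real.log (Real.log B) ^ (-(1 / 8) : ℝ)) := by
    rw [Real.rpow_neg hl0.le]
    ring
  rw [e]
  refine (finsum_primA_le hA0.le hB0.le).trans ?_
  rcases le_total B B₀ with hc | hc
  · refine (h₂ A B hB hc hBA hA).trans ?_
    gcongr
    linarith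
  · obtain ⟨h3, h4, h5⟩ := hB₀ B hc
    refine (h₁ A B h3 h4 h5 hBA hA).trans ?_
    gcongr
    linarith
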